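/- Carleson estimate in Hölder domains (Lemma 3.2): Let α∈(1/2,1] and K>0. There exists a constant C>0 depending only on n, λ, Λ, α and K such that the following holds. Assume [g]_{C^{α,α/(1+α)}} ≤ K, and let u be a positive solution of u_t = Lu in 𝒞₁ vanishing continuously on Γ. Then sup over 𝒞_{1/2} of u is at most C·u(Ē). -/

import Mathlib

noncomputable section
open scoped BigOperators
open Classical

abbrev Spc (m : ℕ) := EuclideanSpace ℝ (Fin (m + 1))
abbrev Spc' (m : ℕ) := EuclideanSpace ℝ (Fin m)

/-- The horizontal coordinates `x' ∈ ℝ^{n-1}` of a point `x ∈ ℝⁿ`. -/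
def xprime {m : ℕ} (x : Spc m) : Spc' m :=
  (WithLp.equiv 2 _).symm fun i => x i.castSucc

/-- The last (vertical) coordinate `x_n` of a point `x ∈ ℝⁿ`. -/
def xlast {m : ℕ} (x : Spc m) : ℝ := x (Fin.last m)

/-- Build a point of `ℝⁿ` from `x' ∈ ℝ^{n-1}` and the vertical coordinate. -/
def mkPt {m : ℕ} (x' : Spc' m) (xn : ℝ) : Spc m :=
  (WithLp.equiv 2 _).symm fun i => if h : i = Fin.last m then xn else x' (i.castPred h)

/-- The `i`-th standard basis vector. -/
def eVec (m : ℕ) (i : Fin (m + 1)) : Spc m := EuclideanSpace.single i 1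

/-- The entry `∂²u/∂xᵢ∂xⱼ` of the spatial Hessian of `u(x,t)` at `p = (x,t)`. -/
def sHess {m : ℕ} (u : Spc m × ℝ → ℝ) (p : Spc m × ℝ) (i j : Fin (m + 1)) : ℝ :=
  fderiv ℝ (fun y => fderiv ℝ (fun z => u (z, p.2)) y (eVec m j)) p.1 (eVec m i)

/-- The operator `Lu = tr(A(x) D²ₓu)` at the point `p = (x,t)`. -/
def Lop {m : ℕ} (A : Spc m → Matrix (Fin (m + 1)) (Fin (m + 1)) ℝ)
    (u : Spc m × ℝ → ℝ) (p : Spc m × ℝ) : ℝ :=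
  ∑ i, ∑ j, A p.1 i j * sHess u p j i

/-- Uniform ellipticity with symmetric coefficients: `λ|ξ|² ≤ ξ·A(x)ξ ≤ Λ|ξ|²`. -/
def IsElliptic {m : ℕ} (lam Lam : ℝ)
    (A : Spc m → Matrix (Fin (m + 1)) (Fin (m + 1)) ℝ) : Prop :=
  (∀ x, (A x).IsSymm) ∧
  ∀ (x ξ : Spc m),
    lam * ‖ξ‖ ^ 2 ≤ ∑ i, ∑ j, ξ i * A x i j * ξ j ∧
      ∑ i, ∑ j, ξ i * A x i j * ξ j ≤ Lam * ‖ξ‖ ^ 2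

/-- `u` is (pointwise) a solution of `u_t = Lu` on `Ω`: twice continuously
differentiable in `x`, differentiable in `t`, with `∂ₜu = tr(A(x)D²ₓu)`. -/
def SolvesL {m : ℕ} (A : Spc m → Matrix (Fin (m + 1)) (Fin (m + 1)) ℝ)
    (u : Spc m × ℝ → ℝ) (Ω : Set (Spc m × ℝ)) : Prop :=
  ∀ p ∈ Ω, ContDiffAt ℝ 2 (fun y => u (y, p.2)) p.1 ∧
    HasDerivAt (fun s => u (p.1, s)) (Lop A u p) p.2

/-- `u` is a pointwise subsolution: `u_t ≤ Lu` on `Ω`. -/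
def SubSolvesL {m : ℕ} (A : Spc m → Matrix (Fin (m + 1)) (Fin (m + 1)) ℝ)
    (u : Spc m × ℝ → ℝ) (Ω : Set (Spc m × ℝ)) : Prop :=
  ∀ p ∈ Ω, ContDiffAt ℝ 2 (fun y => u (y, p.2)) p.1 ∧
    DifferentiableAt ℝ (fun s => u (p.1, s)) p.2 ∧
    deriv (fun s => u (p.1, s)) p.2 ≤ Lop A u p

/-- `u` solves the heat equation `∂ₜu = Δu` on `Ω`. -/
def SolvesHeat {m : ℕ} (u : Spc m × ℝ → ℝ) (Ω : Set (Spc m × ℝ)) : Prop :=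
  ∀ p ∈ Ω, ContDiffAt ℝ 2 (fun y => u (y, p.2)) p.1 ∧
    HasDerivAt (fun s => u (p.1, s)) (∑ i, sHess u p i i) p.2

/-- The graph `Γ = {x_n = g(x',t)}`. -/
def graphSet {m : ℕ} (g : Spc' m → ℝ → ℝ) : Set (Spc m × ℝ) :=
  {p | xlast p.1 = g (xprime p.1) p.2}

/-- The cylinder `𝒞_r` of size `r` on top of the graph of `g`. -/
def Cyl {m : ℕ} (g : Spc' m → ℝ → ℝ) (r : ℝ) : Set (Spc m × ℝ) :=
  {p | ‖xprime p.1‖ < r ∧ -r ^ 2 < p.2 ∧ p.2 < r ^ 2 ∧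
    g (xprime p.1) p.2 < xlast p.1 ∧ xlast p.1 < g (xprime p.1) p.2 + r}

/-- The point `Ē = ((0', g(0',1/2) + 1/2), 1/2)`. -/
def Ebar {m : ℕ} (g : Spc' m → ℝ → ℝ) : Spc m × ℝ := (mkPt 0 (g 0 (1 / 2) + 1 / 2), 1 / 2)

/-- The point `E̲ = ((0', g(0',−1/2) + 1/2), −1/2)`. -/
def Eund {m : ℕ} (g : Spc' m → ℝ → ℝ) : Spc m × ℝ := (mkPt 0 (g 0 (-(1 / 2)) + 1 / 2), -(1 / 2))

/-- `u` vanishes continuously on `Γ`: `u(Q) → 0` as `Q → P` within `Ω`,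
for every `P ∈ Γ` in the closure of `Ω`. -/
def VanishesOn {m : ℕ} (u : Spc m × ℝ → ℝ) (Ω Γ : Set (Spc m × ℝ)) : Prop :=
  ∀ P ∈ Γ ∩ closure Ω, Filter.Tendsto u (nhdsWithin P Ω) (nhds 0)

/-- `[g]_{C^{α,β}} ≤ K`. -/
def HolderSemi {m : ℕ} (α β K : ℝ) (g : Spc' m → ℝ → ℝ) : Prop :=
  ∀ x' y' t s, |g x' t - g y' s| ≤ K * (‖x' - y'‖ ^ α + |t - s| ^ β)

/-- The backward-in-time cylinder `𝒞_r^−` (Lipschitz setting, parabolic scaling). -/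
def CylB {m : ℕ} (g : Spc' m → ℝ → ℝ) (r : ℝ) : Set (Spc m × ℝ) :=
  {p | (∀ i : Fin m, -r < xprime p.1 i ∧ xprime p.1 i < r) ∧ -r ^ 2 < p.2 ∧ p.2 ≤ 0 ∧
    g (xprime p.1) p.2 < xlast p.1 ∧ xlast p.1 < g (xprime p.1) p.2 + r}

/-- The set `𝒜_r` of points of `𝒞_r^−` at height at least `δr` above `Γ`. -/
def ASet {m : ℕ} (g : Spc' m → ℝ → ℝ) (δ r : ℝ) : Set (Spc m × ℝ) :=
  {p ∈ CylB g r | g (xprime p.1) p.2 + δ * r ≤ xlast p.1}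

/-- The backward-in-time cylinder `𝒞_r^−` (Hölder setting, time interval `(−r,0]`). -/
def CylBH {m : ℕ} (g : Spc' m → ℝ → ℝ) (r : ℝ) : Set (Spc m × ℝ) :=
  {p | (∀ i : Fin m, -r < xprime p.1 i ∧ xprime p.1 i < r) ∧ -r < p.2 ∧ p.2 ≤ 0 ∧
    g (xprime p.1) p.2 < xlast p.1 ∧ xlast p.1 < g (xprime p.1) p.2 + r}

/-- The set `𝒜_r` of points of the Hölder cylinder `𝒞_r^−` at height at least `r^β` above `Γ`. -/
def ASetH {m : ℕ} (g : Spc' m → ℝ → ℝ) (β r : ℝ) : Set (Spc m × ℝ) :=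
  {p ∈ CylBH g r | g (xprime p.1) p.2 + r ^ β ≤ xlast p.1}

/-- The height `h_Γ(x,t) = x_n − g(x',t)` above the graph. -/
def hGamma {m : ℕ} (g : Spc' m → ℝ → ℝ) (p : Spc m × ℝ) : ℝ :=
  xlast p.1 - g (xprime p.1) p.2

section Auxiliary

open Set Filter Topology Metric Module MeasureTheory

set_option linter.unusedSectionVars false

section Basics

variable {E : Type*} [NormedAddCommGroup E] [InnerProductSpace ℝ E] [FiniteDimensional ℝ E]

/-- Second derivative of `f` at `x` in the direction `v`. -/
def dir2 (f : E → ℝ) (x v : E) : ℝ := deriv (deriv fun s : ℝ => f (x + s • v)) 0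

/-- The operator `∑ σₖ ∂²/∂bₖ²` for an orthonormal basis `b`. -/
def trA (b : OrthonormalBasis (Fin (finrank ℝ E)) ℝ E) (σ : Fin (finrank ℝ E) → ℝ) (f : E → ℝ)
    (x : E) : ℝ := ∑ k, σ k * dir2 f x (b k)

theorem dir2_congr {f g : E → ℝ} {x : E} (h : f =ᶠ[𝓝 x] g) (v : E) : dir2 f x v = dir2 g x v := by
  have hc : Tendsto (fun s : ℝ => x + s • v) (𝓝 0) (𝓝 x) := by
    have : Continuous (fun s : ℝ => x + s • v) := by fun_prop
    simpa using this.tendsto 0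
  have h1 : (fun s : ℝ => f (x + s • v)) =ᶠ[𝓝 0] fun s => g (x + s • v) := by
    filter_upwards [hc.eventually (p := fun y => f y = g y) h] with s hs using hs
  exact h1.deriv.deriv_eq

theorem dir2_affine (f : E → ℝ) (x v : E) (c d : ℝ) :
    dir2 (fun y => c * f y + d) x v = c * dir2 f x v := by
  unfold dir2
  have : deriv (fun s : ℝ => c * f (x + s • v) + d) = fun s => c * deriv (fun s => f (x + s • v)) s := by
    funext s
    rw [deriv_add_const, deriv_const_mul_field]
  rw [this, deriv_const_mul_field]

theorem dir2_scale (f : E → ℝ) (z y v : E) (r : ℝ) :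
    dir2 (fun y => f (z + r • y)) y v = r ^ 2 * dir2 f (z + r • y) v := by
  unfold dir2
  have h0 : (fun s : ℝ => f (z + r • (y + s • v))) =
      fun s => (fun s => f (z + r • y + s • v)) (r * s) := by
    funext s; simp only [smul_add, mul_smul, add_assoc]
  have h1 : deriv (fun s : ℝ => f (z + r • (y + s • v))) =
      fun s => r * deriv (fun s => f (z + r • y + s • v)) (r * s) := by
    rw [h0]; funext s
    exact deriv_comp_mul_left r (fun s => f (z + r • y + s • v)) s
  rw [h1, deriv_const_mul_field, deriv_comp_mul_left r (deriv fun s => f (z + r • y + s • v)) 0]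
  simp; ring

theorem line_differentiable {f : E → ℝ} {x : E} (hf : ContDiffAt ℝ 2 f x) (v : E) :
    (∀ᶠ s : ℝ in 𝓝 0, HasDerivAt (fun s : ℝ => f (x + s • v)) (fderiv ℝ f (x + s • v) v) s) ∧
    HasDerivAt (fun s : ℝ => fderiv ℝ f (x + s • v) v) (fderiv ℝ (fderiv ℝ f) x v v) 0 := by
  have hl : ∀ s : ℝ, HasDerivAt (fun s : ℝ => x + s • v) v s := fun s => by
    simpa using ((hasDerivAt_id s).smul_const v).const_add x
  have hc : Tendsto (fun s : ℝ => x + s • v) (𝓝 0) (𝓝 x) := by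
    simpa using (hl 0).continuousAt.tendsto
  constructor
  · have h1 : ∀ᶠ y in 𝓝 x, DifferentiableAt ℝ f y := by
      filter_upwards [hf.eventually (by simp)] with y hy
      exact hy.differentiableAt (by simp)
    filter_upwards [hc.eventually h1] with s hs
    exact hs.hasFDerivAt.comp_hasDerivAt s (hl s)
  · have h2 : DifferentiableAt ℝ (fderiv ℝ f) x :=
      (hf.fderiv_right (m := 1) (by norm_num)).differentiableAt (by simp)
    have h3 : HasDerivAt (fun s : ℝ => fderiv ℝ f (x + s • v)) (fderiv ℝ (fderiv ℝ f) x v) 0 := by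
      have : HasFDerivAt (fderiv ℝ f) (fderiv ℝ (fderiv ℝ f) x) (x + (0:ℝ) • v) := by
        simpa using h2.hasFDerivAt
      exact this.comp_hasDerivAt 0 (hl 0)
    exact h3.clm_apply (hasDerivAt_const _ v) |>.congr_deriv (by simp)

theorem dir2_eq_fderiv {f : E → ℝ} {x : E} (hf : ContDiffAt ℝ 2 f x) (v : E) :
    dir2 f x v = fderiv ℝ (fderiv ℝ f) x v v := by
  obtain ⟨h1, h2⟩ := line_differentiable hf v
  have : deriv (fun s : ℝ => f (x + s • v)) =ᶠ[𝓝 0] fun s => fderiv ℝ f (x + s • v) v := by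
    filter_upwards [h1] with s hs using hs.deriv
  unfold dir2
  rw [this.deriv_eq, h2.deriv]

theorem dir2_add {f g : E → ℝ} {x : E} (hf : ContDiffAt ℝ 2 f x) (hg : ContDiffAt ℝ 2 g x) (v : E) :
    dir2 (fun y => f y + g y) x v = dir2 f x v + dir2 g x v := by
  obtain ⟨h1, h2⟩ := line_differentiable hf v
  obtain ⟨k1, k2⟩ := line_differentiable hg v
  have : deriv (fun s : ℝ => f (x + s • v) + g (x + s • v)) =ᶠ[𝓝 0]
      fun s => fderiv ℝ f (x + s • v) v + fderiv ℝ g (x + s • v) v := by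
    filter_upwards [h1, k1] with s hs ks using (hs.add ks).deriv
  rw [dir2_eq_fderiv hf, dir2_eq_fderiv hg]
  unfold dir2
  rw [this.deriv_eq]
  exact (h2.add k2).deriv

theorem dir2_nonneg_of_isLocalMin {f : E → ℝ} {x : E} (hf : ContDiffAt ℝ 2 f x)
    (hm : IsLocalMin f x) (v : E) : 0 ≤ dir2 f x v := by
  by_contra! hneg
  set φ : ℝ → ℝ := fun s => f (x + s • v) with hφ
  have hl : Continuous (fun s : ℝ => x + s • v) := by fun_prop
  have hc : Tendsto (fun s : ℝ => x + s • v) (𝓝 0) (𝓝 x) := by simpa using hl.tendsto 0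
  have hmin : IsLocalMin φ 0 := by
    have := hc.eventually hm
    filter_upwards [this] with s hs
    simpa [hφ] using hs
  have hcont : ContinuousAt φ 0 := by
    have : ContinuousAt f (x + (0:ℝ) • v) := by simpa using hf.continuousAt
    exact ContinuousAt.comp (f := fun s : ℝ => x + s • v) this hl.continuousAt
  have hd0 : deriv φ 0 = 0 := hmin.deriv_eq_zero
  have hmax : IsLocalMax φ 0 := by
    have := isLocalMin_of_deriv_deriv_pos (f := fun s => - φ s) (x₀ := 0) (by
      have : deriv (fun s => - φ s) = fun s => - deriv φ s := by funext s; exact deriv.fun_neg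
      rw [this, deriv.fun_neg]
      unfold dir2 at hneg
      linarith) (by rw [deriv.fun_neg, hd0, neg_zero]) hcont.neg
    filter_upwards [this] with s hs
    linarith
  have heq : φ =ᶠ[𝓝 0] fun _ => φ 0 := by
    filter_upwards [hmin, hmax] with s h1 h2 using le_antisymm h2 h1
  have : deriv (deriv φ) 0 = 0 := by
    have h1 : deriv φ =ᶠ[𝓝 0] deriv fun _ => φ 0 := heq.deriv
    rw [h1.deriv_eq]; simp
  unfold dir2 at hneg
  exact absurd this hneg.ne

theorem trA_congr (b : OrthonormalBasis (Fin (finrank ℝ E)) ℝ E) (σ) {f g : E → ℝ} {x : E}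
    (h : f =ᶠ[𝓝 x] g) : trA b σ f x = trA b σ g x := by
  unfold trA; exact Finset.sum_congr rfl fun k _ => by rw [dir2_congr h]

theorem trA_affine (b : OrthonormalBasis (Fin (finrank ℝ E)) ℝ E) (σ) (f : E → ℝ) (x : E) (c d : ℝ) :
    trA b σ (fun y => c * f y + d) x = c * trA b σ f x := by
  unfold trA; simp only [dir2_affine, Finset.mul_sum]
  exact Finset.sum_congr rfl fun k _ => by ring

theorem trA_scale (b : OrthonormalBasis (Fin (finrank ℝ E)) ℝ E) (σ) (f : E → ℝ) (z y : E) (r : ℝ) :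
    trA b σ (fun y => f (z + r • y)) y = r ^ 2 * trA b σ f (z + r • y) := by
  unfold trA; simp only [dir2_scale, Finset.mul_sum]
  exact Finset.sum_congr rfl fun k _ => by ring

theorem trA_add (b : OrthonormalBasis (Fin (finrank ℝ E)) ℝ E) (σ) {f g : E → ℝ} {x : E}
    (hf : ContDiffAt ℝ 2 f x) (hg : ContDiffAt ℝ 2 g x) :
    trA b σ (fun y => f y + g y) x = trA b σ f x + trA b σ g x := by
  unfold trA; simp only [dir2_add hf hg, mul_add, Finset.sum_add_distrib]

theorem trA_nonneg_of_isLocalMin (b : OrthonormalBasis (Fin (finrank ℝ E)) ℝ E) {σ} (hσ : ∀ k, 0 ≤ σ k)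
    {f : E → ℝ} {x : E} (hf : ContDiffAt ℝ 2 f x) (hm : IsLocalMin f x) : 0 ≤ trA b σ f x :=
  Finset.sum_nonneg fun k _ => mul_nonneg (hσ k) (dir2_nonneg_of_isLocalMin hf hm _)

/-- At `p`, the function `u` is spatially `C²` and satisfies `u_t = tr(A D²u)` for some symmetric
matrix `A` with eigenvalues in `[lam, Lam]`. -/
def SolAt (lam Lam : ℝ) (u : E × ℝ → ℝ) (p : E × ℝ) : Prop :=
  ContDiffAt ℝ 2 (fun y => u (y, p.2)) p.1 ∧
  ∃ (b : OrthonormalBasis (Fin (finrank ℝ E)) ℝ E) (σ : Fin (finrank ℝ E) → ℝ),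
    (∀ k, lam ≤ σ k ∧ σ k ≤ Lam) ∧
    HasDerivAt (fun s => u (p.1, s)) (trA b σ (fun y => u (y, p.2)) p.1) p.2

theorem SolAt.affine {lam Lam : ℝ} {u : E × ℝ → ℝ} {p : E × ℝ} (h : SolAt lam Lam u p) (c d : ℝ) :
    SolAt lam Lam (fun q => c * u q + d) p := by
  obtain ⟨h1, b, σ, hσ, h2⟩ := h
  refine ⟨(contDiffAt_const.mul h1).add contDiffAt_const, b, σ, hσ, ?_⟩
  rw [trA_affine]
  exact (h2.const_mul c).add_const d

theorem SolAt.scale {lam Lam : ℝ} {u : E × ℝ → ℝ} {x : E} {t : ℝ} {r : ℝ} {y : E} {τ : ℝ}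
    (h : SolAt lam Lam u (x + r • y, t + r ^ 2 * τ)) :
    SolAt lam Lam (fun q => u (x + r • q.1, t + r ^ 2 * q.2)) (y, τ) := by
  obtain ⟨h1, b, σ, hσ, h2⟩ := h
  refine ⟨?_, b, σ, hσ, ?_⟩
  · exact ContDiffAt.comp (f := fun y => x + r • y) y h1 (by fun_prop)
  · have e := trA_scale b σ (fun y => u (y, t + r ^ 2 * τ)) x y r
    have : HasDerivAt (fun s => t + r ^ 2 * s) (r ^ 2) τ := by
      simpa using ((hasDerivAt_id τ).const_mul (r ^ 2)).const_add t
    have := HasDerivAt.comp τ (h₂ := fun s => u (x + r • y, s)) h2 this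
    exact this.congr_deriv (by rw [e]; ring)

theorem SolAt.congr {lam Lam : ℝ} {u v : E × ℝ → ℝ} {p : E × ℝ} (h : SolAt lam Lam u p)
    (he : v =ᶠ[𝓝 p] u) : SolAt lam Lam v p := by
  obtain ⟨h1, b, σ, hσ, h2⟩ := h
  have hx : (fun y => v (y, p.2)) =ᶠ[𝓝 p.1] fun y => u (y, p.2) := by
    have : Tendsto (fun y : E => (y, p.2)) (𝓝 p.1) (𝓝 p) :=
      (Continuous.prodMk_left p.2).tendsto' _ _ rfl
    exact this.eventually he
  have ht : (fun s => v (p.1, s)) =ᶠ[𝓝 p.2] fun s => u (p.1, s) := by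
    have : Tendsto (fun s : ℝ => (p.1, s)) (𝓝 p.2) (𝓝 p) :=
      (Continuous.prodMk_right p.1).tendsto' _ _ rfl
    exact this.eventually he
  refine ⟨h1.congr_of_eventuallyEq hx, b, σ, hσ, ?_⟩
  rw [trA_congr b σ hx]
  exact h2.congr_of_eventuallyEq ht

theorem left_deriv_nonpos {f : ℝ → ℝ} {t f' : ℝ} (h : HasDerivWithinAt f f' (Iic t) t)
    (hm : ∀ᶠ s in 𝓝[<] t, f t ≤ f s) : f' ≤ 0 := by
  have h1 := (hasDerivWithinAt_iff_tendsto_slope.1 h)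
  have : Iic t \ {t} = Iio t := by ext; simp [lt_iff_le_and_ne]
  rw [this] at h1
  refine le_of_tendsto h1 ?_
  filter_upwards [hm, self_mem_nhdsWithin] with s hs hs'
  rw [slope_def_field]
  exact div_nonpos_of_nonneg_of_nonpos (by linarith) (by linarith [show s < t from hs'])

theorem comparison_principle {x0 : E} {R t0 t1 : ℝ} (w : E × ℝ → ℝ)
    (hc : ContinuousOn w (closedBall x0 R ×ˢ Icc t0 t1))
    (hinit : ∀ x ∈ closedBall x0 R, 0 ≤ w (x, t0))
    (hlat : ∀ x t, dist x x0 = R → t ∈ Icc t0 t1 → 0 ≤ w (x, t))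
    (h_interior : ∀ x ∈ ball x0 R, ∀ t ∈ Ioc t0 t1, w (x, t) < 0 →
      ContDiffAt ℝ 2 (fun y => w (y, t)) x ∧ ∃ (w' : ℝ)
        (b : OrthonormalBasis (Fin (finrank ℝ E)) ℝ E) (σ : Fin (finrank ℝ E) → ℝ),
        HasDerivWithinAt (fun s => w (x, s)) w' (Iic t) t ∧ (∀ k, 0 ≤ σ k) ∧
        trA b σ (fun y => w (y, t)) x < w') :
    ∀ p ∈ closedBall x0 R ×ˢ Icc t0 t1, 0 ≤ w p := by
  intro p hp
  obtain ⟨⟨x, t⟩, hq, hqmin⟩ := ((isCompact_closedBall x0 R).prod isCompact_Icc).exists_isMinOn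
    ⟨p, hp⟩ hc
  refine le_trans ?_ (hqmin hp)
  by_contra! hneg
  have hx : x ∈ ball x0 R := by
    rcases lt_or_eq_of_le (mem_closedBall.1 hq.1) with h | h
    · exact h
    · exact absurd (hlat x t h hq.2) (not_le.2 hneg)
  have ht : t ∈ Ioc t0 t1 := by
    refine ⟨lt_of_le_of_ne hq.2.1 ?_, hq.2.2⟩
    intro h
    have := hinit x hq.1
    rw [show t0 = t from h] at this
    exact absurd this (not_le.2 hneg)
  obtain ⟨h1, w', b, σ, h2, hσ, h3⟩ := h_interior x hx t ht hneg
  have hlm : IsLocalMin (fun y => w (y, t)) x := by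
    filter_upwards [isOpen_ball.mem_nhds hx] with y hy
    exact hqmin (show (y, t) ∈ _ from ⟨ball_subset_closedBall hy, hq.2⟩)
  have h4 := trA_nonneg_of_isLocalMin b hσ h1 hlm
  have h5 : w' ≤ 0 := by
    refine left_deriv_nonpos h2 ?_
    filter_upwards [Ioo_mem_nhdsLT ht.1] with s hs
    exact hqmin (show (x, s) ∈ _ from ⟨hq.1, hs.1.le, hs.2.le.trans ht.2⟩)
  linarith

end Basics

section ABP

theorem length_active {h : ℝ → ℝ} {t0 t1 C : ℝ} (hC : 0 < C) (h01 : t0 ≤ t1)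
    (hc : ContinuousOn h (Icc t0 t1)) (h0 : -(1 / 2) ≤ h t0) (h1 : h t1 ≤ -1)
    (hS : ∀ t ∈ Ioc t0 t1, (∀ s ∈ Icc t0 t, h t ≤ h s) → h t < -(1 / 2) →
      ∀ᶠ s in 𝓝[<] t, h s ≤ h t + C * (t - s)) :
    ENNReal.ofReal (1 / 2) ≤ ENNReal.ofReal C *
      volume {t | t ∈ Icc t0 t1 ∧ h t < -(1 / 2) ∧ ∀ s ∈ Icc t0 t, h t ≤ h s} := by
  set S := {t | t ∈ Icc t0 t1 ∧ h t < -(1 / 2) ∧ ∀ s ∈ Icc t0 t, h t ≤ h s} with hSdef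
  have key : ∀ s ∈ S, ∀ t ∈ Icc s t1, h s - h t ≤ C * (t - s) := by
    intro s hs t ht
    by_contra! hlt
    set T := {τ | τ ∈ Icc s t ∧ h τ ≤ h t + C * (t - τ)} with hT
    have hTne : T.Nonempty := ⟨t, ⟨ht.1, le_rfl⟩, by simp⟩
    have hTc : IsClosed T := by
      have hc' : ContinuousOn h (Icc s t) := hc.mono (Icc_subset_Icc hs.1.1 ht.2)
      exact isClosed_Icc.isClosed_le hc' (by fun_prop)
    have hTb : BddBelow T := ⟨s, fun τ hτ => hτ.1.1⟩
    have hmem := hTc.csInf_mem hTne hTb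
    set τ := sInf T with hτ
    have hlow : ∀ σ ∈ Ico s τ, h t + C * (t - σ) < h σ := by
      intro σ hσ
      by_contra! hle
      have : σ ∈ T := ⟨⟨hσ.1, hσ.2.le.trans hmem.1.2⟩, hle⟩
      exact absurd (csInf_le hTb this) (not_le.2 hσ.2)
    have hsτ : s < τ := by
      refine lt_of_le_of_ne hmem.1.1 ?_
      intro h
      have := hmem.2
      rw [← h] at this; linarith
    have hτ0 : τ ∈ Ioc t0 t1 := ⟨hs.1.1.trans_lt hsτ, hmem.1.2.trans ht.2⟩
    have hact : ∀ σ ∈ Icc t0 τ, h τ ≤ h σ := by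
      intro σ hσ
      have h2 : C * (t - τ) ≤ C * (t - s) := by gcongr
      rcases lt_or_ge σ s with h1 | h1
      · have := hs.2.2 σ ⟨hσ.1, h1.le⟩
        linarith [hmem.2]
      · rcases lt_or_eq_of_le hσ.2 with h3 | h3
        · have := hlow σ ⟨h1, h3⟩
          have h4 : C * (t - τ) ≤ C * (t - σ) := by gcongr
          linarith [hmem.2]
        · rw [h3]
    have h2 : C * (t - τ) ≤ C * (t - s) := by gcongr
    have := hS τ hτ0 hact (by linarith [hs.2.1, hmem.2])
    obtain ⟨σ, hσ1, hσ2⟩ := (this.and (Ioo_mem_nhdsLT hsτ)).exists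
    have := hlow σ ⟨hσ2.1.le, hσ2.2⟩
    have := hmem.2
    nlinarith
  have hsub : Ico (-1 : ℝ) (-(1 / 2)) ⊆ h '' S := by
    intro v hv
    set T := {τ | τ ∈ Icc t0 t1 ∧ h τ ≤ v} with hT
    have hTne : T.Nonempty := ⟨t1, ⟨h01, le_rfl⟩, by linarith [hv.1]⟩
    have hTc : IsClosed T := isClosed_Icc.isClosed_le hc continuousOn_const
    have hTb : BddBelow T := ⟨t0, fun τ hτ => hτ.1.1⟩
    have hmem := hTc.csInf_mem hTne hTb
    set τ := sInf T with hτ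
    have hlow : ∀ σ ∈ Ico t0 τ, v < h σ := by
      intro σ hσ
      by_contra! hle
      exact absurd (csInf_le hTb (show σ ∈ T from ⟨⟨hσ.1, hσ.2.le.trans hmem.1.2⟩, hle⟩))
        (not_le.2 hσ.2)
    have heq : h τ = v := by
      obtain ⟨σ, hσ, hσv⟩ := intermediate_value_Icc' hmem.1.1
        (hc.mono (Icc_subset_Icc le_rfl hmem.1.2)) (show v ∈ Icc (h τ) (h t0) from
          ⟨hmem.2, by linarith [hv.2]⟩)
      rcases lt_or_eq_of_le hσ.2 with h3 | h3
      · exact absurd hσv (hlow σ ⟨hσ.1, h3⟩).ne'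
      · rw [← h3, hσv]
    refine ⟨τ, ⟨hmem.1, by rw [heq]; exact hv.2, fun s hs => ?_⟩, heq⟩
    rcases lt_or_eq_of_le hs.2 with h3 | h3
    · rw [heq]; exact (hlow s ⟨hs.1, h3⟩).le
    · rw [h3]
  have hlip : LipschitzOnWith C.toNNReal h S := by
    have aux : ∀ x ∈ S, ∀ y ∈ S, x ≤ y → |h x - h y| ≤ C * |x - y| := by
      intro x hx y hy hxy
      rw [abs_of_nonneg (by linarith [hy.2.2 x ⟨hx.1.1, hxy⟩]), abs_sub_comm,
        abs_of_nonneg (by linarith)]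
      exact key x hx y ⟨hxy, hy.1.2⟩
    refine LipschitzOnWith.of_dist_le_mul fun x hx y hy => ?_
    rw [Real.coe_toNNReal _ hC.le, Real.dist_eq, Real.dist_eq]
    rcases le_total x y with hxy | hxy
    · exact aux x hx y hy hxy
    · rw [abs_sub_comm, abs_sub_comm x y]; exact aux y hy x hx hxy
  have h3 := hlip.hausdorffMeasure_image_le zero_le_one
  rw [hausdorffMeasure_real, ENNReal.rpow_one] at h3
  calc ENNReal.ofReal (1 / 2) = volume (Ico (-1 : ℝ) (-(1 / 2))) := by
        rw [Real.volume_Ico]; norm_num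
    _ ≤ volume (h '' S) := measure_mono hsub
    _ ≤ _ := h3

variable {E : Type*} [NormedAddCommGroup E] [InnerProductSpace ℝ E] [FiniteDimensional ℝ E]

/-- The linear identification of the dual of `E` with `E`. -/
def rieszL : StrongDual ℝ E →L[ℝ] E :=
  ∑ k, (ContinuousLinearMap.apply ℝ ℝ (stdOrthonormalBasis ℝ E k)).smulRight (stdOrthonormalBasis ℝ E k)

theorem inner_rieszL (v : E) (φ : StrongDual ℝ E) : inner ℝ v (rieszL φ) = φ v := by
  conv_rhs => rw [← (stdOrthonormalBasis ℝ E).sum_repr' v]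
  simp only [rieszL, _root_.sum_apply, ContinuousLinearMap.smulRight_apply,
    ContinuousLinearMap.apply_apply, inner_sum, inner_smul_right, map_sum, map_smul, smul_eq_mul]
  refine Finset.sum_congr rfl fun k _ => ?_
  rw [real_inner_comm]; ring

/-- The gradient of `f`, written through `rieszL`. -/
def gradE (f : E → ℝ) (x : E) : E := rieszL (fderiv ℝ f x)

theorem abs_det_hess_le {f : E → ℝ} {x : E} (hf : ContDiffAt ℝ 2 f x) (hpos : ∀ v, 0 ≤ dir2 f x v)
    (b : OrthonormalBasis (Fin (finrank ℝ E)) ℝ E) {c : ℝ} (hb : ∀ k, dir2 f x (b k) ≤ c) :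
    DifferentiableAt ℝ (gradE f) x ∧
    |(fderiv ℝ (gradE f) x).det| ≤ (finrank ℝ E).factorial * c ^ (finrank ℝ E) := by
  have h2 : DifferentiableAt ℝ (fderiv ℝ f) x :=
    (hf.fderiv_right (m := 1) (by norm_num)).differentiableAt (by simp)
  have hT : HasFDerivAt (gradE f) ((rieszL (E := E)).comp (fderiv ℝ (fderiv ℝ f) x)) x :=
    (rieszL (E := E)).hasFDerivAt.comp x h2.hasFDerivAt
  refine ⟨hT.differentiableAt, ?_⟩
  rw [hT.fderiv]
  set B := (rieszL (E := E)).comp (fderiv ℝ (fderiv ℝ f) x) with hB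
  have hsymm : ∀ v w, fderiv ℝ (fderiv ℝ f) x v w = fderiv ℝ (fderiv ℝ f) x w v :=
    hf.isSymmSndFDerivAt (by simp)
  have hent : ∀ i j, |LinearMap.toMatrix b.toBasis b.toBasis (B : E →ₗ[ℝ] E) i j| ≤ c := by
    intro i j
    have e1 : LinearMap.toMatrix b.toBasis b.toBasis (B : E →ₗ[ℝ] E) i j =
        fderiv ℝ (fderiv ℝ f) x (b j) (b i) := by
      rw [LinearMap.toMatrix_apply]
      simp only [OrthonormalBasis.coe_toBasis, OrthonormalBasis.coe_toBasis_repr_apply,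
        OrthonormalBasis.repr_apply_apply]
      exact inner_rieszL _ _
    rw [e1]
    have p1 := hpos (b i + b j)
    have p2 := hpos (b i - b j)
    have p3 := hb i
    have p4 := hb j
    rw [dir2_eq_fderiv hf] at p1 p2 p3 p4
    simp only [map_add, map_sub, _root_.add_apply, _root_.sub_apply] at p1 p2
    have := hsymm (b i) (b j)
    rw [abs_le]; constructor <;> linarith
  have := Matrix.det_le (abv := AbsoluteValue.abs) hent
  rw [LinearMap.det_toMatrix] at this
  simpa [nsmul_eq_mul] using this

theorem contact_point {x0 x1 p x : E} {R t0 t lam C w' : ℝ} {w : E × ℝ → ℝ} (hlam : 0 < lam)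
    (hC : 0 < C) (hx : x ∈ ball x0 R) (ht : t0 < t)
    (hmin : ∀ y ∈ closedBall x0 R, ∀ s ∈ Icc t0 t,
      w (x, t) - inner ℝ p (x - x1) ≤ w (y, s) - inner ℝ p (y - x1))
    {b : OrthonormalBasis (Fin (finrank ℝ E)) ℝ E} {σ : Fin (finrank ℝ E) → ℝ}
    (h1 : ContDiffAt ℝ 2 (fun y => w (y, t)) x)
    (hD : HasDerivWithinAt (fun s => w (x, s)) w' (Iic t) t) (hσ : ∀ k, lam ≤ σ k)
    (h3 : trA b σ (fun y => w (y, t)) x ≤ w' + C) :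
    w' ≤ trA b σ (fun y => w (y, t)) x ∧ gradE (fun y => w (y, t)) x = p ∧
    (DifferentiableAt ℝ (gradE fun y => w (y, t)) x ∧
      |(fderiv ℝ (gradE fun y => w (y, t)) x).det| ≤
        (finrank ℝ E).factorial * (C / lam) ^ (finrank ℝ E)) ∧
    ∀ᶠ s in 𝓝[<] t, w (x, s) ≤ w (x, t) + 2 * C * (t - s) := by
  have hlm : IsLocalMin (fun y => w (y, t) - inner ℝ p (y - x1)) x := by
    filter_upwards [isOpen_ball.mem_nhds hx] with y hy
    exact hmin y (ball_subset_closedBall hy) t ⟨ht.le, le_rfl⟩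
  have hlin : ContDiffAt ℝ 2 (fun y => -inner ℝ p (y - x1)) x :=
    (contDiffAt_const.inner ℝ (contDiffAt_id.sub contDiffAt_const)).neg
  have hlin2 : ∀ v, dir2 (fun y => -inner ℝ p (y - x1)) x v = 0 := by
    intro v
    unfold dir2
    have : (fun s : ℝ => -inner ℝ p (x + s • v - x1)) =
        fun s => s * (-inner ℝ p v) + (-inner ℝ p (x - x1)) := by
      funext s
      rw [show x + s • v - x1 = (x - x1) + s • v by abel, inner_add_right, inner_smul_right]; ring
    rw [this]
    have : (deriv fun s : ℝ => s * (-inner ℝ p v) + (-inner ℝ p (x - x1))) = fun _ => -inner ℝ p v := by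
      funext s
      simp
    rw [this]; simp
  have hpos : ∀ v, 0 ≤ dir2 (fun y => w (y, t)) x v := by
    intro v
    have h5 := dir2_nonneg_of_isLocalMin (f := fun y => w (y, t) + -inner ℝ p (y - x1))
      (h1.add hlin) (by simpa only [sub_eq_add_neg] using hlm) v
    rw [dir2_add h1 hlin, hlin2] at h5
    simpa using h5
  have htr : 0 ≤ trA b σ (fun y => w (y, t)) x :=
    Finset.sum_nonneg fun k _ => mul_nonneg (hlam.le.trans (hσ k)) (hpos _)
  have hw' : w' ≤ 0 := by
    refine left_deriv_nonpos hD ?_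
    filter_upwards [Ioo_mem_nhdsLT ht] with s hs
    have := hmin x (ball_subset_closedBall hx) s ⟨hs.1.le, hs.2.le⟩
    linarith
  have hdk : ∀ k, dir2 (fun y => w (y, t)) x (b k) ≤ C / lam := by
    intro k
    rw [le_div_iff₀ hlam]
    have h6 : σ k * dir2 (fun y => w (y, t)) x (b k) ≤ trA b σ (fun y => w (y, t)) x :=
      Finset.single_le_sum (f := fun k => σ k * dir2 (fun y => w (y, t)) x (b k))
        (fun k _ => mul_nonneg (hlam.le.trans (hσ k)) (hpos _)) (Finset.mem_univ k)
    have := mul_le_mul_of_nonneg_right (hσ k) (hpos (b k))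
    linarith
  refine ⟨hw'.trans htr, ?_, abs_det_hess_le h1 hpos b hdk, ?_⟩
  · have h7 : HasFDerivAt (fun y => w (y, t) - inner ℝ p (y - x1))
        (fderiv ℝ (fun y => w (y, t)) x - innerSL ℝ p) x := by
      refine (h1.differentiableAt (by simp)).hasFDerivAt.sub ?_
      exact (innerSL ℝ p).hasFDerivAt.comp x ((hasFDerivAt_id x).sub_const x1)
    have h8 := hlm.fderiv_eq_zero
    rw [h7.fderiv, sub_eq_zero] at h8
    refine ext_inner_left ℝ fun v => ?_
    rw [gradE, inner_rieszL, h8, innerSL_apply_apply, real_inner_comm]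
  · have h9 := hasDerivWithinAt_iff_tendsto_slope.1 hD
    have : Iic t \ {t} = Iio t := by ext; simp [lt_iff_le_and_ne]
    rw [this] at h9
    have h10 := h9.eventually (lt_mem_nhds (show -(2 * C) < w' by linarith))
    filter_upwards [h10, self_mem_nhdsWithin] with s hs hs'
    have hs' : s < t := hs'
    rw [slope_def_field, lt_div_iff_of_neg (by linarith)] at hs
    nlinarith

variable [MeasurableSpace E] [BorelSpace E]

/-- Parabolic Aleksandrov–Bakelman–Pucci estimate. -/
theorem abp {x0 x1 : E} {R t0 t1 lam C : ℝ} (hlam : 0 < lam) (hC : 0 < C) (hR : 0 < R) (h01 : t0 ≤ t1)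
    {w : E × ℝ → ℝ} (hc : ContinuousOn w (closedBall x0 R ×ˢ Icc t0 t1))
    (hinit : ∀ x ∈ closedBall x0 R, 0 ≤ w (x, t0))
    (hlat : ∀ x t, dist x x0 = R → t ∈ Icc t0 t1 → 0 ≤ w (x, t))
    {K1 : Set (E × ℝ)} (hK1 : MeasurableSet K1)
    (h_interior : ∀ x ∈ ball x0 R, ∀ t ∈ Ioc t0 t1, w (x, t) < 0 →
      ContDiffAt ℝ 2 (fun y => w (y, t)) x ∧ ∃ (w' : ℝ)
        (b : OrthonormalBasis (Fin (finrank ℝ E)) ℝ E) (σ : Fin (finrank ℝ E) → ℝ),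
        HasDerivWithinAt (fun s => w (x, s)) w' (Iic t) t ∧ (∀ k, lam ≤ σ k) ∧
        trA b σ (fun y => w (y, t)) x ≤ w' + C ∧
        ((x, t) ∉ K1 → trA b σ (fun y => w (y, t)) x < w'))
    (hx1 : x1 ∈ closedBall x0 R) (hneg : w (x1, t1) ≤ -1) :
    volume (ball (0 : E) (1 / (4 * R))) ≤
      ENNReal.ofReal (4 * C * ((finrank ℝ E).factorial * (C / lam) ^ (finrank ℝ E))) *
        volume ({p ∈ closedBall x0 R ×ˢ Icc t0 t1 | w p < 0} ∩ K1) := by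
  set D : ℝ := (finrank ℝ E).factorial * (C / lam) ^ (finrank ℝ E) with hD
  have hDpos : 0 < D := by positivity
  set Q := closedBall x0 R ×ˢ Icc t0 t1 with hQ
  have hQc : IsCompact Q := (isCompact_closedBall x0 R).prod isCompact_Icc
  obtain ⟨g, hg⟩ := ContinuousMap.exists_restrict_eq hQc.isClosed ⟨Q.domRestrict w, hc.domRestrict⟩
  have hgw : ∀ x ∈ closedBall x0 R, ∀ t ∈ Icc t0 t1, g (x, t) = w (x, t) := by
    intro x hx t ht
    exact DFunLike.congr_fun hg ⟨(x, t), ⟨hx, ht⟩⟩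
  set h : E × ℝ → ℝ := fun q => sInf ((fun x => g (x, q.2) - inner ℝ q.1 (x - x1)) '' closedBall x0 R)
    with hh
  have hhc : Continuous h := by
    have : Continuous (Function.uncurry fun (q : E × ℝ) (x : E) => g (x, q.2) - inner ℝ q.1 (x - x1)) := by
      simp only [Function.uncurry_def]; fun_prop
    exact (isCompact_closedBall x0 R).continuous_sInf this
  have hne : (closedBall x0 R).Nonempty := ⟨x1, hx1⟩
  have hle : ∀ p t, ∀ x ∈ closedBall x0 R, h (p, t) ≤ g (x, t) - inner ℝ p (x - x1) := by
    intro p t x hx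
    refine csInf_le ?_ ⟨x, hx, rfl⟩
    exact ((isCompact_closedBall x0 R).image (by fun_prop)).bddBelow
  have hatt : ∀ p t, ∃ x ∈ closedBall x0 R, h (p, t) = g (x, t) - inner ℝ p (x - x1) := fun p t =>
    (isCompact_closedBall x0 R).exists_sInf_image_eq hne (by fun_prop)
  have hin : ∀ p ∈ ball (0 : E) (1 / (4 * R)), ∀ x ∈ closedBall x0 R,
      |inner ℝ p (x - x1)| ≤ 1 / 2 := by
    intro p hp x hx
    have e1 : ‖p‖ ≤ 1 / (4 * R) := by simpa using (mem_ball_zero_iff.1 hp).le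
    have e2 : ‖x - x1‖ ≤ 2 * R := by
      rw [← dist_eq_norm]
      have := dist_triangle_right x x1 x0
      linarith [mem_closedBall.1 hx, mem_closedBall.1 hx1]
    calc |inner ℝ p (x - x1)| ≤ ‖p‖ * ‖x - x1‖ := abs_real_inner_le_norm _ _
      _ ≤ 1 / (4 * R) * (2 * R) := by gcongr
      _ = 1 / 2 := by field_simp; norm_num
  -- contact points
  have hcontact : ∀ p ∈ ball (0 : E) (1 / (4 * R)), ∀ t ∈ Icc t0 t1, h (p, t) < -(1 / 2) →
      (∀ s ∈ Icc t0 t, h (p, t) ≤ h (p, s)) →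
      (∃ x ∈ ball x0 R, (x, t) ∈ {p ∈ Q | w p < 0} ∩ K1 ∧ gradE (fun y => w (y, t)) x = p ∧
        DifferentiableAt ℝ (gradE fun y => w (y, t)) x ∧
        |(fderiv ℝ (gradE fun y => w (y, t)) x).det| ≤ D) ∧
      ∀ᶠ s in 𝓝[<] t, h (p, s) ≤ h (p, t) + 2 * C * (t - s) := by
    intro p hp t ht hlt hmono
    obtain ⟨x, hx, hxe⟩ := hatt p t
    have hi := abs_le.1 (hin p hp x hx)
    have hwneg : w (x, t) < 0 := by rw [← hgw x hx t ht]; linarith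
    have ht0 : t0 < t := by
      refine lt_of_le_of_ne ht.1 fun e => ?_
      have := hinit x hx
      rw [e] at this; linarith
    have hxb : x ∈ ball x0 R := by
      rcases lt_or_eq_of_le (mem_closedBall.1 hx) with h | h
      · exact h
      · exact absurd (hlat x t h ht) (not_le.2 hwneg)
    have hmin : ∀ y ∈ closedBall x0 R, ∀ s ∈ Icc t0 t,
        w (x, t) - inner ℝ p (x - x1) ≤ w (y, s) - inner ℝ p (y - x1) := by
      intro y hy s hs
      rw [← hgw x hx t ht, ← hgw y hy s ⟨hs.1, hs.2.trans ht.2⟩, ← hxe]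
      exact (hmono s hs).trans (hle p s y hy)
    obtain ⟨c1, w', b, σ, c2, c3, c4, c5⟩ := h_interior x hxb t ⟨ht0, ht.2⟩ hwneg
    obtain ⟨r1, r2, ⟨r3, r4⟩, r5⟩ := contact_point hlam hC hxb ht0 hmin c1 c2 c3 c4
    refine ⟨⟨x, hxb, ⟨⟨⟨hx, ht⟩, hwneg⟩, ?_⟩, r2, r3, r4⟩, ?_⟩
    · by_contra hn
      exact absurd (c5 hn) (not_lt.2 r1)
    · filter_upwards [r5, Ioo_mem_nhdsLT ht0] with s hs hs'
      have e1 := hle p s x hx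
      rw [hgw x hx s ⟨hs'.1.le, hs'.2.le.trans ht.2⟩] at e1
      rw [hxe, hgw x hx t ht]; linarith
  set S : Set (E × ℝ) := {q | q.1 ∈ ball (0 : E) (1 / (4 * R)) ∧ q.2 ∈ Icc t0 t1 ∧ h q < -(1 / 2) ∧
    ∀ s ∈ Icc t0 q.2, h q ≤ h (q.1, s)} with hS
  have hSm : MeasurableSet S := by
    have e : S = {q | q.1 ∈ ball (0 : E) (1 / (4 * R))} ∩ {q | h q < -(1 / 2)} ∩
        ({q | q.2 ∈ Icc t0 t1} ∩ ⋂ θ ∈ Icc (0 : ℝ) 1, {q | h q ≤ h (q.1, t0 + θ * (q.2 - t0))}) := by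
      ext q
      simp only [hS, mem_ofPred_eq, mem_inter_iff, mem_iInter]
      constructor
      · rintro ⟨a1, a2, a3, a4⟩
        refine ⟨⟨a1, a3⟩, a2, fun θ hθ => a4 _ ⟨?_, ?_⟩⟩
        · nlinarith [hθ.1, a2.1]
        · nlinarith [hθ.2, a2.1]
      · rintro ⟨⟨a1, a3⟩, a2, a4⟩
        refine ⟨a1, a2, a3, fun s hs => ?_⟩
        rcases eq_or_lt_of_le a2.1 with h0 | h0
        · have : s = q.2 := le_antisymm hs.2 (h0 ▸ hs.1)
          rw [this]
        · have := a4 ((s - t0) / (q.2 - t0)) ⟨div_nonneg (by linarith [hs.1]) (by linarith),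
            (div_le_one (by linarith)).2 (by linarith [hs.2])⟩
          rwa [div_mul_cancel₀ _ (by linarith), add_sub_cancel] at this
    rw [e]
    refine ((isOpen_ball.preimage continuous_fst).measurableSet.inter
      (isOpen_lt hhc continuous_const).measurableSet).inter (IsClosed.measurableSet ?_)
    refine (isClosed_Icc.preimage continuous_snd).inter (isClosed_biInter fun θ _ => ?_)
    exact isClosed_le hhc (hhc.comp (by fun_prop))
  have hlow : ENNReal.ofReal (1 / (4 * C)) * volume (ball (0 : E) (1 / (4 * R))) ≤ volume S := by
    rw [Measure.volume_eq_prod, Measure.prod_apply hSm, ← setLIntegral_const]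
    refine le_trans (setLIntegral_mono' isOpen_ball.measurableSet fun p hp => ?_)
      (setLIntegral_le_lintegral _ _)
    have := length_active (h := fun t => h (p, t)) (C := 2 * C) (by positivity) h01
      (by fun_prop) (by
        obtain ⟨x, hx, hxe⟩ := hatt p t0
        have := hin p hp x hx
        have := abs_le.1 this
        have := hinit x hx
        rw [hxe, hgw x hx t0 ⟨le_rfl, h01⟩]; linarith)
      (by
        have := hle p t1 x1 hx1
        rw [hgw x1 hx1 t1 ⟨h01, le_rfl⟩] at this
        simp only [sub_self, inner_zero_right, sub_zero] at this
        linarith)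
      (fun t ht hm hlt => (hcontact p hp t ⟨ht.1.le, ht.2⟩ hlt hm).2)
    have e : (Prod.mk p ⁻¹' S) = {t | t ∈ Icc t0 t1 ∧ h (p, t) < -(1 / 2) ∧
        ∀ s ∈ Icc t0 t, h (p, t) ≤ h (p, s)} := by
      ext t; simp only [hS, mem_preimage, mem_ofPred_eq]; tauto
    rw [e]
    refine (ENNReal.mul_le_mul_iff_right (a := ENNReal.ofReal (2 * C)) (by simpa using hC)
      ENNReal.ofReal_ne_top).1 (le_trans (le_of_eq ?_) this)
    rw [← ENNReal.ofReal_mul (by positivity)]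
    congr 1; field_simp; norm_num
  set G := {p ∈ Q | w p < 0} ∩ K1 with hG
  have hGm : MeasurableSet G := by
    have : {p ∈ Q | w p < 0} = Q ∩ {p | g p < 0} := by
      ext ⟨x, t⟩
      simp only [mem_ofPred_eq, mem_inter_iff]
      exact and_congr_right fun hq => by rw [hgw x hq.1 t hq.2]
    rw [hG, this]
    exact (hQc.measurableSet.inter (isOpen_lt g.continuous continuous_const).measurableSet).inter hK1
  have hup : volume S ≤ ENNReal.ofReal D * volume G := by
    rw [Measure.volume_eq_prod, Measure.prod_apply_symm hSm, Measure.prod_apply_symm hGm,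
      ← lintegral_const_mul' _ _ ENNReal.ofReal_ne_top]
    refine lintegral_mono fun t => ?_
    set f := fun y => w (y, t) with hf
    set Γ := ((fun x => (x, t)) ⁻¹' G) ∩ {x | DifferentiableAt ℝ (gradE f) x} ∩
      {x | |(fderiv ℝ (gradE f) x).det| ≤ D} with hΓ
    have hΓm : MeasurableSet Γ := by
      refine ((hGm.preimage (by fun_prop)).inter (measurableSet_of_differentiableAt ℝ _)).inter ?_
      have : Measurable fun x => (fderiv ℝ (gradE f) x).det :=
        ContinuousLinearMap.continuous_det.measurable.comp (measurable_fderiv ℝ _)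
      exact measurableSet_le this.abs measurable_const
    have hsub : (fun x => (x, t)) ⁻¹' S ⊆ gradE f '' Γ := by
      intro p hp
      obtain ⟨⟨x, hx, c1, c2, c3, c4⟩, -⟩ := hcontact p hp.1 t hp.2.1 hp.2.2.1 hp.2.2.2
      exact ⟨x, ⟨⟨c1, c3⟩, c4⟩, c2⟩
    calc volume ((fun x => (x, t)) ⁻¹' S) ≤ volume (gradE f '' Γ) := measure_mono hsub
      _ ≤ ∫⁻ x in Γ, ENNReal.ofReal |(fderiv ℝ (gradE f) x).det| :=
        addHaar_image_le_lintegral_abs_det_fderiv volume hΓm fun x hx =>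
          (DifferentiableAt.hasFDerivAt hx.1.2).hasFDerivWithinAt
      _ ≤ ∫⁻ x in Γ, ENNReal.ofReal D :=
        setLIntegral_mono' hΓm fun x hx => ENNReal.ofReal_le_ofReal hx.2
      _ = ENNReal.ofReal D * volume Γ := setLIntegral_const _ _
      _ ≤ ENNReal.ofReal D * volume ((fun x => (x, t)) ⁻¹' G) := by
        gcongr; exact fun x hx => hx.1.1
  have := hlow.trans hup
  calc volume (ball (0 : E) (1 / (4 * R)))
      = ENNReal.ofReal (4 * C) * (ENNReal.ofReal (1 / (4 * C)) * volume (ball (0 : E) (1 / (4 * R)))) := by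
        rw [← mul_assoc, ← ENNReal.ofReal_mul (by positivity), mul_one_div_cancel (by positivity)]; simp
    _ ≤ ENNReal.ofReal (4 * C) * (ENNReal.ofReal D * volume G) := by gcongr
    _ = _ := by rw [← mul_assoc, ← ENNReal.ofReal_mul (by positivity)]

end ABP

section Barrier

variable {E : Type*} [NormedAddCommGroup E] [InnerProductSpace ℝ E] [FiniteDimensional ℝ E]

/-- The barrier profile `(s - |x - x0|²)₊² / s^q`. -/
def bar (q : ℕ) (x0 : E) (s : ℝ) (x : E) : ℝ := (max (s - ‖x - x0‖ ^ 2) 0) ^ 2 / s ^ q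

theorem bar_nonneg (q : ℕ) (x0 : E) {s : ℝ} (hs : 0 < s) (x : E) : 0 ≤ bar q x0 s x := by
  unfold bar; positivity

theorem bar_eq_zero (q : ℕ) (x0 : E) {s : ℝ} {x : E} (h : s ≤ ‖x - x0‖ ^ 2) : bar q x0 s x = 0 := by
  unfold bar; rw [max_eq_right (by linarith)]; simp

theorem bar_le (e : ℕ) (x0 : E) {s : ℝ} (hs : 0 < s) (x : E) : bar (e + 2) x0 s x ≤ 1 / s ^ e := by
  unfold bar
  have h1 : (max (s - ‖x - x0‖ ^ 2) 0) ^ 2 ≤ s ^ 2 := by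
    gcongr
    exact max_le (by nlinarith [norm_nonneg (x - x0)]) hs.le
  rw [div_le_div_iff₀ (by positivity) (by positivity), pow_add]
  nlinarith [pow_pos hs e]

theorem bar_eq (q : ℕ) (x0 : E) {s : ℝ} {x : E} (h : ‖x - x0‖ ^ 2 ≤ s) :
    bar q x0 s x = (s - ‖x - x0‖ ^ 2) ^ 2 / s ^ q := by
  unfold bar; rw [max_eq_left (by linarith)]

theorem continuousOn_bar (q : ℕ) (x0 : E) :
    ContinuousOn (fun p : E × ℝ => bar q x0 p.2 p.1) {p | 0 < p.2} := by
  unfold bar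
  refine ContinuousOn.div (by fun_prop) (by fun_prop) fun p hp => ?_
  exact pow_ne_zero _ (ne_of_gt hp)

/-- The parameters making the barrier a strict subsolution. -/
def BarParam (d : ℕ) (lam Lam : ℝ) (q : ℕ) : Prop :=
  (1 / 2 + 4 * d * Lam + 8 * lam) ^ 2 < 8 * lam * q

theorem bar_strict {lam Lam : ℝ} (hlam : 0 < lam) {q : ℕ} (hq : BarParam (finrank ℝ E) lam Lam q)
    (x0 : E) {s : ℝ} (hs : 0 < s) {x : E} (hx : ‖x - x0‖ ^ 2 < s) :
    ContDiffAt ℝ 2 (bar q x0 s) x ∧ ∃ ψ : ℝ, HasDerivAt (fun s => bar q x0 s x) ψ s ∧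
      ∀ (b : OrthonormalBasis (Fin (finrank ℝ E)) ℝ E) (σ : Fin (finrank ℝ E) → ℝ),
        (∀ k, lam ≤ σ k ∧ σ k ≤ Lam) → ψ / 4 < trA b σ (bar q x0 s) x := by
  have hev : bar q x0 s =ᶠ[𝓝 x] fun y => (1 / s ^ q) * (s - ‖y - x0‖ ^ 2) ^ 2 + 0 := by
    have : ∀ᶠ y in 𝓝 x, ‖y - x0‖ ^ 2 < s :=
      (show Continuous fun y : E => ‖y - x0‖ ^ 2 by fun_prop).continuousAt.eventually (gt_mem_nhds hx)
    filter_upwards [this] with y hy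
    rw [bar_eq q x0 hy.le]; ring
  have hcd : ContDiff ℝ 2 fun y : E => (s - ‖y - x0‖ ^ 2) ^ 2 :=
    (contDiff_const.sub ((contDiff_norm_sq ℝ).comp (contDiff_id.sub contDiff_const))).pow 2
  refine ⟨?_, (2 * (s - ‖x - x0‖ ^ 2) * s ^ q - (s - ‖x - x0‖ ^ 2) ^ 2 * (q * s ^ (q - 1))) / (s ^ q) ^ 2,
    ?_, ?_⟩
  · refine ContDiffAt.congr_of_eventuallyEq ?_ hev
    exact (contDiffAt_const.mul hcd.contDiffAt).add contDiffAt_const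
  · have hev2 : (fun s => bar q x0 s x) =ᶠ[𝓝 s] fun s => (s - ‖x - x0‖ ^ 2) ^ 2 / s ^ q := by
      filter_upwards [lt_mem_nhds hx] with s' hs'
      rw [bar_eq q x0 hs'.le]
    refine HasDerivAt.congr_of_eventuallyEq ?_ hev2
    have h1 : HasDerivAt (fun s : ℝ => (s - ‖x - x0‖ ^ 2) ^ 2) (2 * (s - ‖x - x0‖ ^ 2)) s := by
      simpa using ((hasDerivAt_id s).sub_const (‖x - x0‖ ^ 2)).fun_pow 2
    exact h1.div (hasDerivAt_pow q s) (by positivity)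
  · intro b σ hσ
    set ζ := s - ‖x - x0‖ ^ 2 with hζ
    have hζp : 0 < ζ := by linarith
    have hd2 : ∀ k, dir2 (fun y => (s - ‖y - x0‖ ^ 2) ^ 2) x (b k) =
        8 * inner ℝ (b k) (x - x0) ^ 2 - 4 * ζ := by
      intro k
      set p := inner ℝ (b k) (x - x0)
      unfold dir2
      have e1 : (fun τ : ℝ => (s - ‖x + τ • b k - x0‖ ^ 2) ^ 2) = fun τ => (ζ - 2 * τ * p - τ ^ 2) ^ 2 := by
        funext τ
        congr 1
        rw [show x + τ • b k - x0 = (x - x0) + τ • b k by abel, norm_add_sq_real, inner_smul_right,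
          norm_smul, b.orthonormal.1 k, real_inner_comm]
        simp only [mul_one, Real.norm_eq_abs, sq_abs]; ring
      have e2 : (deriv fun τ : ℝ => (ζ - 2 * τ * p - τ ^ 2) ^ 2) =
          fun τ => 2 * (ζ - 2 * τ * p - τ ^ 2) * (- (2 * p) - 2 * τ) := by
        funext τ
        have h2 : HasDerivAt (fun τ : ℝ => ζ - 2 * τ * p - τ ^ 2) (- (2 * p) - 2 * τ) τ := by
          have := (((hasDerivAt_id τ).const_mul 2).mul_const p).const_sub ζ |>.sub (hasDerivAt_pow 2 τ)
          refine this.congr_deriv ?_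
          simp
        simpa using (h2.fun_pow 2).deriv
      rw [e1, e2]
      have h2 : HasDerivAt (fun τ : ℝ => ζ - 2 * τ * p - τ ^ 2) (- (2 * p) - 2 * 0) 0 := by
        have := (((hasDerivAt_id (0:ℝ)).const_mul 2).mul_const p).const_sub ζ |>.sub (hasDerivAt_pow 2 0)
        refine this.congr_deriv ?_
        simp
      have h3 : HasDerivAt (fun τ : ℝ => - (2 * p) - 2 * τ) (-2) 0 := by
        simpa using ((hasDerivAt_id (0:ℝ)).const_mul 2).const_sub (-(2 * p))
      have := ((h2.const_mul 2).mul h3).deriv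
      refine this.trans ?_
      simp; ring
    rw [trA_congr b σ hev, trA_affine]
    unfold trA
    simp only [hd2]
    have hsq : ∑ k, inner ℝ (b k) (x - x0) ^ 2 = s - ζ := by
      have := b.sum_sq_norm_inner_right (x - x0)
      simp only [Real.norm_eq_abs, sq_abs] at this
      rw [this]; ring
    have hsum : ∑ k, σ k * (8 * inner ℝ (b k) (x - x0) ^ 2 - 4 * ζ) ≥
        8 * lam * (s - ζ) - 4 * ζ * (finrank ℝ E * Lam) := by
      have : ∑ k, (8 * lam * inner ℝ (b k) (x - x0) ^ 2 - 4 * ζ * Lam) ≤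
          ∑ k, σ k * (8 * inner ℝ (b k) (x - x0) ^ 2 - 4 * ζ) := by
        refine Finset.sum_le_sum fun k _ => ?_
        have h4 := mul_le_mul_of_nonneg_right (hσ k).1 (sq_nonneg (inner ℝ (b k) (x - x0)))
        have h5 := mul_le_mul_of_nonneg_right (hσ k).2 hζp.le
        linarith
      rw [Finset.sum_sub_distrib, ← Finset.mul_sum, hsq] at this
      simp only [Finset.sum_const, Finset.card_univ, Fintype.card_fin, nsmul_eq_mul] at this
      linarith
    have hsq0 : 0 < s ^ q := by positivity
    have hq1 : 1 ≤ q := by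
      rcases Nat.eq_zero_or_pos q with h | h
      · unfold BarParam at hq
        rw [h] at hq; simp at hq; nlinarith [sq_nonneg (1 / 2 + 4 * (finrank ℝ E : ℝ) * Lam + 8 * lam)]
      · exact h
    have hpow : s ^ q = s ^ (q - 1) * s := by rw [← pow_succ, Nat.sub_add_cancel hq1]
    have e3 : (2 * ζ * s ^ q - ζ ^ 2 * (q * s ^ (q - 1))) / (s ^ q) ^ 2 / 4 =
        (1 / s ^ q) * (ζ / 2 - q / 4 * ζ ^ 2 / s) := by
      have : s ^ (q - 1) = s ^ q / s := by rw [hpow]; field_simp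
      rw [this]; field_simp; ring
    rw [e3]
    refine mul_lt_mul_of_pos_left (lt_of_lt_of_le ?_ hsum) (by positivity)
    unfold BarParam at hq
    set B := 1 / 2 + 4 * (finrank ℝ E : ℝ) * Lam + 8 * lam with hB
    suffices B * ζ < q / 4 * ζ ^ 2 / s + 8 * lam * s by
      rw [hB] at this; linarith
    rw [show (q:ℝ) / 4 * ζ ^ 2 / s + 8 * lam * s = (q / 4 * ζ ^ 2 + 8 * lam * s ^ 2) / s by field_simp,
      lt_div_iff₀ hs]
    have h7 := mul_lt_mul_of_pos_right hq (pow_pos hζp 2)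
    have h8 : 32 * lam * (B * ζ * s) < 32 * lam * (q / 4 * ζ ^ 2 + 8 * lam * s ^ 2) := by
      nlinarith [sq_nonneg (B * ζ - 16 * lam * s)]
    exact lt_of_mul_lt_mul_left h8 (by positivity)

theorem barrier_sub {lam Lam : ℝ} (hlam : 0 < lam) {q : ℕ} (hq : BarParam (finrank ℝ E) lam Lam q)
    {u : E × ℝ → ℝ} {x0 x : E} {t T s0 k' : ℝ} {k : ℝ → ℝ} (hu : SolAt lam Lam u (x, t))
    (hk : HasDerivWithinAt k k' (Iic t) t) (hkp : 0 < k t) (hs : 0 < s0 + (t - T) / 4)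
    (hx : ‖x - x0‖ ^ 2 < s0 + (t - T) / 4) :
    ContDiffAt ℝ 2 (fun y => u (y, t) - k t * bar q x0 (s0 + (t - T) / 4) y) x ∧
    ∃ (w' : ℝ) (b : OrthonormalBasis (Fin (finrank ℝ E)) ℝ E) (σ : Fin (finrank ℝ E) → ℝ),
      HasDerivWithinAt (fun s => u (x, s) - k s * bar q x0 (s0 + (s - T) / 4) x) w' (Iic t) t ∧
      (∀ k, lam ≤ σ k) ∧
      trA b σ (fun y => u (y, t) - k t * bar q x0 (s0 + (t - T) / 4) y) x <
        w' + k' * bar q x0 (s0 + (t - T) / 4) x := by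
  obtain ⟨h1, b, σ, hσ, h2⟩ := hu
  obtain ⟨g1, ψ, g2, g3⟩ := bar_strict hlam hq x0 hs hx
  have g3 := g3 b σ hσ
  dsimp only at h1 h2
  refine ⟨h1.sub (contDiffAt_const.mul g1), trA b σ (fun y => u (y, t)) x -
      (k' * bar q x0 (s0 + (t - T) / 4) x + k t * (ψ * (1 / 4))), b, σ, ?_, fun k => (hσ k).1, ?_⟩
  · refine h2.hasDerivWithinAt.sub (hk.mul ?_)
    have h3 : HasDerivAt (fun s => s0 + (s - T) / 4) (1 / 4) t := by
      simpa using (((hasDerivAt_id t).sub_const T).div_const 4).const_add s0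
    exact (HasDerivAt.comp t (h₂ := fun s => bar q x0 s x) g2 h3).hasDerivWithinAt
  · have e : (fun y => u (y, t) - k t * bar q x0 (s0 + (t - T) / 4) y) =
        fun y => u (y, t) + ((-k t) * bar q x0 (s0 + (t - T) / 4) y + 0) := by
      funext y; ring
    rw [e, trA_add b σ h1 ((contDiffAt_const.mul g1).add contDiffAt_const), trA_affine]
    nlinarith

/-- Propagation of lower bounds forward in time. -/
theorem propagate {lam Lam : ℝ} (hlam : 0 < lam) {e : ℕ}
    (hq : BarParam (finrank ℝ E) lam Lam (e + 2)) {u : E × ℝ → ℝ} {x0 : E} {L r t0 t1 ℓ : ℝ}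
    (hr : 0 < r) (hℓ : 0 < ℓ)
    (hc : ContinuousOn u (closedBall x0 L ×ˢ Icc t0 t1))
    (hnn : ∀ p ∈ closedBall x0 L ×ˢ Icc t0 t1, 0 ≤ u p)
    (hsol : ∀ x ∈ ball x0 L, ∀ t ∈ Ioc t0 t1, SolAt lam Lam u (x, t))
    (hinit : ∀ x ∈ closedBall x0 r, ℓ ≤ u (x, t0)) (hs : r ^ 2 + (t1 - t0) / 4 ≤ L ^ 2) :
    ∀ x ∈ closedBall x0 L, ∀ t ∈ Icc t0 t1,
      ℓ * (r ^ 2) ^ e * bar (e + 2) x0 (r ^ 2 + (t - t0) / 4) x ≤ u (x, t) := by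
  intro x hx t ht
  have hr2 : 0 < r ^ 2 := by positivity
  set w : E × ℝ → ℝ := fun p => u p - ℓ * (r ^ 2) ^ e * bar (e + 2) x0 (r ^ 2 + (p.2 - t0) / 4) p.1
    with hw
  have hpos : ∀ t, t0 ≤ t → 0 < r ^ 2 + (t - t0) / 4 := fun t ht => by linarith
  have h := comparison_principle (x0 := x0) (R := L) (t0 := t0) (t1 := t1) w ?_ ?_ ?_ ?_ (x, t) ⟨hx, ht⟩
  · simpa [hw] using h
  · refine hc.sub (continuousOn_const.mul ?_)
    exact (continuousOn_bar (e + 2) x0).comp (f := fun p : E × ℝ => (p.1, r ^ 2 + (p.2 - t0) / 4))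
      (by fun_prop) fun p hp => hpos _ hp.2.1
  · intro y hy
    simp only [hw, sub_self, zero_div, add_zero]
    rcases le_or_gt ‖y - x0‖ r with h1 | h1
    · have := hinit y (by rwa [mem_closedBall, dist_eq_norm])
      have h2 := bar_le e x0 hr2 y
      have h3 : ℓ * (r ^ 2) ^ e * bar (e + 2) x0 (r ^ 2) y ≤ ℓ * (r ^ 2) ^ e * (1 / (r ^ 2) ^ e) := by
        gcongr
      have h4 : ℓ * (r ^ 2) ^ e * (1 / (r ^ 2) ^ e) = ℓ := by field_simp
      rw [h4] at h3
      linarith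
    · rw [bar_eq_zero _ _ (by gcongr)]
      simpa using hnn _ ⟨hy, le_rfl, ht.1.trans ht.2⟩
  · intro y s hy hs'
    simp only [hw]
    rw [bar_eq_zero]
    · simpa using hnn (y, s) ⟨mem_closedBall.2 hy.le, hs'⟩
    · rw [← dist_eq_norm, hy]; linarith [hs'.2]
  · intro y hy s hs' hneg
    have hin : ‖y - x0‖ ^ 2 < r ^ 2 + (s - t0) / 4 := by
      by_contra! hge
      simp only [hw] at hneg
      rw [bar_eq_zero _ _ hge] at hneg
      have := hnn _ (show (y, s) ∈ _ from ⟨ball_subset_closedBall hy, hs'.1.le, hs'.2⟩)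
      linarith
    obtain ⟨c1, w', b, σ, c2, c3, c4⟩ := barrier_sub hlam hq (hsol y hy s hs')
      (hasDerivWithinAt_const s (Iic s) (ℓ * (r ^ 2) ^ e)) (by positivity) (hpos s hs'.1.le) hin
    exact ⟨c1, w', b, σ, c2, fun k => hlam.le.trans (c3 k), by linarith⟩

variable [MeasurableSpace E] [BorelSpace E]

/-- Open parabolic cylinder with centre `(x, t)`. -/
def pcyl (x : E) (t r : ℝ) : Set (E × ℝ) := ball x r ×ˢ Ioo (t - r ^ 2) (t + r ^ 2)

theorem volume_pcyl [Nontrivial E] (x : E) (t : ℝ) {r : ℝ} (hr : 0 ≤ r) :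
    volume (pcyl x t r) = ENNReal.ofReal (2 * r ^ (finrank ℝ E + 2)) * volume (ball (0 : E) 1) := by
  rw [pcyl, Measure.volume_eq_prod, Measure.prod_prod, Measure.addHaar_ball _ _ hr, Real.volume_Ioo,
    mul_right_comm, ← ENNReal.ofReal_mul (by positivity)]
  congr 2; ring

/-- Measure-to-point estimate: if `u` exceeds `M` on most of a cylinder, then it exceeds `1`
at later times. -/
theorem measure_to_point [Nontrivial E] {lam Lam : ℝ} (hlam : 0 < lam) {e : ℕ}
    (hq : BarParam (finrank ℝ E) lam Lam (e + 2)) :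
    ∃ M : ℝ, 1 < M ∧ ∃ μ : ℝ, 0 < μ ∧ μ < 1 ∧ ∀ (u : E × ℝ → ℝ) (x0 : E) (t0 r : ℝ), 0 < r →
      ContinuousOn u (closedBall x0 (4 * r) ×ˢ Icc (t0 - r ^ 2) (t0 + 40 * r ^ 2)) →
      (∀ p ∈ closedBall x0 (4 * r) ×ˢ Icc (t0 - r ^ 2) (t0 + 40 * r ^ 2), 0 ≤ u p) →
      (∀ x ∈ ball x0 (4 * r), ∀ t ∈ Ioc (t0 - r ^ 2) (t0 + 40 * r ^ 2), u (x, t) < M →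
        SolAt lam Lam u (x, t)) →
      volume {p ∈ pcyl x0 t0 r | u p < M} < ENNReal.ofReal μ * volume (pcyl x0 t0 r) →
      ∀ x ∈ closedBall x0 (3 * r), 1 < u (x, t0 + 40 * r ^ 2) := by
  set N : ℝ := 11 ^ (e + 2) with hN
  have hN1 : 1 ≤ N := one_le_pow₀ (by norm_num)
  set d := finrank ℝ E with hd
  set C1 : ℝ := N * 2 ^ e with hC1
  have hC1p : 0 < C1 := by positivity
  set K : ℝ := 4 * C1 * (d.factorial * (C1 / lam) ^ d) with hK
  have hKp : 0 < K := by positivity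
  refine ⟨C1 + 1, by linarith, min (1 / 2) (1 / (16 ^ d * (2 * K))), by positivity,
    (min_le_left _ _).trans_lt (by norm_num), ?_⟩
  intro u x0 t0 r hr hc hnn hsol hvol x hx
  by_contra! hle
  have hr2 : 0 < r ^ 2 := by positivity
  set ts := t0 - r ^ 2 with hts
  set te := t0 + 40 * r ^ 2 with hte
  set k : ℝ → ℝ := fun t => N * (r ^ 2) ^ e * min ((t - ts) / r ^ 2) 1 with hk
  set w : E × ℝ → ℝ := fun p => u p - k p.2 * bar (e + 2) x0 (r ^ 2 / 2 + (p.2 - ts) / 4) p.1 with hw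
  have hpos : ∀ t, ts ≤ t → 0 < r ^ 2 / 2 + (t - ts) / 4 := fun t ht => by linarith
  have hbar : ∀ t, ts ≤ t → ∀ y, (r ^ 2) ^ e * bar (e + 2) x0 (r ^ 2 / 2 + (t - ts) / 4) y ≤ 2 ^ e := by
    intro t ht y
    have h1 := bar_le e x0 (hpos t ht) y
    have h2 : (1 : ℝ) / (r ^ 2 / 2 + (t - ts) / 4) ^ e ≤ 1 / (r ^ 2 / 2) ^ e := by
      gcongr; linarith
    calc (r ^ 2) ^ e * bar (e + 2) x0 (r ^ 2 / 2 + (t - ts) / 4) y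
        ≤ (r ^ 2) ^ e * (1 / (r ^ 2 / 2) ^ e) := by gcongr; exact h1.trans h2
      _ = 2 ^ e := by rw [div_pow]; field_simp
  have hφ : ∀ t, ts ≤ t → ∀ y, k t * bar (e + 2) x0 (r ^ 2 / 2 + (t - ts) / 4) y ≤ C1 := by
    intro t ht y
    have h1 := bar_nonneg (e + 2) x0 (hpos t ht) y
    have h2 : k t ≤ N * (r ^ 2) ^ e * 1 := by
      simp only [hk]; gcongr; exact min_le_right _ _
    calc _ ≤ N * (r ^ 2) ^ e * 1 * bar (e + 2) x0 (r ^ 2 / 2 + (t - ts) / 4) y := by gcongr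
      _ = N * ((r ^ 2) ^ e * bar (e + 2) x0 (r ^ 2 / 2 + (t - ts) / 4) y) := by ring
      _ ≤ N * 2 ^ e := by gcongr; exact hbar t ht y
  have hx1 : x ∈ closedBall x0 (4 * r) := closedBall_subset_closedBall (by linarith) hx
  have hinside : ∀ y, ∀ t, ts ≤ t → 0 ≤ u (y, t) → w (y, t) < 0 →
      ‖y - x0‖ ^ 2 < r ^ 2 / 2 + (t - ts) / 4 := by
    intro y t _ hu hneg
    by_contra! hge
    simp only [hw] at hneg
    rw [bar_eq_zero _ _ hge] at hneg
    linarith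
  have h := abp (x0 := x0) (x1 := x) (R := 4 * r) (t0 := ts) (t1 := te) (lam := lam)
    (C := C1 / r ^ 2) hlam (by positivity) (by positivity) (by linarith) (w := w) ?_ ?_ ?_
    (K1 := ball x0 r ×ˢ Ioc ts (ts + r ^ 2)) (isOpen_ball.measurableSet.prod measurableSet_Ioc) ?_ hx1 ?_
  · set G := {p ∈ pcyl x0 t0 r | u p < C1 + 1} with hG
    have hsub : {p | p ∈ closedBall x0 (4 * r) ×ˢ Icc ts te ∧ w p < 0} ∩ ball x0 r ×ˢ Ioc ts (ts + r ^ 2) ⊆ G := by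
      rintro ⟨y, t⟩ ⟨⟨⟨h1, h2⟩, h3⟩, h4, h5⟩
      have := hφ t h2.1 y
      simp only [hw] at h3
      refine ⟨⟨h4, h5.1, ?_⟩, by linarith⟩
      have := h5.2
      simp only [hts] at this
      dsimp only
      linarith
    have h1 : volume (ball (0 : E) (1 / (4 * (4 * r)))) =
        ENNReal.ofReal ((1 / (16 * r)) ^ d) * volume (ball (0 : E) 1) := by
      rw [Measure.addHaar_ball _ _ (by positivity)]
      congr 3; ring
    have hB0 : volume (ball (0 : E) 1) ≠ 0 := (measure_ball_pos _ _ one_pos).ne'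
    have hBt : volume (ball (0 : E) 1) ≠ ⊤ := measure_ball_lt_top.ne
    set K' := 4 * (C1 / r ^ 2) * (d.factorial * (C1 / r ^ 2 / lam) ^ d) with hK'
    have hK'e : K' = K / (r ^ 2 * (r ^ 2) ^ d) := by
      rw [hK', hK, div_right_comm, div_pow]; field_simp
    have hK'p : 0 < K' := by rw [hK'e]; positivity
    have h2 : volume (ball (0 : E) (1 / (4 * (4 * r)))) < volume (ball (0 : E) (1 / (4 * (4 * r)))) := by
      calc volume (ball (0 : E) (1 / (4 * (4 * r)))) ≤ ENNReal.ofReal K' * volume G :=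
            h.trans (by gcongr)
        _ < ENNReal.ofReal K' *
            (ENNReal.ofReal (min (1 / 2) (1 / (16 ^ d * (2 * K)))) * volume (pcyl x0 t0 r)) := by
          refine ENNReal.mul_lt_mul_right ?_ ENNReal.ofReal_ne_top hvol
          simpa using hK'p
        _ ≤ ENNReal.ofReal K' * (ENNReal.ofReal (1 / (16 ^ d * (2 * K))) * volume (pcyl x0 t0 r)) := by
          gcongr; exact min_le_right _ _
        _ = _ := by
          rw [h1, volume_pcyl _ _ hr.le, ← mul_assoc, ← mul_assoc, ← ENNReal.ofReal_mul hK'p.le,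
            ← ENNReal.ofReal_mul (by positivity)]
          congr 2
          rw [hK'e, div_pow, mul_pow, pow_add]; field_simp
          ring
    exact lt_irrefl _ h2
  · refine hc.sub (ContinuousOn.mul (by simp only [hk]; fun_prop) ?_)
    exact (continuousOn_bar (e + 2) x0).comp
      (f := fun p : E × ℝ => (p.1, r ^ 2 / 2 + (p.2 - ts) / 4)) (by fun_prop) fun p hp => hpos _ hp.2.1
  · intro y hy
    have := hnn (y, ts) ⟨hy, le_rfl, by linarith⟩
    simpa [hw, hk] using this
  · intro y t hy ht
    have h1 := hnn (y, t) ⟨hy.le, ht⟩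
    by_contra! hneg
    have := hinside y t ht.1 h1 hneg
    rw [← dist_eq_norm, hy] at this
    have h3 := ht.2
    simp only [hte] at h3
    nlinarith
  · intro y hy t ht hneg
    have hnn1 := hnn (y, t) ⟨ball_subset_closedBall hy, ht.1.le, ht.2⟩
    have hin := hinside y t ht.1.le hnn1 hneg
    have hkp : 0 < k t := by
      simp only [hk]
      have : 0 < (t - ts) / r ^ 2 := div_pos (by linarith [ht.1]) hr2
      positivity
    have hbn := bar_nonneg (e + 2) x0 (hpos t ht.1.le) y
    have hsolt := hsol y hy t ht (by
      have := hφ t ht.1.le y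
      simp only [hw] at hneg
      linarith)
    rcases le_or_gt t (ts + r ^ 2) with hcase | hcase
    · have hkd : HasDerivWithinAt k (N * (r ^ 2) ^ e * (1 / r ^ 2)) (Iic t) t := by
        have h1 : HasDerivAt (fun t => N * (r ^ 2) ^ e * ((t - ts) / r ^ 2))
            (N * (r ^ 2) ^ e * (1 / r ^ 2)) t :=
          (((hasDerivAt_id t).sub_const ts).div_const _).const_mul _
        have h2 : ∀ s ∈ Iic t, k s = N * (r ^ 2) ^ e * ((s - ts) / r ^ 2) := by
          intro s hs
          simp only [hk]
          rw [min_eq_left]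
          rw [div_le_one hr2]
          have : s ≤ t := hs
          linarith
        exact h1.hasDerivWithinAt.congr h2 (h2 t (mem_Iic.2 le_rfl))
      obtain ⟨c1, w', b, σ, c2, c3, c4⟩ := barrier_sub hlam hq hsolt hkd hkp (hpos t ht.1.le) hin
      refine ⟨c1, w', b, σ, c2, c3, c4.le.trans ?_, fun hn => absurd ?_ hn⟩
      · have h2 := hbar t ht.1.le y
        have : N * (r ^ 2) ^ e * (1 / r ^ 2) * bar (e + 2) x0 (r ^ 2 / 2 + (t - ts) / 4) y ≤ C1 / r ^ 2 := by
          calc _ = N * ((r ^ 2) ^ e * bar (e + 2) x0 (r ^ 2 / 2 + (t - ts) / 4) y) / r ^ 2 := by ring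
            _ ≤ N * 2 ^ e / r ^ 2 := by gcongr
        linarith
      · refine ⟨?_, ht.1, hcase⟩
        rw [mem_ball, dist_eq_norm]
        refine lt_of_pow_lt_pow_left₀ 2 hr.le (hin.trans_le ?_)
        linarith
    · have hkd : HasDerivWithinAt k 0 (Iic t) t := by
        have h2 : k =ᶠ[𝓝 t] fun _ => N * (r ^ 2) ^ e * 1 := by
          filter_upwards [lt_mem_nhds hcase] with s hs
          simp only [hk]
          rw [min_eq_right]
          rw [le_div_iff₀ hr2]; linarith
        exact ((hasDerivAt_const t _).congr_of_eventuallyEq h2).hasDerivWithinAt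
      obtain ⟨c1, w', b, σ, c2, c3, c4⟩ := barrier_sub hlam hq hsolt hkd hkp (hpos t ht.1.le) hin
      rw [zero_mul, add_zero] at c4
      exact ⟨c1, w', b, σ, c2, c3, c4.le.trans (by linarith [show 0 < C1 / r ^ 2 by positivity]),
        fun _ => c4⟩
  · simp only [hw]
    have hnorm : ‖x - x0‖ ^ 2 ≤ 9 * r ^ 2 := by
      rw [← dist_eq_norm]
      have := mem_closedBall.1 hx
      nlinarith [dist_nonneg (x := x) (y := x0)]
    have hse : r ^ 2 / 2 + (te - ts) / 4 = 43 / 4 * r ^ 2 := by simp only [hte, hts]; ring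
    have hk1 : k te = N * (r ^ 2) ^ e := by
      simp only [hk]
      rw [min_eq_right, mul_one]
      rw [le_div_iff₀ hr2]; simp only [hte, hts]; linarith
    rw [hse, hk1, bar_eq _ _ (by linarith)]
    suffices 2 ≤ N * (r ^ 2) ^ e * ((43 / 4 * r ^ 2 - ‖x - x0‖ ^ 2) ^ 2 / (43 / 4 * r ^ 2) ^ (e + 2)) by
      linarith
    have h1 : (7 / 4 * r ^ 2) ^ 2 ≤ (43 / 4 * r ^ 2 - ‖x - x0‖ ^ 2) ^ 2 := by
      gcongr; linarith
    have h2 : ((43:ℝ) / 4) ^ (e + 2) ≤ N := by rw [hN]; gcongr; norm_num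
    calc (2 : ℝ) ≤ (49 / 16) * (N / (43 / 4) ^ (e + 2)) := by
          have : 1 ≤ N / (43 / 4) ^ (e + 2) := by rwa [one_le_div (by positivity)]
          linarith
      _ = N * (r ^ 2) ^ e * ((7 / 4 * r ^ 2) ^ 2 / (43 / 4 * r ^ 2) ^ (e + 2)) := by
          rw [mul_pow (43 / 4), pow_add (r ^ 2)]; field_simp; norm_num
      _ ≤ _ := by gcongr

end Barrier

section InkSpots

theorem volume_union_tails {ι : Type*} (a c b : ι → ℝ) (θ : ℝ) (hθ : 0 ≤ θ) (hac : ∀ i, a i ≤ c i)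
    (hcb : ∀ i, c i ≤ b i) (h : ∀ i, θ * (b i - a i) ≤ b i - c i) (s : Finset ι) (x : ℝ) :
    ENNReal.ofReal θ * volume ((⋃ i ∈ s, Ioo (a i) (b i)) ∩ Ioi x) ≤
      volume ((⋃ i ∈ s, Ioo (c i) (b i)) ∩ Ioi x) := by
  revert x
  induction s using Finset.induction_on_min_value a with
  | empty => intro x; simp
  | insert i s hi hmin ih =>
    have key : ∀ x, a i ≤ x → ENNReal.ofReal θ * volume ((⋃ j ∈ insert i s, Ioo (a j) (b j)) ∩ Ioi x)
        ≤ volume ((⋃ j ∈ insert i s, Ioo (c j) (b j)) ∩ Ioi x) := by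
      intro x hx
      rcases le_or_gt (b i) x with hb | hb
      · have e1 : (⋃ j ∈ insert i s, Ioo (a j) (b j)) ∩ Ioi x = (⋃ j ∈ s, Ioo (a j) (b j)) ∩ Ioi x := by
          rw [Finset.set_biUnion_insert, union_inter_distrib_right]
          rw [show Ioo (a i) (b i) ∩ Ioi x = ∅ from ?_, empty_union]
          ext y; simp only [mem_inter_iff, mem_Ioo, mem_Ioi, mem_empty_iff_false, iff_false]
          rintro ⟨⟨_, h1⟩, h2⟩; linarith
        rw [e1]
        refine (ih x).trans (measure_mono (inter_subset_inter_left _ ?_))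
        rw [Finset.set_biUnion_insert]; exact subset_union_right
      · have hup : volume ((⋃ j ∈ insert i s, Ioo (a j) (b j)) ∩ Ioi x) ≤
            volume ((⋃ j ∈ s, Ioo (a j) (b j)) ∩ Ioi (b i)) + ENNReal.ofReal (b i - x) := by
          rw [← Real.volume_Ioc]
          refine (measure_mono ?_).trans (measure_union_le _ _)
          rintro y ⟨hy, hyx⟩
          rcases le_or_gt y (b i) with h1 | h1
          · exact Or.inr ⟨hyx, h1⟩
          · refine Or.inl ⟨?_, h1⟩
            rw [Finset.set_biUnion_insert] at hy
            rcases hy with hy | hy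
            · exact absurd hy.2 (not_lt.2 h1.le)
            · exact hy
        have hlow : volume ((⋃ j ∈ s, Ioo (c j) (b j)) ∩ Ioi (b i)) +
            ENNReal.ofReal (b i - max (c i) x) ≤ volume ((⋃ j ∈ insert i s, Ioo (c j) (b j)) ∩ Ioi x) := by
          rw [← Real.volume_Ioo, ← measure_union _ measurableSet_Ioo]
          · apply measure_mono
            rintro y (⟨hy, hyb⟩ | hy)
            · refine ⟨?_, hb.trans hyb⟩
              rw [Finset.set_biUnion_insert]; exact Or.inr hy
            · refine ⟨?_, (le_max_right _ _).trans_lt hy.1⟩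
              rw [Finset.set_biUnion_insert]; exact Or.inl ⟨(le_max_left _ _).trans_lt hy.1, hy.2⟩
          · rw [Set.disjoint_left]
            rintro y ⟨_, hy⟩ hy2
            exact absurd hy2.2 (not_lt.2 (le_of_lt hy))
        refine le_trans ?_ hlow
        refine (mul_le_mul_right hup _).trans ?_
        rw [mul_add, ← ENNReal.ofReal_mul hθ]
        refine add_le_add (ih _) (ENNReal.ofReal_le_ofReal ?_)
        rcases le_total (c i) x with h1 | h1
        · rw [max_eq_right h1]
          have h2 := h i
          have h3 := hac i
          have h4 := hcb i
          have : θ ≤ 1 := by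
            by_contra! hh
            nlinarith
          nlinarith
        · rw [max_eq_left h1]
          refine le_trans ?_ (h i)
          gcongr
    intro x
    rcases le_or_gt (a i) x with hx | hx
    · exact key x hx
    · refine le_trans ?_ ((key (a i) le_rfl).trans (measure_mono (inter_subset_inter_right _ (Ioi_subset_Ioi hx.le))))
      refine mul_le_mul_right (measure_mono ?_) _
      rintro y ⟨hy, _⟩
      refine ⟨hy, ?_⟩
      rw [Finset.set_biUnion_insert] at hy
      rcases hy with hy | hy
      · exact hy.1
      · simp only [mem_iUnion] at hy
        obtain ⟨j, hj, hy⟩ := hy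
        exact (hmin j hj).trans_lt hy.1

theorem volume_union_le_volume_union {ι : Type*} (S : Set ι) (a c b : ι → ℝ) (θ : ℝ) (hθ : 0 ≤ θ)
    (hac : ∀ i, a i ≤ c i)
    (hcb : ∀ i, c i ≤ b i) (h : ∀ i, θ * (b i - a i) ≤ b i - c i) :
    ENNReal.ofReal θ * volume (⋃ i ∈ S, Ioo (a i) (b i)) ≤ volume (⋃ i ∈ S, Ioo (c i) (b i)) := by
  have hopen : IsOpen (⋃ i ∈ S, Ioo (a i) (b i)) := isOpen_biUnion fun i _ => isOpen_Ioo
  rw [hopen.measure_eq_iSup_isCompact]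
  simp only [ENNReal.mul_iSup, iSup_le_iff]
  intro K hK hKc
  obtain ⟨t, hts, htf, ht⟩ := hKc.elim_finite_subcover_image (b := S) (c := fun i => Ioo (a i) (b i))
    (fun i _ => isOpen_Ioo) hK
  obtain ⟨s, rfl⟩ := htf.exists_finset_coe
  obtain ⟨x, hx⟩ : ∃ x, ∀ i ∈ s, x < a i := by
    obtain ⟨x, hx⟩ := (s.image a).bddBelow
    exact ⟨x - 1, fun i hi => by
      have := hx (Finset.mem_coe.2 (Finset.mem_image_of_mem a hi)); linarith⟩
  have e := volume_union_tails a c b θ hθ hac hcb h s x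
  refine le_trans ?_ (e.trans (measure_mono ?_))
  · refine mul_le_mul_right (measure_mono ?_) _
    intro y hy
    constructor
    · simpa using ht hy
    · have := ht hy
      simp only [mem_iUnion] at this
      obtain ⟨i, hi, hy⟩ := this
      exact (hx i hi).trans hy.1
  · refine inter_subset_left.trans ?_
    intro y hy
    simp only [mem_iUnion] at hy ⊢
    obtain ⟨i, hi, hy⟩ := hy
    exact ⟨i, hts hi, hy⟩

variable {E : Type*} [NormedAddCommGroup E] [InnerProductSpace ℝ E] [FiniteDimensional ℝ E]
  [MeasurableSpace E] [BorelSpace E]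

theorem isOpen_pcyl (x : E) (t r : ℝ) : IsOpen (pcyl x t r) := isOpen_ball.prod isOpen_Ioo

theorem mem_pcyl_self (x : E) (t : ℝ) {r : ℝ} (hr : 0 < r) : (x, t) ∈ pcyl x t r :=
  ⟨mem_ball_self hr, by constructor <;> simp <;> positivity⟩

theorem pcyl_subset_of_inter {x y : E} {t s r ρ : ℝ} (hr : 0 < r) (hρ : 0 < ρ) (h : r ≤ 2 * ρ)
    (hne : (pcyl x t r ∩ pcyl y s ρ).Nonempty) : pcyl x t r ⊆ pcyl y s (5 * ρ) := by
  obtain ⟨⟨z, τ⟩, ⟨hz1, hτ1⟩, hz2, hτ2⟩ := hne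
  simp only [mem_ball, mem_Ioo] at hz1 hτ1 hz2 hτ2
  rintro ⟨w, σ⟩ ⟨hw, hσ⟩
  simp only [mem_ball, mem_Ioo] at hw hσ
  refine ⟨?_, ?_, ?_⟩
  · have h1 := dist_triangle4 w x z y
    rw [dist_comm x z] at h1
    simp only [mem_ball]
    linarith
  · simp only; nlinarith
  · simp only; nlinarith

/-- Covering argument: the union of critical cylinders is substantially larger than `S`. -/
theorem volume_union_critical [Nontrivial E] {S : Set (E × ℝ)} (hS : MeasurableSet S)
    {μ R : ℝ} (r : E × ℝ → ℝ) (hr : ∀ p ∈ S, 0 < r p) (hrR : ∀ p ∈ S, r p ≤ R)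
    (hbad : ∀ p ∈ S, ENNReal.ofReal μ * volume (pcyl p.1 p.2 (r p)) ≤
      volume (pcyl p.1 p.2 (r p) \ S)) :
    (1 + ENNReal.ofReal μ * ENNReal.ofReal ((5 : ℝ) ^ (finrank ℝ E + 2))⁻¹) * volume S ≤
      volume (⋃ p ∈ S, pcyl p.1 p.2 (r p)) := by
  set G := ⋃ p ∈ S, pcyl p.1 p.2 (r p) with hG
  have hSG : S ⊆ G := fun p hp => mem_biUnion hp (mem_pcyl_self p.1 p.2 (hr p hp))
  obtain ⟨T, hTS, hTd, hT⟩ := Vitali.exists_disjoint_subfamily_covering_enlargement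
    (fun p : E × ℝ => pcyl p.1 p.2 (r p)) S r 2 one_lt_two (fun p hp => (hr p hp).le) R hrR
    (fun p hp => ⟨p, mem_pcyl_self _ _ (hr p hp)⟩)
  have hTc : T.Countable := hTd.countable_of_isOpen (fun p _ => isOpen_pcyl _ _ _)
    (fun p hp => ⟨p, mem_pcyl_self _ _ (hr p (hTS hp))⟩)
  have h1 : volume G ≤ ∑' p : T, volume (pcyl p.1.1 p.1.2 (5 * r p)) := by
    refine (measure_mono ?_).trans (measure_biUnion_le volume hTc
      (fun q : E × ℝ => pcyl q.1 q.2 (5 * r q)))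
    refine iUnion₂_subset fun p hp => ?_
    obtain ⟨q, hq, hne, hle⟩ := hT p hp
    exact (pcyl_subset_of_inter (hr p hp) (hr q (hTS hq)) hle hne).trans
      (subset_biUnion_of_mem (u := fun q : E × ℝ => pcyl q.1 q.2 (5 * r q)) hq)
  have h2 : ∑' p : T, volume (pcyl p.1.1 p.1.2 (r p) \ S) ≤ volume (G \ S) := by
    rw [← measure_biUnion hTc (f := fun p : E × ℝ => pcyl p.1 p.2 (r p) \ S)]
    · apply measure_mono
      refine iUnion₂_subset fun p hp => sdiff_subset_sdiff_left
        (subset_biUnion_of_mem (u := fun q : E × ℝ => pcyl q.1 q.2 (r q)) (hTS hp))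
    · intro p hp q hq hpq
      exact (hTd hp hq hpq).mono sdiff_subset sdiff_subset
    · intro p _
      exact (isOpen_pcyl _ _ _).measurableSet.diff hS
  have h3 : ∀ p : T, ENNReal.ofReal μ * ENNReal.ofReal ((5 : ℝ) ^ (finrank ℝ E + 2))⁻¹ *
      volume (pcyl p.1.1 p.1.2 (5 * r p)) ≤ volume (pcyl p.1.1 p.1.2 (r p) \ S) := by
    intro p
    have hp := hr p (hTS p.2)
    refine le_trans (le_of_eq ?_) (hbad p (hTS p.2))
    rw [volume_pcyl _ _ (by positivity), volume_pcyl _ _ hp.le, mul_assoc, ← mul_assoc (ENNReal.ofReal _⁻¹),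
      ← ENNReal.ofReal_mul (by positivity)]
    congr 3
    rw [mul_pow]; field_simp
  have h4 : ENNReal.ofReal μ * ENNReal.ofReal ((5 : ℝ) ^ (finrank ℝ E + 2))⁻¹ * volume G ≤
      volume (G \ S) := by
    refine (mul_le_mul_right h1 _).trans (le_trans ?_ h2)
    rw [← ENNReal.tsum_mul_left]
    exact ENNReal.tsum_le_tsum h3
  calc _ = volume S + ENNReal.ofReal μ * ENNReal.ofReal ((5 : ℝ) ^ (finrank ℝ E + 2))⁻¹ * volume S := by
        rw [add_mul, one_mul]
    _ ≤ volume S + volume (G \ S) := by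
        gcongr
        exact (mul_le_mul_right (measure_mono hSG) _).trans h4
    _ = volume G := by
        rw [measure_add_sdiff hS.nullMeasurableSet, union_eq_self_of_subset_left hSG]

/-- Parabolic ink-spots lemma with time shift. -/
theorem ink_spots [Nontrivial E] {S F : Set (E × ℝ)} (hS : IsOpen S) {μ m r0 : ℝ} (hμ : 0 < μ)
    (hm : 40 ≤ m) (hr0' : 0 < r0)
    (hprop : ∀ x t r, (x, t) ∈ S → 0 < r → r ≤ 2 * r0 →
      volume (pcyl x t r \ S) < ENNReal.ofReal μ * volume (pcyl x t r) →
      r ≤ r0 ∧ ball x (2 * r) ×ˢ Ioo (t + 40 * r ^ 2) (t + m * r ^ 2) ⊆ F) :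
    ENNReal.ofReal ((m - 40) / (m + 4)) *
      ((1 + ENNReal.ofReal μ * ENNReal.ofReal ((5 : ℝ) ^ (finrank ℝ E + 2))⁻¹) * volume S) ≤
      volume F := by
  have hchoose : ∀ p ∈ S, ∃ r, 0 < r ∧ r ≤ r0 ∧
      volume (pcyl p.1 p.2 r \ S) < ENNReal.ofReal μ * volume (pcyl p.1 p.2 r) ∧
      ENNReal.ofReal μ * volume (pcyl p.1 p.2 (2 * r)) ≤ volume (pcyl p.1 p.2 (2 * r) \ S) := by
    rintro ⟨x, t⟩ hp
    by_contra! hcon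
    obtain ⟨r1, h1, h1', hsub⟩ : ∃ r1, 0 < r1 ∧ r1 ≤ r0 ∧ pcyl x t r1 ⊆ S := by
      obtain ⟨ε, hε, hb⟩ := Metric.isOpen_iff.1 hS _ hp
      refine ⟨min (min (ε / 2) 1) r0, by positivity, min_le_right _ _, ?_⟩
      set r1 := min (min (ε / 2) 1) r0
      have a1 : r1 ≤ ε / 2 := (min_le_left _ _).trans (min_le_left _ _)
      have a2 : r1 ≤ 1 := (min_le_left _ _).trans (min_le_right _ _)
      have a3 : 0 < r1 := by positivity
      rintro ⟨y, s⟩ ⟨hy, hs1, hs2⟩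
      refine hb ?_
      simp only [mem_ball, Prod.dist_eq, Real.dist_eq] at hy hs1 hs2 ⊢
      refine max_lt (by linarith) (abs_lt.2 ⟨by nlinarith, by nlinarith⟩)
    have hall : ∀ j : ℕ, 2 ^ j * r1 ≤ r0 ∧
        volume (pcyl x t (2 ^ j * r1) \ S) < ENNReal.ofReal μ * volume (pcyl x t (2 ^ j * r1)) := by
      intro j
      induction j with
      | zero =>
        rw [pow_zero, one_mul, sdiff_eq_bot_iff.2 hsub]
        refine ⟨h1', ?_⟩
        rw [bot_eq_empty, measure_empty]
        exact ENNReal.mul_pos (by simpa using hμ)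
          ((isOpen_pcyl x t r1).measure_pos volume ⟨_, mem_pcyl_self x t h1⟩).ne'
      | succ j ih =>
        have h2 := hcon (2 ^ j * r1) (by positivity) ih.1 ih.2
        have e : 2 ^ (j + 1) * r1 = 2 * (2 ^ j * r1) := by ring
        rw [e]
        exact ⟨(hprop x t _ hp (by positivity) (by linarith [ih.1]) h2).1, h2⟩
    obtain ⟨j, hj⟩ := pow_unbounded_of_one_lt (r0 / r1) (one_lt_two (α := ℝ))
    rw [div_lt_iff₀ h1] at hj
    exact absurd (hall j).1 (not_le.2 hj)
  choose! r hr0 hrr hgood hbad using hchoose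
  set V := ⋃ p ∈ S, ball p.1 (2 * r p) ×ˢ Ioo (p.2 + 40 * r p ^ 2) (p.2 + m * r p ^ 2) with hV
  have hVF : V ⊆ F := iUnion₂_subset fun p hp =>
    (hprop p.1 p.2 (r p) hp (hr0 p hp) (by linarith [hr0 p hp, hrr p hp]) (hgood p hp)).2
  set W := ⋃ p ∈ S, ball p.1 (2 * r p) ×ˢ Ioo (p.2 - 4 * r p ^ 2) (p.2 + m * r p ^ 2) with hW
  have hVW : ENNReal.ofReal ((m - 40) / (m + 4)) * volume W ≤ volume V := by
    have hVm : MeasurableSet V := (isOpen_biUnion fun p _ => isOpen_ball.prod isOpen_Ioo).measurableSet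
    have hWm : MeasurableSet W := (isOpen_biUnion fun p _ => isOpen_ball.prod isOpen_Ioo).measurableSet
    rw [Measure.volume_eq_prod, Measure.prod_apply hVm, Measure.prod_apply hWm,
      ← lintegral_const_mul' _ _ ENNReal.ofReal_ne_top]
    refine lintegral_mono fun y => ?_
    have sl : ∀ c : E × ℝ → ℝ, Prod.mk y ⁻¹' (⋃ p ∈ S, ball p.1 (2 * r p) ×ˢ
        Ioo (c p) (p.2 + m * r p ^ 2)) = ⋃ p ∈ {p ∈ S | y ∈ ball p.1 (2 * r p)},
        Ioo (c p) (p.2 + m * r p ^ 2) := by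
      intro c
      ext s
      simp only [mem_preimage, mem_iUnion, mem_prod, exists_prop, mem_ofPred_eq]
      constructor
      · rintro ⟨p, h1, h2, h3⟩; exact ⟨p, ⟨h1, h2⟩, h3⟩
      · rintro ⟨p, ⟨h1, h2⟩, h3⟩; exact ⟨p, h1, h2, h3⟩
    rw [hV, hW, sl, sl]
    refine volume_union_le_volume_union _ _ _ _ _ (div_nonneg (by linarith) (by linarith)) ?_ ?_ ?_
    · intro p; nlinarith [sq_nonneg (r p)]
    · intro p; nlinarith [sq_nonneg (r p)]
    · intro p
      have : 0 < m + 4 := by linarith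
      apply le_of_eq; field_simp; ring
  have hG := volume_union_critical hS.measurableSet (μ := μ) (R := 2 * r0) (fun p => 2 * r p)
    (fun p hp => by linarith [hr0 p hp]) (fun p hp => by linarith [hrr p hp]) hbad
  refine le_trans (mul_le_mul_right (hG.trans (measure_mono ?_)) _) (hVW.trans (measure_mono hVF))
  refine iUnion₂_mono fun p hp => ?_
  refine prod_mono_right (Ioo_subset_Ioo ?_ ?_)
  · apply le_of_eq; ring
  · nlinarith [sq_nonneg (r p)]

end InkSpots

section Growth

variable {E : Type*} [NormedAddCommGroup E] [InnerProductSpace ℝ E] [FiniteDimensional ℝ E]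
  [MeasurableSpace E] [BorelSpace E]

/-- The conclusion of the measure-to-point estimate, for given constants. -/
def MeasToPoint (E : Type*) [NormedAddCommGroup E] [InnerProductSpace ℝ E] [FiniteDimensional ℝ E]
    [MeasurableSpace E] [BorelSpace E] (lam Lam M μ : ℝ) : Prop :=
  ∀ (u : E × ℝ → ℝ) (x0 : E) (t0 r : ℝ), 0 < r →
      ContinuousOn u (closedBall x0 (4 * r) ×ˢ Icc (t0 - r ^ 2) (t0 + 40 * r ^ 2)) →
      (∀ p ∈ closedBall x0 (4 * r) ×ˢ Icc (t0 - r ^ 2) (t0 + 40 * r ^ 2), 0 ≤ u p) →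
      (∀ x ∈ ball x0 (4 * r), ∀ t ∈ Ioc (t0 - r ^ 2) (t0 + 40 * r ^ 2), u (x, t) < M →
        SolAt lam Lam u (x, t)) →
      volume {p ∈ pcyl x0 t0 r | u p < M} < ENNReal.ofReal μ * volume (pcyl x0 t0 r) →
      ∀ x ∈ closedBall x0 (3 * r), 1 < u (x, t0 + 40 * r ^ 2)

theorem SolAt.max_affine {lam Lam : ℝ} {u : E × ℝ → ℝ} {p : E × ℝ} (h : SolAt lam Lam u p)
    {ℓ : ℝ} (hℓ : ℓ < u p) (c d : ℝ) : SolAt lam Lam (fun q => c * max (u q) ℓ + d) p := by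
  refine SolAt.affine (u := fun q => max (u q) ℓ) ?_ c d
  obtain ⟨h1, b, σ, hσ, h2⟩ := h
  have hx : (fun y => max (u (y, p.2)) ℓ) =ᶠ[𝓝 p.1] fun y => u (y, p.2) := by
    filter_upwards [h1.continuousAt.eventually (lt_mem_nhds (show ℓ < u (p.1, p.2) from hℓ))] with y hy
    exact max_eq_left (le_of_lt hy)
  have ht : (fun s => max (u (p.1, s)) ℓ) =ᶠ[𝓝 p.2] fun s => u (p.1, s) := by
    filter_upwards [h2.continuousAt.eventually (lt_mem_nhds (show ℓ < u (p.1, p.2) from hℓ))] with y hy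
    exact max_eq_left (le_of_lt hy)
  refine ⟨h1.congr_of_eventuallyEq hx, b, σ, hσ, ?_⟩
  rw [trA_congr b σ hx]
  exact h2.congr_of_eventuallyEq ht

theorem growth {lam Lam M μ : ℝ} (hM : 1 < M) (hmtp : MeasToPoint E lam Lam M μ)
    {f : E × ℝ → ℝ} {x : E} {t r H : ℝ} (hr : 0 < r) (hH : 0 < H)
    (hc : ContinuousOn f (closedBall x (4 * r) ×ˢ Icc (t - 41 * r ^ 2) t))
    (hsol : ∀ y ∈ ball x (4 * r), ∀ s ∈ Ioc (t - 41 * r ^ 2) t, H / 2 < f (y, s) →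
      SolAt lam Lam f (y, s))
    (hvol : volume {p ∈ pcyl x (t - 40 * r ^ 2) r | H / 2 < f p} <
      ENNReal.ofReal μ * volume (pcyl x (t - 40 * r ^ 2) r)) (hf : H ≤ f (x, t)) :
    ∃ p ∈ closedBall x (4 * r) ×ˢ Icc (t - 41 * r ^ 2) t, (1 + 1 / (2 * (M - 1))) * H ≤ f p := by
  by_contra! hcon
  have hM1 : 0 < M - 1 := by linarith
  set S := (1 + 1 / (2 * (M - 1))) * H with hS
  have hSe : S = H + H / (2 * (M - 1)) := by rw [hS]; ring
  have hSp : 0 < H / (2 * (M - 1)) := by positivity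
  have hSl : 0 < S - H / 2 := by linarith
  have e1 : t - 40 * r ^ 2 - r ^ 2 = t - 41 * r ^ 2 := by ring
  have e2 : t - 40 * r ^ 2 + 40 * r ^ 2 = t := by ring
  have hM0 : 0 < M / (S - H / 2) := by positivity
  set v : E × ℝ → ℝ := fun q => -(M / (S - H / 2)) * max (f q) (H / 2) + M * S / (S - H / 2) with hv
  have hve : ∀ q, v q = M / (S - H / 2) * (S - max (f q) (H / 2)) := by intro q; rw [hv]; ring
  have hlt : ∀ q, v q < M → H / 2 < f q := by
    intro q hq
    by_contra! hle
    rw [hve, max_eq_right hle, div_mul_cancel₀ _ hSl.ne'] at hq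
    exact lt_irrefl _ hq
  have key := hmtp v x (t - 40 * r ^ 2) r hr
  rw [e1, e2] at key
  have := key ?_ ?_ ?_ ?_ x (mem_closedBall_self (by positivity))
  · rw [hve, max_eq_left (by linarith)] at this
    have h2 : M / (S - H / 2) * (S - f (x, t)) ≤ M / (S - H / 2) * (S - H) := by gcongr
    have h3 : M / (S - H / 2) * (S - H) = 1 := by
      rw [div_mul_eq_mul_div, div_eq_one_iff_eq hSl.ne', hSe]
      field_simp; ring
    linarith
  · exact (continuousOn_const.mul (hc.sup continuousOn_const)).add continuousOn_const
  · intro p hp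
    rw [hve]
    have := hcon p hp
    have : max (f p) (H / 2) ≤ S := max_le this.le (by linarith)
    exact mul_nonneg hM0.le (by linarith)
  · intro y hy s hs h1
    exact (hsol y hy s hs (hlt _ h1)).max_affine (hlt _ h1) _ _
  · refine (measure_mono ?_).trans_lt hvol
    intro q hq
    exact ⟨hq.1, hlt _ hq.2⟩

/-- Iterated growth contradicts boundedness. -/
theorem blowup_bound {lam Lam M μ : ℝ} (hM : 1 < M) (hmtp : MeasToPoint E lam Lam M μ)
    {f : E × ℝ → ℝ} {x0 : E} {t0 δ δ' H : ℝ} (hH : 0 < H) (ρ : ℕ → ℝ) (hρ : ∀ j, 0 < ρ j)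
    (hρ1 : ∀ n, ∑ i ∈ Finset.range n, 4 * ρ i ≤ δ)
    (hρ2 : ∀ n, ∑ i ∈ Finset.range n, 41 * ρ i ^ 2 ≤ δ')
    (hc : ContinuousOn f (closedBall x0 δ ×ˢ Icc (t0 - δ') t0))
    (hsol : ∀ y ∈ ball x0 δ, ∀ s ∈ Ioc (t0 - δ') t0, H / 2 < f (y, s) → SolAt lam Lam f (y, s))
    (hvol : ∀ j x t, closedBall x (4 * ρ j) ⊆ closedBall x0 δ → t - 41 * ρ j ^ 2 ∈ Icc (t0 - δ') t0 →
      t ≤ t0 → volume {p ∈ pcyl x (t - 40 * ρ j ^ 2) (ρ j) | (1 + 1 / (2 * (M - 1))) ^ j * H / 2 < f p} <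
      ENNReal.ofReal μ * volume (pcyl x (t - 40 * ρ j ^ 2) (ρ j))) : f (x0, t0) < H := by
  by_contra! hcon
  have hM1 : 0 < M - 1 := by linarith
  set θ := 1 + 1 / (2 * (M - 1)) with hθ
  have hθ1 : 1 < θ := by
    have : 0 < 1 / (2 * (M - 1)) := by positivity
    linarith
  have hsp1 : ∀ n, 0 ≤ ∑ i ∈ Finset.range n, 4 * ρ i :=
    fun n => Finset.sum_nonneg fun i _ => by linarith [hρ i]
  have hsp2 : ∀ n, 0 ≤ ∑ i ∈ Finset.range n, 41 * ρ i ^ 2 :=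
    fun n => Finset.sum_nonneg fun i _ => by positivity
  have hall : ∀ j : ℕ, ∃ x t, dist x x0 ≤ ∑ i ∈ Finset.range j, 4 * ρ i ∧ t ≤ t0 ∧
      t0 - ∑ i ∈ Finset.range j, 41 * ρ i ^ 2 ≤ t ∧ θ ^ j * H ≤ f (x, t) := by
    intro j
    induction j with
    | zero => exact ⟨x0, t0, by simp, le_rfl, by simp, by simpa using hcon⟩
    | succ j ih =>
      obtain ⟨x, t, h1, h2, h3, h4⟩ := ih
      have g1 := hρ1 (j + 1)
      have g2 := hρ2 (j + 1)
      rw [Finset.sum_range_succ] at g1 g2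
      have b1 : closedBall x (4 * ρ j) ⊆ closedBall x0 δ := closedBall_subset_closedBall' (by linarith)
      have b1' : ball x (4 * ρ j) ⊆ ball x0 δ := ball_subset_ball' (by linarith)
      have hp : 0 < 41 * ρ j ^ 2 := by have := hρ j; positivity
      have b2 : t - 41 * ρ j ^ 2 ∈ Icc (t0 - δ') t0 := ⟨by linarith, by linarith⟩
      have hpw : 1 ≤ θ ^ j := one_le_pow₀ hθ1.le
      obtain ⟨⟨y, s⟩, ⟨hy, hs⟩, hp'⟩ := growth (H := θ ^ j * H) hM hmtp (hρ j) (by positivity)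
        (hc.mono (prod_mono b1 (Icc_subset_Icc b2.1 h2)))
        (fun y hy s hs h => hsol y (b1' hy) s ⟨b2.1.trans_lt hs.1, hs.2.trans h2⟩ (by nlinarith))
        (hvol j x t b1 b2 h2) h4
      simp only [mem_closedBall, mem_Icc] at hy hs
      refine ⟨y, s, ?_, hs.2.trans h2, ?_, ?_⟩
      · rw [Finset.sum_range_succ]
        linarith [dist_triangle y x x0]
      · rw [Finset.sum_range_succ]; linarith
      · rw [pow_succ]; linarith
  obtain ⟨B, hB⟩ := (((isCompact_closedBall x0 δ).prod isCompact_Icc).image_of_continuousOn hc).bddAbove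
  obtain ⟨j, hj⟩ := pow_unbounded_of_one_lt (B / H) hθ1
  rw [div_lt_iff₀ hH] at hj
  obtain ⟨x, t, h1, h2, h3, h4⟩ := hall j
  have : f (x, t) ≤ B := hB ⟨(x, t), ⟨h1.trans (hρ1 j), by linarith [hρ2 j], h2⟩, rfl⟩
  linarith

end Growth

section Decay

variable {E : Type*} [NormedAddCommGroup E] [InnerProductSpace ℝ E] [FiniteDimensional ℝ E]
  [MeasurableSpace E] [BorelSpace E]

/-- Nonnegative solutions in a large normalised cylinder which are at most one at some late point. -/
def NormSol (lam Lam : ℝ) (v : E × ℝ → ℝ) : Prop :=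
  ContinuousOn v (closedBall 0 9 ×ˢ Icc (-4) 100) ∧ (∀ p ∈ closedBall (0 : E) 9 ×ˢ Icc (-4) 100, 0 ≤ v p) ∧
  (∀ x ∈ ball (0 : E) 9, ∀ t ∈ Ioc (-4 : ℝ) 100, SolAt lam Lam v (x, t)) ∧
  ∃ y ∈ closedBall (0 : E) 1, v (y, 100) ≤ 1

theorem density_step [Nontrivial E] {lam Lam M0 μ m : ℝ} (hlam : 0 < lam) (hM0 : 1 < M0)
    (hmtp : MeasToPoint E lam Lam M0 μ) {e : ℕ} (hm : 40 ≤ m)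
    (hq : BarParam (finrank ℝ E) lam Lam (e + 2)) {v : E × ℝ → ℝ} (hv : NormSol lam Lam v)
    {a : ℝ} (ha : 0 < a) {x : E} {t r : ℝ} (hx : ‖x‖ ≤ 2) (ht : t ∈ Icc (-2 : ℝ) 2) (hr : 0 < r)
    (hr1 : r ≤ 1 / 8) (hmr : m * r ^ 2 ≤ 1)
    (hvol : volume {p ∈ pcyl x t r | v p ≤ (4 * M0 * (36 + m) ^ e) * a} <
      ENNReal.ofReal μ * volume (pcyl x t r)) :
    (∀ y ∈ closedBall x (2 * r), ∀ s ∈ Icc (t + 40 * r ^ 2) (t + m * r ^ 2), a < v (y, s)) ∧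
      a * (r ^ 2) ^ e ≤ 1 := by
  obtain ⟨hc, hnn, hsol, Y, hY, hY1⟩ := hv
  have hr2 : 0 < r ^ 2 := by positivity
  have hr3 : r ^ 2 ≤ 1 / 64 := by nlinarith
  have hM0p : 0 < M0 := by linarith
  have hP : 0 < (36 + m) ^ e := by positivity
  set ℓ := 4 * (36 + m) ^ e * a with hℓ
  have hℓp : 0 < ℓ := by positivity
  have hin : ∀ z, z ∈ closedBall x 6 → z ∈ closedBall (0 : E) 9 := by
    intro z hz
    rw [mem_closedBall] at hz ⊢
    rw [← dist_zero_right] at hx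
    linarith [dist_triangle z x 0]
  have hin' : ∀ z, z ∈ ball x 6 → z ∈ ball (0 : E) 9 := by
    intro z hz
    rw [mem_ball] at hz ⊢
    rw [← dist_zero_right] at hx
    linarith [dist_triangle z x 0]
  have hstart : ∀ z ∈ closedBall x (3 * r), ℓ ≤ v (z, t + 40 * r ^ 2) := by
    intro z hz
    have hsub : closedBall x (4 * r) ×ˢ Icc (t - r ^ 2) (t + 40 * r ^ 2) ⊆
        closedBall (0 : E) 9 ×ˢ Icc (-4) 100 := by
      refine prod_mono (fun z hz => hin z (closedBall_subset_closedBall (by linarith) hz))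
        (Icc_subset_Icc (by linarith [ht.1]) (by linarith [ht.2]))
    have h1 := hmtp (fun q => 1 / ℓ * v q + 0) x t r hr
      ((continuousOn_const.mul (hc.mono hsub)).add continuousOn_const)
      (fun p hp => by have := hnn p (hsub hp); positivity)
      (fun y hy s hs _ => (hsol y (hin' y (ball_subset_ball (by linarith) hy)) s
        ⟨by linarith [ht.1, hs.1], by linarith [hs.2, ht.2]⟩).affine _ _)
      ((measure_mono ?_).trans_lt hvol) z hz
    · simp only [add_zero] at h1
      rw [one_div_mul_eq_div, lt_div_iff₀ hℓp] at h1
      linarith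
    · rintro p ⟨hp1, hp2⟩
      refine ⟨hp1, ?_⟩
      simp only [add_zero] at hp2
      rw [one_div_mul_eq_div, div_lt_iff₀ hℓp] at hp2
      rw [hℓ] at hp2
      nlinarith
  have hprop := propagate (u := v) (x0 := x) (L := 6) (r := 3 * r) (t0 := t + 40 * r ^ 2) (t1 := 100)
    hlam hq (by positivity) hℓp
    (hc.mono (prod_mono hin (Icc_subset_Icc (by linarith [ht.1]) le_rfl)))
    (fun p hp => hnn p ⟨hin _ hp.1, by linarith [hp.2.1, ht.1], hp.2.2⟩)
    (fun y hy s hs => hsol y (hin' y hy) s ⟨by linarith [hs.1, ht.1], hs.2⟩)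
    hstart (by nlinarith [ht.1])
  constructor
  · intro y hy s hs
    have hs2 : s ≤ 100 := by linarith [hs.2, ht.2]
    refine lt_of_lt_of_le ?_ (hprop y (closedBall_subset_closedBall (by linarith) hy) s ⟨hs.1, hs2⟩)
    set σ := (3 * r) ^ 2 + (s - (t + 40 * r ^ 2)) / 4 with hσ
    have hσ1 : 9 * r ^ 2 ≤ σ := by nlinarith [hs.1]
    have hσ2 : σ ≤ (9 + m / 4) * r ^ 2 := by nlinarith [hs.2]
    have hσp : 0 < σ := by linarith
    rw [mem_closedBall, dist_eq_norm] at hy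
    have hyx : ‖y - x‖ ^ 2 ≤ 4 * r ^ 2 := by nlinarith [norm_nonneg (y - x)]
    rw [bar_eq _ _ (by linarith)]
    have h5 : (5 / 9 * σ) ^ 2 ≤ (σ - ‖y - x‖ ^ 2) ^ 2 := by
      apply pow_le_pow_left₀ (by positivity); linarith
    have h6 : (25 / 81) / ((9 + m / 4) * r ^ 2) ^ e ≤ (σ - ‖y - x‖ ^ 2) ^ 2 / σ ^ (e + 2) := by
      calc _ ≤ (25 / 81) / σ ^ e := by gcongr
        _ = (5 / 9 * σ) ^ 2 / σ ^ (e + 2) := by field_simp; ring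
        _ ≤ _ := by gcongr
    calc a < 4 * (25 / 81) * 36 ^ e * a := by
          have : (1 : ℝ) ≤ 36 ^ e := one_le_pow₀ (by norm_num)
          nlinarith
      _ = ℓ * ((3 * r) ^ 2) ^ e * ((25 / 81) / ((9 + m / 4) * r ^ 2) ^ e) := by
          rw [hℓ, mul_pow 3 r, mul_pow _ (r ^ 2), mul_pow _ (r ^ 2),
            show (9 : ℝ) + m / 4 = (36 + m) / 4 by ring, div_pow (36 + m) 4,
            show (36 : ℝ) = 3 ^ 2 * 4 by norm_num, mul_pow (3 ^ 2) 4]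
          have : 0 < 3 ^ 2 * 4 + m := by linarith
          field_simp
      _ ≤ _ := by gcongr
  · have hYx : ‖Y - x‖ ≤ 3 := by
      have := norm_sub_le Y x
      rw [mem_closedBall, dist_zero_right] at hY
      linarith
    have h1 := hprop Y (by rw [mem_closedBall, dist_eq_norm]; linarith) 100
      ⟨by linarith [ht.2], le_rfl⟩
    set σ := (3 * r) ^ 2 + (100 - (t + 40 * r ^ 2)) / 4 with hσ
    have hσ1 : 24 ≤ σ := by nlinarith [ht.2]
    have hσ2 : σ ≤ 26 := by nlinarith [ht.1]
    have hyx : ‖Y - x‖ ^ 2 ≤ 9 := by nlinarith [norm_nonneg (Y - x)]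
    rw [bar_eq _ _ (by linarith)] at h1
    have h5 : (15 / 26 * σ) ^ 2 ≤ (σ - ‖Y - x‖ ^ 2) ^ 2 := by
      apply pow_le_pow_left₀ (by positivity); linarith
    have h6 : (225 / 676) / 26 ^ e ≤ (σ - ‖Y - x‖ ^ 2) ^ 2 / σ ^ (e + 2) := by
      calc _ ≤ (225 / 676) / σ ^ e := by gcongr
        _ = (15 / 26 * σ) ^ 2 / σ ^ (e + 2) := by field_simp; ring
        _ ≤ _ := by gcongr
    have h7 : ℓ * ((3 * r) ^ 2) ^ e * ((225 / 676) / 26 ^ e) ≤ 1 := by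
      refine le_trans ?_ (h1.trans hY1)
      gcongr
    have h8 : a * (r ^ 2) ^ e ≤ ℓ * ((3 * r) ^ 2) ^ e * ((225 / 676) / 26 ^ e) := by
      have g1 : (26 : ℝ) ^ e ≤ (36 + m) ^ e := by gcongr; linarith
      have g2 : (1 : ℝ) ≤ 9 ^ e := one_le_pow₀ (by norm_num)
      have g3 : ℓ * ((3 * r) ^ 2) ^ e * ((225 / 676) / 26 ^ e) =
          (a * (r ^ 2) ^ e) * ((900 / 676) * 9 ^ e * ((36 + m) ^ e / 26 ^ e)) := by
        rw [hℓ, mul_pow 3 r, mul_pow _ (r ^ 2)]; norm_num; ring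
      rw [g3]
      have g4 : 1 ≤ (36 + m) ^ e / (26 : ℝ) ^ e := by rw [le_div_iff₀ (by positivity)]; linarith
      have g5 : (1 : ℝ) ≤ (900 / 676) * 9 ^ e * ((36 + m) ^ e / 26 ^ e) := by
        have : (1 : ℝ) ≤ (900 / 676) * 9 ^ e := by linarith
        nlinarith
      exact le_mul_of_one_le_right (by positivity) g5
    linarith

end Decay

section Decay2

variable {E : Type*} [NormedAddCommGroup E] [InnerProductSpace ℝ E] [FiniteDimensional ℝ E]
  [MeasurableSpace E] [BorelSpace E]

/-- Superlevel set in a centred box. -/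
def levelBox (v : E × ℝ → ℝ) (δ h : ℝ) : Set (E × ℝ) := {p ∈ ball (0 : E) δ ×ˢ Ioo (-δ) δ | h < v p}

theorem levelBox_step [Nontrivial E] {lam Lam M0 μ m : ℝ} (hlam : 0 < lam) (hM0 : 1 < M0) (hμ : 0 < μ)
    (hmtp : MeasToPoint E lam Lam M0 μ) {e : ℕ} (hm : 40 ≤ m) (he : 1 ≤ e)
    (hq : BarParam (finrank ℝ E) lam Lam (e + 2)) {v : E × ℝ → ℝ} (hv : NormSol lam Lam v)
    {a ρ δ δ' : ℝ} (ha : 0 < a) (hρ : 0 < ρ) (haρ : 1 ≤ a * (ρ ^ 2) ^ e) (hδ : δ' + m * ρ ≤ δ)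
    (hδ2 : δ ≤ 2) (hmρ : m * ρ ≤ 1) :
    ENNReal.ofReal ((m - 40) / (m + 4) * (1 + μ * ((5 : ℝ) ^ (finrank ℝ E + 2))⁻¹)) *
      volume (levelBox v δ' ((4 * M0 * (36 + m) ^ e) * a)) ≤ volume (levelBox v δ a) := by
  have hm4 : 0 ≤ (m - 40) / (m + 4) := div_nonneg (by linarith) (by linarith)
  have hρ1 : ρ ≤ 1 / 40 := by nlinarith
  have hopen : IsOpen (levelBox v δ' ((4 * M0 * (36 + m) ^ e) * a)) := by
    refine ContinuousOn.isOpen_inter_preimage (s := ball (0 : E) δ' ×ˢ Ioo (-δ') δ') (t := Ioi _)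
      (hv.1.mono ?_) (isOpen_ball.prod isOpen_Ioo) isOpen_Ioi
    refine prod_mono (fun z hz => ?_) (fun z hz => ?_)
    · rw [mem_ball] at hz; rw [mem_closedBall]; nlinarith
    · constructor <;> nlinarith [hz.1, hz.2]
  rw [ENNReal.ofReal_mul hm4, ENNReal.ofReal_add one_pos.le (by positivity), ENNReal.ofReal_one,
    ENNReal.ofReal_mul hμ.le, mul_assoc]
  refine ink_spots hopen hμ hm hρ ?_
  intro x t r hx hr hrρ hvol
  have hx1 := hx.1.1
  have hx2 := hx.1.2
  simp only [mem_ball, dist_zero_right, mem_Ioo] at hx1 hx2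
  have hmr : m * r ^ 2 ≤ 1 := by nlinarith
  have hsub : {p ∈ pcyl x t r | v p ≤ (4 * M0 * (36 + m) ^ e) * a} ⊆
      pcyl x t r \ levelBox v δ' ((4 * M0 * (36 + m) ^ e) * a) := by
    rintro p ⟨hp1, hp2⟩
    exact ⟨hp1, fun hp => absurd hp.2 (not_lt.2 hp2)⟩
  obtain ⟨h1, h2⟩ := density_step hlam hM0 hmtp hm hq hv ha (x := x) (t := t) (r := r) (by nlinarith)
    ⟨by nlinarith, by nlinarith⟩ hr (by linarith) hmr ((measure_mono hsub).trans_lt hvol)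
  · have hrρ' : r ≤ ρ := by
      by_contra! hlt
      have : (ρ ^ 2) ^ e < (r ^ 2) ^ e := by gcongr
      nlinarith
    refine ⟨hrρ', ?_⟩
    rintro ⟨y, s⟩ ⟨hy, hs⟩
    simp only [mem_ball, mem_Ioo] at hy hs
    refine ⟨⟨?_, ?_, ?_⟩, h1 y (mem_closedBall.2 hy.le) s ⟨hs.1.le, hs.2.le⟩⟩
    · simp only [mem_ball]
      have := dist_triangle y x 0
      rw [dist_zero_right x] at this
      nlinarith
    · simp only; nlinarith
    · simp only
      have : m * r ^ 2 ≤ m * ρ := by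
        have : r ^ 2 ≤ ρ := by nlinarith
        gcongr
      linarith

theorem exists_barParam (d : ℕ) {lam : ℝ} (hlam : 0 < lam) (Lam : ℝ) :
    ∃ e : ℕ, 1 ≤ e ∧ BarParam d lam Lam (e + 2) := by
  obtain ⟨N, hN⟩ := exists_nat_gt ((1 / 2 + 4 * d * Lam + 8 * lam) ^ 2 / (8 * lam))
  refine ⟨N + 1, by omega, ?_⟩
  rw [div_lt_iff₀ (by positivity)] at hN
  unfold BarParam
  push_cast
  nlinarith

/-- Power decay of the distribution function. -/
theorem weak_decay [Nontrivial E] {lam Lam M0 μ : ℝ} (hlam : 0 < lam) (hM0 : 1 < M0) (hμ : 0 < μ)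
    (hmtp : MeasToPoint E lam Lam M0 μ) :
    ∃ C ε : ℝ, 0 < C ∧ 0 < ε ∧ ∀ v : E × ℝ → ℝ, NormSol lam Lam v → ∀ h : ℝ, 0 < h →
      volume (levelBox v 1 h) ≤ ENNReal.ofReal (C * h ^ (-ε)) := by
  obtain ⟨e, he, hq⟩ := exists_barParam (finrank ℝ E) hlam Lam
  set κ := μ * ((5 : ℝ) ^ (finrank ℝ E + 2))⁻¹ with hκ
  have hκp : 0 < κ := by positivity
  set m := 44 / κ + 41 with hmdef
  have hmκ : m * κ = 44 + 41 * κ := by rw [hmdef]; field_simp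
  have hm : 40 ≤ m := by have : 0 < 44 / κ := by positivity
                         linarith
  set Θ := (m - 40) / (m + 4) * (1 + κ) with hΘ
  have hΘ1 : 1 < Θ := by
    rw [hΘ, div_mul_eq_mul_div, one_lt_div (by linarith)]
    nlinarith
  set M := 4 * M0 * (36 + m) ^ e with hM
  have hM1 : 1 < M := by
    have : (1 : ℝ) ≤ (36 + m) ^ e := one_le_pow₀ (by linarith)
    nlinarith
  have hMp : 0 < M := by linarith
  set ν : ℝ := M ^ (-(1 / (2 * (e : ℝ)))) with hν
  have hνp : 0 < ν := Real.rpow_pos_of_pos hMp _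
  have he' : (0 : ℝ) < e := by exact_mod_cast he
  have hν1 : ν < 1 := Real.rpow_lt_one_of_one_lt_of_neg hM1 (by
    have : 0 < 1 / (2 * (e : ℝ)) := by positivity
    linarith)
  have hνM : (ν ^ 2) ^ e * M = 1 := by
    rw [← pow_mul, hν, ← Real.rpow_natCast, ← Real.rpow_mul hMp.le]
    push_cast
    rw [show -(1 / (2 * (e : ℝ))) * (2 * e) = -1 by field_simp, Real.rpow_neg_one, inv_mul_cancel₀ hMp.ne']
  obtain ⟨k0, hk0⟩ : ∃ k0 : ℕ, m * ν ^ k0 ≤ 1 - ν := by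
    obtain ⟨k, hk⟩ := exists_pow_lt_of_lt_one (show 0 < (1 - ν) / m from div_pos (by linarith) (by linarith)) hν1
    refine ⟨k, ?_⟩
    rw [lt_div_iff₀ (by linarith)] at hk
    linarith
  set ε := Real.log Θ / Real.log M with hε
  have hεp : 0 < ε := div_pos (Real.log_pos hΘ1) (Real.log_pos hM1)
  have hMε : M ^ ε = Θ := by
    rw [Real.rpow_def_of_pos hMp, hε, mul_div_cancel₀ _ (Real.log_pos hM1).ne', Real.exp_log (by linarith)]
  have hV0 : volume (ball (0 : E) 2 ×ˢ Ioo (-2 : ℝ) 2) ≠ ⊤ :=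
    ((Metric.isBounded_ball.prod (Metric.isBounded_Ioo _ _)).measure_lt_top).ne
  set V0 := (volume (ball (0 : E) 2 ×ˢ Ioo (-2 : ℝ) 2)).toReal with hV0'
  have hV0n : 0 ≤ V0 := ENNReal.toReal_nonneg
  refine ⟨V0 * Θ ^ (k0 + 1) + 1, ε, by positivity, hεp, ?_⟩
  intro v hv h hh
  set δ : ℕ → ℝ := fun k => 1 + m * ν ^ k / (1 - ν) with hδ
  have hδ1 : ∀ k, 1 ≤ δ k := by
    intro k
    have : 0 ≤ m * ν ^ k / (1 - ν) := div_nonneg (mul_nonneg (by linarith) (by positivity)) (by linarith)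
    simp only [hδ]; linarith
  have hmν : ∀ j, m * ν ^ (k0 + j) ≤ 1 - ν := by
    intro j
    refine le_trans ?_ hk0
    have : ν ^ (k0 + j) ≤ ν ^ k0 := pow_le_pow_of_le_one hνp.le hν1.le (by omega)
    nlinarith
  have hδ2 : ∀ j, δ (k0 + j) ≤ 2 := by
    intro j
    have : m * ν ^ (k0 + j) / (1 - ν) ≤ 1 := by rw [div_le_one (by linarith)]; exact hmν j
    simp only [hδ]; linarith
  have hδs : ∀ k, δ (k + 1) + m * ν ^ k = δ k := by
    intro k
    simp only [hδ, pow_succ]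
    have : 1 - ν ≠ 0 := by linarith
    field_simp; ring
  have hstep : ∀ j, ENNReal.ofReal (Θ ^ j) * volume (levelBox v (δ (k0 + j)) (M ^ (k0 + j))) ≤
      volume (ball (0 : E) 2 ×ˢ Ioo (-2 : ℝ) 2) := by
    intro j
    induction j with
    | zero =>
      simp only [pow_zero, ENNReal.ofReal_one, one_mul]
      refine measure_mono fun p hp => ?_
      have := hδ2 0
      exact ⟨ball_subset_ball this hp.1.1, by linarith [hp.1.2.1], by linarith [hp.1.2.2]⟩
    | succ j ih =>
      refine le_trans ?_ ih
      have h1 := levelBox_step (a := M ^ (k0 + j)) (ρ := ν ^ (k0 + j)) (δ := δ (k0 + j))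
        (δ' := δ (k0 + j + 1)) hlam hM0 hμ hmtp hm he hq hv (by positivity)
        (by positivity) (le_of_eq ?_) (hδs _).le (hδ2 j) ((hmν j).trans (by linarith))
      · rw [pow_succ Θ, ENNReal.ofReal_mul (by positivity), mul_assoc]
        refine mul_le_mul_right ?_ _
        rw [show k0 + (j + 1) = k0 + j + 1 by ring, pow_succ M, mul_comm _ M]
        exact h1
      · rw [← pow_mul, ← pow_mul, mul_comm (k0 + j), pow_mul, pow_mul, ← mul_pow, mul_comm M, hνM, one_pow]
  have hpowε : ∀ n : ℕ, ∀ z : ℝ, 0 < z → z ≤ M ^ n → z ^ ε ≤ Θ ^ n := by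
    intro n z hz hzn
    calc z ^ ε ≤ (M ^ n) ^ ε := Real.rpow_le_rpow hz.le hzn hεp.le
      _ = Θ ^ n := by rw [← hMε, ← Real.rpow_natCast, ← Real.rpow_natCast, ← Real.rpow_mul hMp.le,
          ← Real.rpow_mul hMp.le, mul_comm]
  obtain ⟨j, hj1, hj2⟩ : ∃ j : ℕ, h ^ ε ≤ Θ ^ (k0 + j + 1) ∧ ENNReal.ofReal (Θ ^ j) *
      volume (levelBox v 1 h) ≤ volume (ball (0 : E) 2 ×ˢ Ioo (-2 : ℝ) 2) := by
    rcases lt_or_ge h (M ^ k0) with hlt | hge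
    · refine ⟨0, hpowε _ h hh (hlt.le.trans (pow_le_pow_right₀ hM1.le (by omega))), ?_⟩
      rw [pow_zero, ENNReal.ofReal_one, one_mul]
      refine measure_mono fun p hp => ?_
      exact ⟨ball_subset_ball one_le_two hp.1.1, by linarith [hp.1.2.1], by linarith [hp.1.2.2]⟩
    · obtain ⟨n, hn1, hn2⟩ := exists_nat_pow_near ((one_le_pow₀ hM1.le).trans hge) hM1
      have hkn : k0 ≤ n := by
        have := (pow_lt_pow_iff_right₀ hM1).1 (hge.trans_lt hn2)
        omega
      obtain ⟨j, rfl⟩ := Nat.exists_eq_add_of_le hkn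
      refine ⟨j, hpowε _ h hh hn2.le, le_trans (mul_le_mul_right (measure_mono ?_) _) (hstep j)⟩
      intro p hp
      have := hδ1 (k0 + j)
      exact ⟨⟨ball_subset_ball this hp.1.1, by linarith [hp.1.2.1], by linarith [hp.1.2.2]⟩,
        hn1.trans_lt hp.2⟩
  have hΘj : 0 < Θ ^ j := by positivity
  rw [← ENNReal.ofReal_toReal hV0, ← hV0', mul_comm] at hj2
  have h2 := (ENNReal.le_div_iff_mul_le (Or.inl (by simpa using hΘj)) (Or.inl ENNReal.ofReal_ne_top)).2 hj2
  rw [← ENNReal.ofReal_div_of_pos hΘj] at h2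
  refine h2.trans (ENNReal.ofReal_le_ofReal ?_)
  rw [Real.rpow_neg hh.le, ← div_eq_mul_inv]
  have hhε : 0 < h ^ ε := Real.rpow_pos_of_pos hh ε
  rw [div_le_div_iff₀ hΘj hhε]
  calc V0 * h ^ ε ≤ V0 * Θ ^ (k0 + j + 1) := by gcongr
    _ = V0 * Θ ^ (k0 + 1) * Θ ^ j := by ring
    _ ≤ (V0 * Θ ^ (k0 + 1) + 1) * Θ ^ j := by gcongr; linarith

end Decay2

section Harnack

variable {E : Type*} [NormedAddCommGroup E] [InnerProductSpace ℝ E] [FiniteDimensional ℝ E]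
  [MeasurableSpace E] [BorelSpace E]

theorem sum_geom_le {a ζ : ℝ} (ha : 0 ≤ a) (h0 : 0 ≤ ζ) (h1 : ζ < 1) (n : ℕ) :
    ∑ i ∈ Finset.range n, a * (1 - ζ) * ζ ^ i ≤ a := by
  have : ∑ i ∈ Finset.range n, a * (1 - ζ) * ζ ^ i = a * (1 - ζ ^ n) := by
    rw [← Finset.mul_sum, geom_sum_eq h1.ne]
    have : ζ - 1 ≠ 0 := by linarith
    field_simp; ring
  rw [this]
  have : 0 ≤ ζ ^ n := by positivity
  nlinarith

theorem normSol_bound [Nontrivial E] {lam Lam M0 μ : ℝ} (hlam : 0 < lam) (hM0 : 1 < M0) (hμ : 0 < μ)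
    (hmtp : MeasToPoint E lam Lam M0 μ) :
    ∃ H : ℝ, 0 < H ∧ ∀ v : E × ℝ → ℝ, NormSol lam Lam v → v (0, 0) < H := by
  obtain ⟨C, ε, hC, hε, hdec⟩ := weak_decay hlam hM0 hμ hmtp
  set d := finrank ℝ E with hd
  set θ := 1 + 1 / (2 * (M0 - 1)) with hθ
  have hθ1 : 1 < θ := by
    have : 0 < 1 / (2 * (M0 - 1)) := by have : 0 < M0 - 1 := by linarith
                                        positivity
    linarith
  have hθp : 0 < θ := by linarith
  have hd2 : (0 : ℝ) < d + 2 := by positivity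
  set ζ := θ ^ (-(ε / (d + 2))) with hζ
  have hζp : 0 < ζ := Real.rpow_pos_of_pos hθp _
  have hζ1 : ζ < 1 := Real.rpow_lt_one_of_one_lt_of_neg hθ1 (by
    have : 0 < ε / (d + 2) := by positivity
    linarith)
  have hζθ : ∀ j : ℕ, (ζ ^ j) ^ (d + 2) = (θ ^ j) ^ (-ε) := by
    intro j
    rw [← pow_mul, mul_comm j, pow_mul, ← Real.rpow_natCast θ j, ← Real.rpow_mul hθp.le, mul_comm (j : ℝ),
      Real.rpow_mul hθp.le, Real.rpow_natCast, hζ, ← Real.rpow_natCast _ (d + 2), ← Real.rpow_mul hθp.le]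
    congr 2
    push_cast
    field_simp
  set ρs := 1 / 100 * (1 - ζ) with hρs
  have hρsp : 0 < ρs := by rw [hρs]; linarith
  set ω := (volume (ball (0 : E) 1)).toReal with hω
  have hωt : volume (ball (0 : E) 1) ≠ ⊤ := measure_ball_lt_top.ne
  have hωp : 0 < ω := ENNReal.toReal_pos (measure_ball_pos volume 0 one_pos).ne' hωt
  obtain ⟨h, hh, hhsmall⟩ : ∃ h : ℝ, 0 < h ∧ C * h ^ (-ε) < μ * (2 * ρs ^ (d + 2) * ω) := by
    have h1 := (tendsto_rpow_neg_atTop hε).const_mul C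
    rw [mul_zero] at h1
    obtain ⟨h, h2, h3⟩ := ((h1.eventually (gt_mem_nhds (show 0 < μ * (2 * ρs ^ (d + 2) * ω) by
      positivity))).and (eventually_gt_atTop 0)).exists
    exact ⟨h, h3, h2⟩
  refine ⟨2 * h, by positivity, fun v hv => ?_⟩
  refine blowup_bound (δ := 1 / 2) (δ' := 1 / 2) hM0 hmtp (by positivity) (fun j => ρs * ζ ^ j)
    (fun j => by positivity) ?_ ?_ (hv.1.mono ?_) ?_ ?_
  · intro n
    refine le_trans (le_of_eq ?_) ((sum_geom_le (a := 4 / 100) (by norm_num) hζp.le hζ1 n).trans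
      (by norm_num))
    refine Finset.sum_congr rfl fun i _ => ?_
    rw [hρs]; ring
  · intro n
    refine le_trans ?_ ((sum_geom_le (a := 41 / 100) (by norm_num) hζp.le hζ1 n).trans
      (by norm_num))
    refine Finset.sum_le_sum fun i _ => ?_
    have h1 : ζ ^ i ≤ 1 := pow_le_one₀ hζp.le hζ1.le
    have h2 : 0 < ζ ^ i := by positivity
    have h3 : ρs ≤ 1 := by rw [hρs]; linarith
    have h4 : ρs * ζ ^ i ≤ 1 := by nlinarith
    have h5 : 0 < ρs * ζ ^ i := by positivity
    calc 41 * (ρs * ζ ^ i) ^ 2 ≤ 41 * (ρs * ζ ^ i) := by nlinarith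
      _ = _ := by rw [hρs]; ring
  · exact prod_mono (closedBall_subset_closedBall (by norm_num)) (Icc_subset_Icc (by norm_num) (by norm_num))
  · intro y hy s hs _
    exact hv.2.2.1 y (ball_subset_ball (by norm_num) hy) s ⟨by linarith [hs.1], by linarith [hs.2]⟩
  · intro j x t hx ht1 ht0
    have hρj : 0 < ρs * ζ ^ j := by positivity
    have hsub : {p ∈ pcyl x (t - 40 * (ρs * ζ ^ j) ^ 2) (ρs * ζ ^ j) | θ ^ j * (2 * h) / 2 < v p} ⊆
        levelBox v 1 (θ ^ j * h) := by
      rintro ⟨y, s⟩ ⟨⟨hy, hs1, hs2⟩, hv2⟩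
      have h1 : y ∈ closedBall (0 : E) (1 / 2) :=
        hx (ball_subset_closedBall (ball_subset_ball (by linarith) hy))
      have hp := sq_nonneg (ρs * ζ ^ j)
      simp only at hs1 hs2
      refine ⟨⟨closedBall_subset_ball (by norm_num) h1, ?_, ?_⟩, ?_⟩
      · simp only; linarith [ht1.1]
      · simp only; linarith
      · refine lt_of_eq_of_lt ?_ hv2
        ring
    refine (measure_mono hsub).trans_lt ((hdec v hv _ (by positivity)).trans_lt ?_)
    rw [volume_pcyl _ _ hρj.le, ← ENNReal.ofReal_toReal hωt, ← hω,
      ← ENNReal.ofReal_mul (by positivity), ← ENNReal.ofReal_mul hμ.le]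
    refine (ENNReal.ofReal_lt_ofReal_iff (by positivity)).2 ?_
    rw [Real.mul_rpow (by positivity) hh.le, ← hζθ, mul_pow]
    have : 0 < (ζ ^ j) ^ (d + 2) := by positivity
    calc C * ((ζ ^ j) ^ (d + 2) * h ^ (-ε)) = (ζ ^ j) ^ (d + 2) * (C * h ^ (-ε)) := by ring
      _ < (ζ ^ j) ^ (d + 2) * (μ * (2 * ρs ^ (d + 2) * ω)) := by gcongr
      _ = _ := by ring

/-- The interior Harnack inequality with constant `CH`. -/
def HarnackConst (E : Type*) [NormedAddCommGroup E] [InnerProductSpace ℝ E] [FiniteDimensional ℝ E]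
    (lam Lam CH : ℝ) : Prop :=
  ∀ (u : E × ℝ → ℝ) (x0 : E) (t0 r : ℝ), 0 < r →
    ContinuousOn u (closedBall x0 (9 * r) ×ˢ Icc (t0 - 4 * r ^ 2) (t0 + 100 * r ^ 2)) →
    (∀ p ∈ closedBall x0 (9 * r) ×ˢ Icc (t0 - 4 * r ^ 2) (t0 + 100 * r ^ 2), 0 ≤ u p) →
    (∀ p ∈ closedBall x0 (9 * r) ×ˢ Icc (t0 - 4 * r ^ 2) (t0 + 100 * r ^ 2), SolAt lam Lam u p) →
    ∀ y, dist y x0 ≤ r → u (x0, t0) ≤ CH * u (y, t0 + 100 * r ^ 2)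

theorem exists_harnackConst [Nontrivial E] {lam Lam M0 μ : ℝ} (hlam : 0 < lam) (hM0 : 1 < M0)
    (hμ : 0 < μ) (hmtp : MeasToPoint E lam Lam M0 μ) :
    ∃ CH : ℝ, 1 ≤ CH ∧ HarnackConst E lam Lam CH := by
  obtain ⟨H, hH, hb⟩ := normSol_bound hlam hM0 hμ hmtp
  refine ⟨max H 1, le_max_right _ _, ?_⟩
  intro u x0 t0 r hr hc hnn hsol y hy
  have hr2 : 0 < r ^ 2 := by positivity
  set Y : E × ℝ := (y, t0 + 100 * r ^ 2) with hY
  have hYin : Y ∈ closedBall x0 (9 * r) ×ˢ Icc (t0 - 4 * r ^ 2) (t0 + 100 * r ^ 2) :=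
    ⟨by rw [mem_closedBall]; linarith, by constructor <;> simp only [hY] <;> linarith⟩
  have hYn := hnn Y hYin
  refine le_trans ?_ (mul_le_mul_of_nonneg_right (le_max_left H 1) hYn)
  refine le_of_forall_pos_le_add fun η hη => ?_
  set N := u Y + η / H with hN
  have hNp : 0 < N := by positivity
  have hmap : ∀ q : E × ℝ, q ∈ closedBall (0 : E) 9 ×ˢ Icc (-4 : ℝ) 100 →
      (x0 + r • q.1, t0 + r ^ 2 * q.2) ∈ closedBall x0 (9 * r) ×ˢ Icc (t0 - 4 * r ^ 2) (t0 + 100 * r ^ 2) := by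
    rintro q ⟨h1, h2, h3⟩
    rw [mem_closedBall, dist_zero_right] at h1
    refine ⟨?_, ?_, ?_⟩
    · rw [mem_closedBall, dist_eq_norm, add_sub_cancel_left, norm_smul, Real.norm_of_nonneg hr.le]
      nlinarith
    · simp only; nlinarith
    · simp only; nlinarith
  have key := hb (fun p => 1 / N * u (x0 + r • p.1, t0 + r ^ 2 * p.2) + 0) ⟨?_, ?_, ?_, ?_⟩
  · simp only [smul_zero, add_zero, mul_zero] at key
    rw [one_div_mul_eq_div, div_lt_iff₀ hNp] at key
    refine key.le.trans (le_of_eq ?_)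
    rw [hN]; field_simp
  · refine (continuousOn_const.mul ?_).add continuousOn_const
    exact hc.comp (f := fun p : E × ℝ => (x0 + r • p.1, t0 + r ^ 2 * p.2)) (by fun_prop) hmap
  · intro p hp
    have := hnn _ (hmap p hp)
    simp only [add_zero]
    positivity
  · intro x hx t ht
    exact ((hsol _ (hmap (x, t) ⟨ball_subset_closedBall hx, ht.1.le, ht.2⟩)).scale).affine _ _
  · refine ⟨(1 / r) • (y - x0), ?_, ?_⟩
    · rw [mem_closedBall, dist_zero_right, norm_smul, Real.norm_of_nonneg (by positivity), ← dist_eq_norm,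
        one_div_mul_eq_div, div_le_one hr]
      exact hy
    · simp only [add_zero]
      rw [smul_smul, mul_one_div_cancel hr.ne', one_smul, add_sub_cancel, one_div_mul_eq_div,
        div_le_one hNp, mul_comm (r ^ 2), ← hY, hN]
      have : 0 < η / H := by positivity
      linarith

theorem harnack_chain {lam Lam CH : ℝ} (hCH : 1 ≤ CH) (hH : HarnackConst E lam Lam CH) {Ω : Set (E × ℝ)}
    {u : E × ℝ → ℝ} (hc : ContinuousOn u Ω) (hnn : ∀ p ∈ Ω, 0 ≤ u p) (hsol : ∀ p ∈ Ω, SolAt lam Lam u p)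
    {r : ℝ} (hr : 0 < r) (x : ℕ → E) (t : ℝ) (k : ℕ) (hstep : ∀ j < k, dist (x (j + 1)) (x j) ≤ r)
    (hdom : ∀ j < k, closedBall (x j) (9 * r) ×ˢ
      Icc (t + j * (100 * r ^ 2) - 4 * r ^ 2) (t + j * (100 * r ^ 2) + 100 * r ^ 2) ⊆ Ω) :
    u (x 0, t) ≤ CH ^ k * u (x k, t + k * (100 * r ^ 2)) := by
  induction k with
  | zero => simp
  | succ k ih =>
    have h1 := ih (fun j hj => hstep j (by omega)) (fun j hj => hdom j (by omega))
    have hd := hdom k (by omega)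
    have h2 := hH u (x k) (t + k * (100 * r ^ 2)) r hr (hc.mono hd) (fun p hp => hnn p (hd hp))
      (fun p hp => hsol p (hd hp)) (x (k + 1)) (hstep k (by omega))
    have e : t + ((k + 1 : ℕ) : ℝ) * (100 * r ^ 2) = t + k * (100 * r ^ 2) + 100 * r ^ 2 := by
      push_cast; ring
    rw [e, pow_succ, mul_assoc]
    exact h1.trans (mul_le_mul_of_nonneg_left h2 (by positivity))

end Harnack

section Cross

variable {E : Type*} [NormedAddCommGroup E] [InnerProductSpace ℝ E] [FiniteDimensional ℝ E]
  [MeasurableSpace E] [BorelSpace E]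

/-- Nonnegative solutions in a box, continuous off the product set `Z × P`. -/
structure CrossSol (lam Lam : ℝ) (Z : Set E) (P : Set ℝ) (x0 : E) (t0 ρ : ℝ) (v : E × ℝ → ℝ) : Prop where
  pos : 0 < ρ
  le_one : ρ ≤ 1
  closed : IsClosed Z
  mem : x0 ∈ Z
  nonneg : ∀ p ∈ closedBall x0 ρ ×ˢ Icc (t0 - ρ) (t0 + ρ), 0 ≤ v p
  sol : ∀ p ∈ closedBall x0 ρ ×ˢ Icc (t0 - ρ) (t0 + ρ), SolAt lam Lam v p
  cont : ∀ p ∈ closedBall x0 ρ ×ˢ Icc (t0 - ρ) (t0 + ρ), ¬ (p.1 ∈ Z ∧ p.2 ∈ P) → ContinuousAt v p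

variable {lam Lam CH : ℝ} {Z : Set E} {P : Set ℝ} {x0 : E} {t0 ρ : ℝ} {v : E × ℝ → ℝ}

theorem CrossSol.vertical (hv : CrossSol lam Lam Z P x0 t0 ρ v) (hH : HarnackConst E lam Lam CH)
    {y : E} {a b : ℝ} (hab : a < b) (hyB : closedBall y (infDist y Z) ⊆ closedBall x0 ρ)
    (hd : b - a ≤ infDist y Z ^ 2 / 4) (ha : t0 - ρ ≤ a - (b - a) / 25) (hb : b ≤ t0 + ρ) :
    v (y, a) ≤ CH * v (y, b) := by
  set d := infDist y Z with hd'
  have hdn : 0 ≤ d := infDist_nonneg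
  set r := √((b - a) / 100) with hr
  have hrp : 0 < r := Real.sqrt_pos.2 (by linarith)
  have hr2 : r ^ 2 = (b - a) / 100 := Real.sq_sqrt (by linarith)
  have h9 : 9 * r < d := by
    have : 0 < d := by
      by_contra! hh
      have : d = 0 := le_antisymm hh hdn
      rw [this] at hd; linarith
    nlinarith
  have hsub : closedBall y (9 * r) ×ˢ Icc (a - 4 * r ^ 2) (a + 100 * r ^ 2) ⊆
      closedBall x0 ρ ×ˢ Icc (t0 - ρ) (t0 + ρ) := by
    refine prod_mono ((closedBall_subset_closedBall h9.le).trans hyB) (Icc_subset_Icc ?_ ?_)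
    · rw [hr2]; linarith
    · rw [hr2]; linarith
  have key := hH v y a r hrp (fun p hp => (hv.cont p (hsub hp) ?_).continuousWithinAt)
    (fun p hp => hv.nonneg p (hsub hp)) (fun p hp => hv.sol p (hsub hp)) y (by simpa using hrp.le)
  · rwa [hr2, show a + 100 * ((b - a) / 100) = b by ring] at key
  · rintro ⟨h1, -⟩
    have h2 := infDist_le_dist_of_mem (x := y) h1
    have h3 := mem_closedBall'.1 hp.1
    linarith

theorem CrossSol.oblique (hv : CrossSol lam Lam Z P x0 t0 ρ v) (hCH : 1 ≤ CH)
    (hH : HarnackConst E lam Lam CH)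
    {y z : E} {d a b : ℝ} (hd : 0 < d) (hyz : dist z y ≤ d) (hab : b = a + d ^ 2 / 16)
    (hB : closedBall y (2 * d) ⊆ closedBall x0 ρ) (hP : ∀ s ∈ Icc (a - d ^ 2 / 16) b, s ∉ P)
    (ha : t0 - ρ ≤ a - d ^ 2 / 16) (hb : b ≤ t0 + ρ) :
    v (y, a) ≤ CH ^ 1600 * v (z, b) := by
  set r := d / 1600 with hr
  have hrp : 0 < r := by positivity
  set x : ℕ → E := fun j => y + ((j : ℝ) / 1600) • (z - y) with hx
  have h100 : 100 * r ^ 2 = d ^ 2 / 16 / 1600 := by rw [hr]; ring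
  have hnorm : ‖z - y‖ ≤ d := by rwa [← dist_eq_norm]
  have hd2 : 0 < d ^ 2 := by positivity
  have hdom : ∀ j : ℕ, j < 1600 → closedBall (x j) (9 * r) ×ˢ
      Icc (a + j * (100 * r ^ 2) - 4 * r ^ 2) (a + j * (100 * r ^ 2) + 100 * r ^ 2) ⊆
      {p ∈ closedBall x0 ρ ×ˢ Icc (t0 - ρ) (t0 + ρ) | p.2 ∉ P} := by
    rintro j hj ⟨w, s⟩ ⟨hw, hs1, hs2⟩
    have hj1 : (j : ℝ) + 1 ≤ 1600 := by exact_mod_cast hj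
    have hj0 : (0 : ℝ) ≤ j := Nat.cast_nonneg j
    simp only at hs1 hs2 hw
    rw [h100] at hs1 hs2
    have hs3 : a - d ^ 2 / 16 ≤ s := by
      have : 4 * r ^ 2 ≤ d ^ 2 / 16 := by rw [hr]; nlinarith
      have : 0 ≤ (j : ℝ) * (d ^ 2 / 16 / 1600) := by positivity
      linarith
    have hs4 : s ≤ b := by
      rw [hab]; nlinarith
    refine ⟨⟨hB ?_, by linarith, by linarith⟩, hP s ⟨hs3, hs4⟩⟩
    have h1 : dist (x j) y ≤ d := by
      rw [dist_eq_norm, hx, add_sub_cancel_left, norm_smul, Real.norm_of_nonneg (by positivity)]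
      have : (j : ℝ) / 1600 ≤ 1 := by rw [div_le_one (by norm_num)]; linarith
      nlinarith [norm_nonneg (z - y), this]
    have h2 := dist_triangle w (x j) y
    rw [mem_closedBall] at hw ⊢
    have : 9 * r ≤ d := by rw [hr]; linarith
    linarith
  have key := harnack_chain (u := v) hCH hH (Ω := {p ∈ closedBall x0 ρ ×ˢ Icc (t0 - ρ) (t0 + ρ) | p.2 ∉ P})
    (fun p hp => (hv.cont p hp.1 fun h => hp.2 h.2).continuousWithinAt)
    (fun p hp => hv.nonneg p hp.1) (fun p hp => hv.sol p hp.1) hrp x a 1600 ?_ hdom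
  · have e1 : x 0 = y := by simp [hx]
    have e2 : x 1600 = z := by simp [hx]
    rw [e1, e2, h100] at key
    convert key using 4
    rw [hab]; push_cast; ring
  · intro j _
    have : x (j + 1) - x j = (1 / 1600 : ℝ) • (z - y) := by
      simp only [hx]; push_cast
      rw [add_sub_add_left_eq_sub, ← sub_smul]; congr 1; ring
    rw [dist_eq_norm, this, norm_smul, Real.norm_of_nonneg (by norm_num), hr]
    linarith

theorem CrossSol.lower (hv : CrossSol lam Lam Z P x0 t0 ρ v) (hCH : 1 ≤ CH)
    (hH : HarnackConst E lam Lam CH) {κ : ℝ} (hκ : 0 < κ)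
    (hκv : ∀ p ∈ closedBall x0 ρ ×ˢ Icc (t0 - ρ) (t0 + ρ), p.1 ∈ Z ∨ p.2 ∈ P → κ ≤ v p) :
    ∀ p ∈ closedBall x0 (ρ / 8) ×ˢ Icc (t0 - ρ / 8) (t0 + ρ / 8), κ ≤ CH ^ 1600 * v p := by
  rintro ⟨y, t⟩ ⟨hy, ht1, ht2⟩
  have hρ := hv.pos
  have hρ1 := hv.le_one
  simp only at hy ht1 ht2
  have hyB : y ∈ closedBall x0 ρ := closedBall_subset_closedBall (by linarith) hy
  have hC1 : 1 ≤ CH ^ 1600 := one_le_pow₀ hCH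
  have hv0 := hv.nonneg (y, t) ⟨hyB, by constructor <;> simp only <;> linarith⟩
  have triv : ∀ w, κ ≤ w → w ≤ CH ^ 1600 * w := fun w hw => by nlinarith
  obtain ⟨z, hz, hzd⟩ := hv.closed.exists_infDist_eq_dist ⟨x0, hv.mem⟩ y
  set d := infDist y Z with hd
  have hd8 : d ≤ ρ / 8 := (infDist_le_dist_of_mem hv.mem).trans hy
  rcases (infDist_nonneg (x := y) (s := Z)).eq_or_lt with h0 | hdp
  · have hyz : y = z := dist_eq_zero.1 (by rw [← hzd, hd, ← h0])
    have := hκv (y, t) ⟨hyB, by constructor <;> simp only <;> linarith⟩ (Or.inl (hyz ▸ hz))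
    exact this.trans (triv _ this)
  rw [← hd] at hdp
  have hd2 : d ^ 2 ≤ ρ / 8 := by nlinarith
  have hd2p : 0 < d ^ 2 := by positivity
  by_cases hP : ∃ a ∈ P, a ∈ Icc (t - d ^ 2 / 4) t
  · obtain ⟨a, haP, ha1, ha2⟩ := hP
    have hκa := hκv (y, a) ⟨hyB, by constructor <;> simp only <;> linarith⟩ (Or.inr haP)
    rcases ha2.eq_or_lt with rfl | hlt
    · exact hκa.trans (triv _ hκa)
    · have h1 := hv.vertical hH hlt (closedBall_subset_closedBall' (by
        rw [mem_closedBall] at hy; linarith)) (by linarith) (by linarith) (by linarith)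
      refine hκa.trans (h1.trans ?_)
      have : CH ≤ CH ^ 1600 := le_self_pow₀ hCH (by norm_num)
      gcongr
  · push Not at hP
    have hzx : dist z x0 ≤ ρ / 4 := by
      rw [mem_closedBall] at hy
      have := dist_triangle z y x0
      rw [dist_comm z y, ← hzd] at this
      linarith
    have h1 := hv.oblique hCH hH (y := z) (z := y) (a := t - d ^ 2 / 16) (b := t) hdp
      (by rw [← hzd]) (by ring)
      (closedBall_subset_closedBall' (by linarith))
      (fun s hs hsP => hP s hsP ⟨by linarith [hs.1], hs.2⟩) (by linarith) (by linarith)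
    exact (hκv (z, t - d ^ 2 / 16) ⟨mem_closedBall.2 (by simp only; linarith), by
      constructor <;> simp only <;> linarith⟩ (Or.inl hz)).trans h1

theorem CrossSol.upper (hv : CrossSol lam Lam Z P x0 t0 ρ v) (hCH : 1 ≤ CH)
    (hH : HarnackConst E lam Lam CH) {K : ℝ}
    (hκv : ∀ p ∈ closedBall x0 ρ ×ˢ Icc (t0 - ρ) (t0 + ρ), p.1 ∈ Z ∨ p.2 ∈ P → v p ≤ K) :
    ∀ p ∈ closedBall x0 (ρ / 8) ×ˢ Icc (t0 - ρ / 8) (t0 + ρ / 8), v p ≤ CH ^ 1601 * K := by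
  rintro ⟨y, t⟩ ⟨hy, ht1, ht2⟩
  have hρ := hv.pos
  have hρ1 := hv.le_one
  simp only at hy ht1 ht2
  have hyB : y ∈ closedBall x0 ρ := closedBall_subset_closedBall (by linarith) hy
  have hC1 : 1 ≤ CH ^ 1601 := one_le_pow₀ hCH
  have hv0 := hv.nonneg (y, t) ⟨hyB, by constructor <;> simp only <;> linarith⟩
  obtain ⟨z, hz, hzd⟩ := hv.closed.exists_infDist_eq_dist ⟨x0, hv.mem⟩ y
  have hx0 : (x0, t0) ∈ closedBall x0 ρ ×ˢ Icc (t0 - ρ) (t0 + ρ) :=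
    ⟨mem_closedBall_self hρ.le, by constructor <;> simp only <;> linarith⟩
  have hK0 : 0 ≤ K := (hv.nonneg _ hx0).trans (hκv _ hx0 (Or.inl hv.mem))
  have triv : ∀ w, w ≤ K → w ≤ CH ^ 1601 * K := fun w hw => by nlinarith
  set d := infDist y Z with hd
  have hd8 : d ≤ ρ / 8 := (infDist_le_dist_of_mem hv.mem).trans hy
  rcases (infDist_nonneg (x := y) (s := Z)).eq_or_lt with h0 | hdp
  · have hyz : y = z := dist_eq_zero.1 (by rw [← hzd, hd, ← h0])
    exact triv _ (hκv (y, t) ⟨hyB, by constructor <;> simp only <;> linarith⟩ (Or.inl (hyz ▸ hz)))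
  rw [← hd] at hdp
  have hd2 : d ^ 2 ≤ ρ / 8 := by nlinarith
  have hd2p : 0 < d ^ 2 := by positivity
  have hcb : closedBall y (infDist y Z) ⊆ closedBall x0 ρ := closedBall_subset_closedBall' (by
        rw [mem_closedBall] at hy; linarith)
  by_cases hP : ∃ a ∈ P, a ∈ Icc t (t + d ^ 2 / 4)
  · obtain ⟨a, haP, ha1, ha2⟩ := hP
    have hκa := hκv (y, a) ⟨hyB, by constructor <;> simp only <;> linarith⟩ (Or.inr haP)
    rcases ha1.eq_or_lt with rfl | hlt
    · exact triv _ hκa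
    · have h1 := hv.vertical hH hlt hcb (by linarith) (by linarith) (by linarith)
      refine h1.trans ?_
      have : CH ≤ CH ^ 1601 := le_self_pow₀ hCH (by norm_num)
      have hva := hv.nonneg (y, a) ⟨hyB, by constructor <;> simp only <;> linarith⟩
      exact mul_le_mul this hκa hva (by positivity)
  · push Not at hP
    have h1 := hv.vertical hH (a := t) (b := t + d ^ 2 / 8) (by linarith) hcb (by linarith) (by linarith)
      (by linarith)
    have h2 := hv.oblique hCH hH (y := y) (z := z) (a := t + d ^ 2 / 8) (b := t + 3 * d ^ 2 / 16) hdp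
      (by rw [dist_comm, ← hzd]) (by ring)
      (closedBall_subset_closedBall' (by rw [mem_closedBall] at hy; linarith))
      (fun s hs hsP => hP s hsP ⟨by linarith [hs.1], by linarith [hs.2]⟩) (by linarith) (by linarith)
    have hzx : dist z x0 ≤ ρ / 4 := by
      rw [mem_closedBall] at hy
      have := dist_triangle z y x0
      rw [dist_comm z y, ← hzd] at this
      linarith
    have h3 := hκv (z, t + 3 * d ^ 2 / 16) ⟨mem_closedBall.2 (by simp only; linarith), by
      constructor <;> simp only <;> linarith⟩ (Or.inl hz)
    calc v (y, t) ≤ CH * v (y, t + d ^ 2 / 8) := h1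
      _ ≤ CH * (CH ^ 1600 * K) := by gcongr; exact h2.trans (by gcongr)
      _ = CH ^ 1601 * K := by rw [← mul_assoc, ← pow_succ']

end Cross

section JointContinuity

variable {E : Type*} [NormedAddCommGroup E] [InnerProductSpace ℝ E] [FiniteDimensional ℝ E]
  [MeasurableSpace E] [BorelSpace E]

/-- Solutions near a point which are Lipschitz on crosses through the point at all small scales. -/
def CrossLip (lam Lam N : ℝ) (w : E × ℝ → ℝ) (x0 : E) (t0 : ℝ) : Prop :=
  ∃ ρ0, 0 < ρ0 ∧ ρ0 ≤ 1 ∧ ∀ ρ, 0 < ρ → ρ ≤ ρ0 → ∃ (Z : Set E) (P : Set ℝ), IsClosed Z ∧ x0 ∈ Z ∧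
    (∀ p ∈ closedBall x0 ρ ×ˢ Icc (t0 - ρ) (t0 + ρ), SolAt lam Lam w p) ∧
    (∀ p ∈ closedBall x0 ρ ×ˢ Icc (t0 - ρ) (t0 + ρ), ¬ (p.1 ∈ Z ∧ p.2 ∈ P) → ContinuousAt w p) ∧
    ∀ p ∈ closedBall x0 ρ ×ˢ Icc (t0 - ρ) (t0 + ρ), p.1 ∈ Z ∨ p.2 ∈ P → |w p - w (x0, t0)| ≤ N * ρ

variable {lam Lam CH N : ℝ} {x0 : E} {t0 : ℝ} {w u : E × ℝ → ℝ}

theorem CrossLip.neg (h : CrossLip lam Lam N w x0 t0) :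
    CrossLip lam Lam N (fun q => (-1) * w q + 0) x0 t0 := by
  obtain ⟨ρ0, h0, h1, h⟩ := h
  refine ⟨ρ0, h0, h1, fun ρ hρ hρ0 => ?_⟩
  obtain ⟨Z, P, hZ, hx0, hs, hc, hb⟩ := h ρ hρ hρ0
  refine ⟨Z, P, hZ, hx0, fun p hp => (hs p hp).affine _ _, fun p hp hn =>
    ((hc p hp hn).const_mul _).add_const _, fun p hp hn => ?_⟩
  rw [show -1 * w p + 0 - (-1 * w (x0, t0) + 0) = -(w p - w (x0, t0)) by ring, abs_neg]
  exact hb p hp hn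

theorem box_mem_nhds {ρ : ℝ} (hρ : 0 < ρ) :
    closedBall x0 ρ ×ˢ Icc (t0 - ρ) (t0 + ρ) ∈ 𝓝 (x0, t0) :=
  prod_mem_nhds (closedBall_mem_nhds _ hρ) (Icc_mem_nhds (by linarith) (by linarith))

theorem exists_box_of_mem_nhds {S : Set (E × ℝ)} (hS : S ∈ 𝓝 (x0, t0)) :
    ∃ ρ1, 0 < ρ1 ∧ ∀ ρ ≤ ρ1, closedBall x0 ρ ×ˢ Icc (t0 - ρ) (t0 + ρ) ⊆ S := by
  obtain ⟨ρ1, h1, h2⟩ := Metric.nhds_basis_closedBall.mem_iff.1 hS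
  refine ⟨ρ1, h1, fun ρ hρ => Subset.trans ?_ h2⟩
  rw [← closedBall_prod_same, Real.closedBall_eq_Icc]
  exact prod_mono (closedBall_subset_closedBall hρ) (Icc_subset_Icc (by linarith) (by linarith))

theorem CrossLip.lower (hCH : 1 ≤ CH) (hH : HarnackConst E lam Lam CH) (hN : 0 < N)
    (h : CrossLip lam Lam N w x0 t0) {B : ℝ} (hB : ∀ᶠ q in 𝓝 (x0, t0), B ≤ w q) {ε : ℝ} (hε : 0 < ε) :
    ∀ᶠ q in 𝓝 (x0, t0), w (x0, t0) - ε ≤ w q := by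
  obtain ⟨ρ0, h0, h1, h⟩ := h
  set c := (CH ^ 1600)⁻¹ with hc
  have hC1 : 1 ≤ CH ^ 1600 := one_le_pow₀ hCH
  have hC0 : 0 < CH ^ 1600 := by linarith
  have hc0 : 0 < c := by positivity
  have hc1 : c ≤ 1 := inv_le_one_of_one_le₀ hC1
  have step : ∀ a, 0 < a → (∀ᶠ q in 𝓝 (x0, t0), w (x0, t0) - a ≤ w q) →
      ∀ᶠ q in 𝓝 (x0, t0), w (x0, t0) - a * (1 - c / 2) ≤ w q := by
    intro a ha hev
    obtain ⟨ρ1, hρ1, hsub⟩ := exists_box_of_mem_nhds hev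
    set ρ := min ρ0 (min ρ1 (a / 2 / N)) with hρ
    have hρp : 0 < ρ := lt_min h0 (lt_min hρ1 (by positivity))
    have hNρ : N * ρ ≤ a / 2 := by
      have : ρ ≤ a / 2 / N := (min_le_right _ _).trans (min_le_right _ _)
      rwa [le_div_iff₀ hN, mul_comm] at this
    obtain ⟨Z, P, hZ, hx0, hs, hcont, hb⟩ := h ρ hρp (min_le_left _ _)
    have hv : CrossSol lam Lam Z P x0 t0 ρ (fun q => 1 * w q + (a - w (x0, t0))) :=
      { pos := hρp
        le_one := (min_le_left _ _).trans h1
        closed := hZ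
        mem := hx0
        nonneg := fun p hp => by
          have : w (x0, t0) - a ≤ w p := hsub ρ ((min_le_right _ _).trans (min_le_left _ _)) hp
          linarith
        sol := fun p hp => (hs p hp).affine _ _
        cont := fun p hp hn => ((hcont p hp hn).const_mul _).add_const _ }
    have := hv.lower hCH hH (κ := a / 2) (by positivity) (fun p hp hn => by
      have := (abs_le.1 (hb p hp hn)).1
      linarith)
    filter_upwards [box_mem_nhds (x0 := x0) (t0 := t0) (show 0 < ρ / 8 by positivity)] with q hq
    have h3 := this q hq
    have h4 : c * (a / 2) ≤ 1 * w q + (a - w (x0, t0)) := by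
      rw [hc, inv_mul_le_iff₀ hC0]; exact h3
    linarith
  set a0 := max (w (x0, t0) - B) 1 with ha0
  have ha0p : 0 < a0 := lt_max_of_lt_right one_pos
  have iter : ∀ k : ℕ, ∀ᶠ q in 𝓝 (x0, t0), w (x0, t0) - a0 * (1 - c / 2) ^ k ≤ w q := by
    intro k
    induction k with
    | zero =>
      filter_upwards [hB] with q hq
      have := le_max_left (w (x0, t0) - B) 1
      rw [pow_zero, mul_one]; linarith
    | succ k ih =>
      have := step _ (mul_pos ha0p (pow_pos (by linarith) k)) ih
      simpa only [pow_succ, mul_assoc] using this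
  obtain ⟨k, hk⟩ := exists_pow_lt_of_lt_one (show 0 < ε / a0 by positivity) (show 1 - c / 2 < 1 by linarith)
  filter_upwards [iter k] with q hq
  rw [lt_div_iff₀ ha0p] at hk
  linarith

theorem CrossLip.continuousAt (hCH : 1 ≤ CH) (hH : HarnackConst E lam Lam CH) (hN : 0 < N)
    (h : CrossLip lam Lam N w x0 t0) (hnn : ∀ᶠ q in 𝓝 (x0, t0), 0 ≤ w q) :
    ContinuousAt w (x0, t0) := by
  have hup : ∃ B, ∀ᶠ q in 𝓝 (x0, t0), w q ≤ B := by
    obtain ⟨ρ0, h0, h1, h⟩ := h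
    obtain ⟨ρ1, hρ1, hsub⟩ := exists_box_of_mem_nhds hnn
    have hρp : 0 < min ρ0 ρ1 := lt_min h0 hρ1
    obtain ⟨Z, P, hZ, hx0, hs, hcont, hb⟩ := h _ hρp (min_le_left _ _)
    have hv : CrossSol lam Lam Z P x0 t0 (min ρ0 ρ1) w :=
      { pos := hρp
        le_one := (min_le_left _ _).trans h1
        closed := hZ
        mem := hx0
        nonneg := fun p hp => hsub _ (min_le_right _ _) hp
        sol := hs
        cont := hcont }
    have := hv.upper hCH hH (K := w (x0, t0) + N * min ρ0 ρ1) (fun p hp hn => by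
      have := (abs_le.1 (hb p hp hn)).2
      linarith)
    exact ⟨_, mem_of_superset (box_mem_nhds (x0 := x0) (t0 := t0)
      (show 0 < min ρ0 ρ1 / 8 by positivity)) this⟩
  obtain ⟨B, hB⟩ := hup
  rw [Metric.continuousAt_iff']
  intro ε hε
  have l1 := h.lower hCH hH hN hnn (half_pos hε)
  have l2 := h.neg.lower hCH hH hN (B := -B) (hB.mono fun q hq => by linarith) (half_pos hε)
  filter_upwards [l1, l2] with q h1 h2
  rw [Real.dist_eq, abs_lt]
  constructor <;> linarith

/-- Points where `u` is separately Lipschitz at scale `1/N` with constant `N`. -/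
def sepLip (u : E × ℝ → ℝ) (Ω : Set (E × ℝ)) (N : ℝ) : Set (E × ℝ) :=
  {q | (∀ s, |s - q.2| < 1 / N → (q.1, s) ∈ Ω → |u (q.1, s) - u q| ≤ N * |s - q.2|) ∧
    ∀ y, dist y q.1 < 1 / N → (y, q.2) ∈ Ω → |u (y, q.2) - u q| ≤ N * dist y q.1}

theorem closure_sepLip {Ω : Set (E × ℝ)} (hΩ : IsOpen Ω)
    (hx : ∀ p ∈ Ω, ContinuousAt (fun y => u (y, p.2)) p.1)
    (ht : ∀ p ∈ Ω, ContinuousAt (fun s => u (p.1, s)) p.2) (hN : 0 < N) :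
    Ω ∩ closure (sepLip u Ω N) ⊆ sepLip u Ω N := by
  rintro q ⟨hqΩ, hq⟩
  have : (𝓝[sepLip u Ω N] q).NeBot := mem_closure_iff_nhdsWithin_neBot.1 hq
  set F := 𝓝[sepLip u Ω N] q with hF
  have hid : Tendsto (fun p : E × ℝ => p) F (𝓝 q) := nhdsWithin_le_nhds
  have h1 : Tendsto (fun p : E × ℝ => p.1) F (𝓝 q.1) := (continuous_fst.tendsto q).comp hid
  have h2 : Tendsto (fun p : E × ℝ => p.2) F (𝓝 q.2) := (continuous_snd.tendsto q).comp hid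
  have hmem : ∀ᶠ p in F, p ∈ sepLip u Ω N := self_mem_nhdsWithin
  have hN' : 0 < 1 / N := by positivity
  have hu : Tendsto u F (𝓝 (u q)) := by
    have a1 : Tendsto (fun p : E × ℝ => u (p.1, q.2)) F (𝓝 (u q)) := (hx q hqΩ).tendsto.comp h1
    have a2 : Tendsto (fun p : E × ℝ => (p.1, q.2)) F (𝓝 q) := h1.prodMk_nhds tendsto_const_nhds
    have a3 : ∀ᶠ p in F, (p.1, q.2) ∈ Ω := a2 (hΩ.mem_nhds hqΩ)
    have a4 : Tendsto (fun p : E × ℝ => |q.2 - p.2|) F (𝓝 0) := by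
      simpa using ((tendsto_const_nhds (x := q.2)).sub h2).abs
    have a5 : Tendsto (fun p : E × ℝ => u (p.1, q.2) - u p) F (𝓝 0) := by
      refine squeeze_zero_norm' (a := fun p : E × ℝ => N * |q.2 - p.2|) ?_ (by simpa using a4.const_mul N)
      filter_upwards [hmem, a3, a4.eventually (gt_mem_nhds hN')] with p b1 b2 b3
      exact b1.1 q.2 b3 b2
    simpa using a1.sub a5
  constructor
  · intro s hs hsΩ
    have a1 : Tendsto (fun p : E × ℝ => u (p.1, s)) F (𝓝 (u (q.1, s))) := (hx _ hsΩ).tendsto.comp h1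
    have a2 : Tendsto (fun p : E × ℝ => (p.1, s)) F (𝓝 (q.1, s)) := h1.prodMk_nhds tendsto_const_nhds
    have a4 : Tendsto (fun p : E × ℝ => |s - p.2|) F (𝓝 |s - q.2|) := (tendsto_const_nhds.sub h2).abs
    refine le_of_tendsto_of_tendsto (a1.sub hu).abs (a4.const_mul N) ?_
    filter_upwards [hmem, a2 (hΩ.mem_nhds hsΩ), a4.eventually (gt_mem_nhds hs)] with p b1 b2 b3
    exact b1.1 s b3 b2
  · intro y hy hyΩ
    have a1 : Tendsto (fun p : E × ℝ => u (y, p.2)) F (𝓝 (u (y, q.2))) := (ht _ hyΩ).tendsto.comp h2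
    have a2 : Tendsto (fun p : E × ℝ => (y, p.2)) F (𝓝 (y, q.2)) := tendsto_const_nhds.prodMk_nhds h2
    have a4 : Tendsto (fun p : E × ℝ => dist y p.1) F (𝓝 (dist y q.1)) := tendsto_const_nhds.dist h1
    refine le_of_tendsto_of_tendsto (a1.sub hu).abs (a4.const_mul N) ?_
    filter_upwards [hmem, a2 (hΩ.mem_nhds hyΩ), a4.eventually (gt_mem_nhds hy)] with p b1 b2 b3
    exact b1.2 y b3 b2

theorem exists_mem_sepLip {Ω : Set (E × ℝ)} {q : E × ℝ}
    (hx : DifferentiableAt ℝ (fun y => u (y, q.2)) q.1)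
    (ht : DifferentiableAt ℝ (fun s => u (q.1, s)) q.2) : ∃ n : ℕ, q ∈ sepLip u Ω (n + 1) := by
  obtain ⟨c1, h1⟩ := hx.isBigO_sub.bound
  obtain ⟨c2, h2⟩ := ht.isBigO_sub.bound
  obtain ⟨r1, hr1, h1⟩ := Metric.eventually_nhds_iff.1 h1
  obtain ⟨r2, hr2, h2⟩ := Metric.eventually_nhds_iff.1 h2
  obtain ⟨n, hn⟩ := exists_nat_ge (max (max c1 c2) (max (1 / r1) (1 / r2)))
  simp only [max_le_iff] at hn
  have hn0 : (0 : ℝ) < n + 1 := by positivity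
  have e1 : 1 / ((n : ℝ) + 1) ≤ r1 := by
    rw [one_div_le hn0 hr1]; linarith [hn.2.1]
  have e2 : 1 / ((n : ℝ) + 1) ≤ r2 := by
    rw [one_div_le hn0 hr2]; linarith [hn.2.2]
  refine ⟨n, fun s hs _ => ?_, fun y hy _ => ?_⟩
  · have := h2 (y := s) (by rw [Real.dist_eq]; linarith)
    simp only [Real.norm_eq_abs] at this
    refine this.trans ?_
    gcongr; linarith [hn.1.2]
  · have := h1 (y := y) (by linarith)
    rw [Real.norm_eq_abs, ← dist_eq_norm] at this
    refine this.trans ?_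
    gcongr; linarith [hn.1.1]

theorem crossLip_of_sepLip {Ω U G : Set (E × ℝ)} (hU : IsOpen U) (hUΩ : U ⊆ Ω) (hG : IsOpen G)
    (hsol : ∀ p ∈ Ω, SolAt lam Lam u p) (hcont : ∀ p ∈ G, ContinuousAt u p) (hN : 0 < N)
    (hlip : ∀ p ∈ U, p ∉ G → p ∈ sepLip u Ω N) (hp : (x0, t0) ∈ U) (hpG : (x0, t0) ∉ G) :
    CrossLip lam Lam (4 * N) u x0 t0 := by
  obtain ⟨ρ1, hρ1, hsub⟩ := exists_box_of_mem_nhds (hU.mem_nhds hp)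
  have hN' : 0 < 1 / N := by positivity
  refine ⟨min 1 (min ρ1 (1 / N / 4)), by positivity, min_le_left _ _, fun ρ hρ hρ0 => ?_⟩
  have hr1 : ρ ≤ ρ1 := hρ0.trans ((min_le_right _ _).trans (min_le_left _ _))
  have hr2 : ρ ≤ 1 / N / 4 := hρ0.trans ((min_le_right _ _).trans (min_le_right _ _))
  have hbox := hsub ρ hr1
  set box := closedBall x0 ρ ×ˢ Icc (t0 - ρ) (t0 + ρ) with hbx
  have hcomp : IsCompact (box \ G) := ((isCompact_closedBall x0 ρ).prod isCompact_Icc).diff hG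
  have h0 : (x0, t0) ∈ box := mem_of_mem_nhds (box_mem_nhds hρ)
  refine ⟨Prod.fst '' (box \ G), Prod.snd '' (box \ G), (hcomp.image continuous_fst).isClosed,
    ⟨_, ⟨h0, hpG⟩, rfl⟩, fun p hp => hsol p (hUΩ (hbox hp)), fun p hp hn => ?_, ?_⟩
  · refine hcont p (by_contra fun hh => hn ⟨⟨p, ⟨hp, hh⟩, rfl⟩, ⟨p, ⟨hp, hh⟩, rfl⟩⟩)
  · have hl0 := hlip _ (hbox h0) hpG
    rintro ⟨x, t⟩ ⟨hx, ht⟩ hn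
    have ht' := abs_le.1 (abs_le.2 ⟨by linarith [ht.1], by linarith [ht.2]⟩ : |t - t0| ≤ ρ)
    simp only at hx ht hn
    rcases hn with ⟨⟨x', t'⟩, ⟨hb, hbG⟩, rfl⟩ | ⟨⟨x', t'⟩, ⟨hb, hbG⟩, rfl⟩
    · have hl := hlip _ (hbox hb) hbG
      have hb1 : dist x' x0 ≤ ρ := hb.1
      have hb2 : t' ∈ Icc (t0 - ρ) (t0 + ρ) := hb.2
      have d1 : |t - t'| ≤ 2 * ρ := abs_le.2 ⟨by linarith [ht.1, hb2.2], by linarith [ht.2, hb2.1]⟩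
      have d2 : |t' - t0| ≤ ρ := abs_le.2 ⟨by linarith [hb2.1], by linarith [hb2.2]⟩
      have d3 : dist x0 x' ≤ ρ := by rwa [dist_comm]
      have e1 := hl.1 t (by simp only; linarith) (hUΩ (hbox ⟨hb.1, ht⟩))
      have e2 := hl.2 x0 (by simp only; linarith) (hUΩ (hbox ⟨mem_closedBall_self hρ.le, hb.2⟩))
      have e3 := hl0.1 t' (by simp only; linarith) (hUΩ (hbox ⟨mem_closedBall_self hρ.le, hb.2⟩))
      simp only at e1 e2 e3 ⊢
      have f1 : N * |t - t'| ≤ N * (2 * ρ) := by gcongr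
      have f2 : N * |t' - t0| ≤ N * ρ := by gcongr
      have f3 : N * dist x0 x' ≤ N * ρ := by gcongr
      rw [abs_le] at e1 e2 e3 ⊢
      constructor <;> linarith [e1.1, e1.2, e2.1, e2.2, e3.1, e3.2]
    · have hl := hlip _ (hbox hb) hbG
      have hb1 : dist x' x0 ≤ ρ := hb.1
      have hx1 : dist x x0 ≤ ρ := hx
      have d1 : dist x x' ≤ 2 * ρ := by linarith [dist_triangle_right x x' x0]
      have d2 : |t0 - t'| ≤ ρ := by
        have hb2 : t' ∈ Icc (t0 - ρ) (t0 + ρ) := hb.2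
        exact abs_le.2 ⟨by linarith [hb2.2], by linarith [hb2.1]⟩
      have ht0 : t0 ∈ Icc (t0 - ρ) (t0 + ρ) := h0.2
      have e1 := hl.2 x (by simp only; linarith) (hUΩ (hbox ⟨hx, hb.2⟩))
      have e2 := hl.1 t0 (by simp only; linarith) (hUΩ (hbox ⟨hb.1, ht0⟩))
      have e3 := hl0.2 x' (by simp only; linarith) (hUΩ (hbox ⟨hb.1, ht0⟩))
      simp only at e1 e2 e3 ⊢
      have f1 : N * dist x x' ≤ N * (2 * ρ) := by gcongr
      have f2 : N * |t0 - t'| ≤ N * ρ := by gcongr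
      have f3 : N * dist x' x0 ≤ N * ρ := by gcongr
      rw [abs_le] at e1 e2 e3 ⊢
      constructor <;> linarith [e1.1, e1.2, e2.1, e2.2, e3.1, e3.2]

/-- Nonnegative classical solutions are jointly continuous. -/
theorem SolAt.continuousAt (hCH : 1 ≤ CH) (hH : HarnackConst E lam Lam CH) {Ω : Set (E × ℝ)}
    (hΩ : IsOpen Ω) (hnn : ∀ p ∈ Ω, 0 ≤ u p) (hsol : ∀ p ∈ Ω, SolAt lam Lam u p) :
    ∀ p ∈ Ω, ContinuousAt u p := by
  set G := {p | ∀ᶠ q in 𝓝 p, ContinuousAt u q} with hG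
  have hGo : IsOpen G := isOpen_iff_mem_nhds.2 fun p hp => eventually_eventually_nhds.2 hp
  have hGc : ∀ p ∈ G, ContinuousAt u p := fun p hp => mem_of_mem_nhds hp
  by_contra! hcon
  obtain ⟨p1, hp1, hp1c⟩ := hcon
  have hdx : ∀ p ∈ Ω, DifferentiableAt ℝ (fun y => u (y, p.2)) p.1 := fun p hp =>
    (hsol p hp).1.differentiableAt (by norm_num)
  have hdt : ∀ p ∈ Ω, DifferentiableAt ℝ (fun s => u (p.1, s)) p.2 := fun p hp => by
    obtain ⟨-, b, σ, -, h⟩ := hsol p hp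
    exact h.differentiableAt
  have hlc : IsLocallyClosed (Ω \ G) := hΩ.isLocallyClosed.inter hGo.isClosed_compl.isLocallyClosed
  have := hlc.locallyCompactSpace
  have : Nonempty ↥(Ω \ G) := ⟨⟨p1, hp1, fun h => hp1c (hGc _ h)⟩⟩
  obtain ⟨n, ⟨⟨q, hq⟩, hqi⟩⟩ := nonempty_interior_of_iUnion_of_closed
    (f := fun n : ℕ => ((↑) : ↥(Ω \ G) → E × ℝ) ⁻¹' sepLip u Ω (n + 1)) (fun n => by
      have : ((↑) : ↥(Ω \ G) → E × ℝ) ⁻¹' sepLip u Ω (n + 1) =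
          ((↑) : ↥(Ω \ G) → E × ℝ) ⁻¹' closure (sepLip u Ω (n + 1)) := by
        refine Subset.antisymm (preimage_mono subset_closure) fun q hq => ?_
        exact closure_sepLip hΩ (fun p hp => (hdx p hp).continuousAt)
          (fun p hp => (hdt p hp).continuousAt) (by positivity) ⟨q.2.1, hq⟩
      simp only [this]
      exact isClosed_closure.preimage continuous_subtype_val)
    (by
      refine eq_univ_of_forall fun q => mem_iUnion.2 ?_
      exact exists_mem_sepLip (hdx _ q.2.1) (hdt _ q.2.1))
  rw [mem_interior] at hqi
  obtain ⟨V, hV, hVo, hqV⟩ := hqi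
  obtain ⟨U, hU, rfl⟩ := isOpen_induced_iff.1 hVo
  have hUq : U ∩ Ω ∈ 𝓝 q := (hU.inter hΩ).mem_nhds ⟨hqV, hq.1⟩
  refine hq.2 (mem_of_superset hUq ?_)
  rintro ⟨x, t⟩ hp
  by_cases hpG : (x, t) ∈ G
  · exact hGc _ hpG
  · have hcl : CrossLip lam Lam (4 * ((n : ℝ) + 1)) u x t :=
      crossLip_of_sepLip (hU.inter hΩ) inter_subset_right hGo hsol hGc (by positivity)
        (fun p hp hpG => hV (show (⟨p, hp.2, hpG⟩ : ↥(Ω \ G)) ∈ _ from hp.1)) hp hpG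
    refine hcl.continuousAt hCH hH (by positivity) ?_
    filter_upwards [hΩ.mem_nhds hp.2] with q hq using hnn q hq

end JointContinuity

section Elliptic

variable {m : ℕ}

theorem sum_eigen_bilin (A : Matrix (Fin (m + 1)) (Fin (m + 1)) ℝ) (hA : A.IsHermitian)
    (B : Spc m →L[ℝ] Spc m →L[ℝ] ℝ) :
    ∑ k, hA.eigenvalues k * B (hA.eigenvectorBasis k) (hA.eigenvectorBasis k) =
      ∑ i, ∑ j, A i j * B (eVec m i) (eVec m j) := by
  set b := hA.eigenvectorBasis
  have hexp : ∀ v : Spc m, v = ∑ i, v i • eVec m i := fun v => by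
    have := (EuclideanSpace.basisFun (Fin (m + 1)) ℝ).sum_repr v
    simpa [eVec] using this.symm
  have hB : ∀ v w : Spc m, B v w = ∑ i, ∑ j, v i * w j * B (eVec m i) (eVec m j) := fun v w => by
    conv_lhs => rw [hexp v, hexp w]
    simp only [map_sum, map_smul, sum_apply, smul_apply,
      smul_eq_mul, Finset.mul_sum]
    rw [Finset.sum_comm]
    exact Finset.sum_congr rfl fun i _ => Finset.sum_congr rfl fun j _ => by ring
  have hdelta : ∀ i j, ∑ k, b k i * b k j = if j = i then 1 else 0 := fun i j => by
    have := b.sum_inner_mul_inner (EuclideanSpace.single i 1) (EuclideanSpace.single j 1)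
    simp only [EuclideanSpace.inner_single_left, EuclideanSpace.inner_single_right] at this
    simpa [PiLp.single_apply] using this
  have hAb : ∀ k i, hA.eigenvalues k * b k i = ∑ l, A i l * b k l := fun k i => by
    have := congrFun (hA.mulVec_eigenvectorBasis k) i
    simpa [Matrix.mulVec, dotProduct] using this.symm
  have hAij : ∀ i j, ∑ k, hA.eigenvalues k * (b k i * b k j) = A i j := fun i j => by
    calc ∑ k, hA.eigenvalues k * (b k i * b k j) = ∑ k, ∑ l, A i l * (b k l * b k j) := by
          refine Finset.sum_congr rfl fun k _ => ?_
          rw [← mul_assoc, hAb, Finset.sum_mul]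
          exact Finset.sum_congr rfl fun l _ => by ring
      _ = ∑ l, A i l * ∑ k, b k l * b k j := by
          rw [Finset.sum_comm]; simp only [Finset.mul_sum]
      _ = A i j := by simp [hdelta]
  calc ∑ k, hA.eigenvalues k * B (b k) (b k)
      = ∑ k, ∑ i, ∑ j, hA.eigenvalues k * (b k i * b k j) * B (eVec m i) (eVec m j) := by
        refine Finset.sum_congr rfl fun k _ => ?_
        rw [hB]
        simp only [Finset.mul_sum, mul_assoc]
    _ = ∑ i, ∑ j, ∑ k, hA.eigenvalues k * (b k i * b k j) * B (eVec m i) (eVec m j) := by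
        rw [Finset.sum_comm]
        exact Finset.sum_congr rfl fun i _ => Finset.sum_comm
    _ = _ := by
        refine Finset.sum_congr rfl fun i _ => Finset.sum_congr rfl fun j _ => ?_
        rw [← Finset.sum_mul, hAij]

theorem SolvesL.solAt {lam Lam : ℝ} {A : Spc m → Matrix (Fin (m + 1)) (Fin (m + 1)) ℝ}
    (hA : IsElliptic lam Lam A) {u : Spc m × ℝ → ℝ} {Ω : Set (Spc m × ℝ)} (hu : SolvesL A u Ω)
    {p : Spc m × ℝ} (hp : p ∈ Ω) : SolAt lam Lam u p := by
  obtain ⟨h1, h2⟩ := hu p hp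
  have hH : (A p.1).IsHermitian := by
    have := hA.1 p.1
    rw [Matrix.IsHermitian, Matrix.conjTranspose_eq_transpose_of_trivial]; exact this
  have hfr : finrank ℝ (Spc m) = m + 1 := by simp
  set e : Fin (m + 1) ≃ Fin (finrank ℝ (Spc m)) := finCongr hfr.symm
  refine ⟨h1, hH.eigenvectorBasis.reindex e, fun k => hH.eigenvalues (e.symm k), fun k => ?_, ?_⟩
  · set l := e.symm k
    have h3 := hA.2 p.1 (hH.eigenvectorBasis l)
    have h4 : ‖hH.eigenvectorBasis l‖ = 1 := hH.eigenvectorBasis.orthonormal.1 l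
    have h5 : ∑ i, ∑ j, hH.eigenvectorBasis l i * A p.1 i j * hH.eigenvectorBasis l j =
        hH.eigenvalues l := by
      have h6 : ∀ i, ∑ j, A p.1 i j * hH.eigenvectorBasis l j =
          hH.eigenvalues l * hH.eigenvectorBasis l i := fun i => by
        have := congrFun (hH.mulVec_eigenvectorBasis l) i
        simpa [Matrix.mulVec, dotProduct] using this
      have h7 : ∑ i, hH.eigenvectorBasis l i ^ 2 = 1 := by
        have := EuclideanSpace.norm_sq_eq (hH.eigenvectorBasis l)
        rw [h4] at this
        simpa using this.symm
      calc _ = ∑ i, hH.eigenvalues l * hH.eigenvectorBasis l i ^ 2 := by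
            refine Finset.sum_congr rfl fun i _ => ?_
            simp only [mul_assoc]
            rw [← Finset.mul_sum, h6]; ring
        _ = _ := by rw [← Finset.mul_sum, h7, mul_one]
    rw [h4, h5] at h3
    simpa using h3
  · convert h2 using 1
    simp only [trA, OrthonormalBasis.reindex_apply]
    rw [e.symm.sum_comp (fun l => hH.eigenvalues l *
      dir2 (fun y => u (y, p.2)) p.1 (hH.eigenvectorBasis l))]
    simp only [dir2_eq_fderiv h1]
    rw [sum_eigen_bilin (A p.1) hH (fderiv ℝ (fderiv ℝ fun y => u (y, p.2)) p.1)]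
    refine Finset.sum_congr rfl fun i _ => Finset.sum_congr rfl fun j _ => ?_
    have hd : DifferentiableAt ℝ (fderiv ℝ fun y => u (y, p.2)) p.1 :=
      (h1.fderiv_right (m := 1) (by norm_num)).differentiableAt (by norm_num)
    have : sHess u p j i = fderiv ℝ (fderiv ℝ fun y => u (y, p.2)) p.1 (eVec m j) (eVec m i) := by
      rw [sHess, fderiv_clm_apply hd (differentiableAt_const _)]
      simp
    rw [this, (h1.isSymmSndFDerivAt (by simp)).eq]

end Elliptic

section Segment

theorem harnack_segment {E : Type*} [NormedAddCommGroup E] [InnerProductSpace ℝ E]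
    [FiniteDimensional ℝ E] [MeasurableSpace E] [BorelSpace E] {lam Lam CH : ℝ} (hCH : 1 ≤ CH)
    (hH : HarnackConst E lam Lam CH) {Ω : Set (E × ℝ)} {u : E × ℝ → ℝ} (hc : ContinuousOn u Ω)
    (hnn : ∀ p ∈ Ω, 0 ≤ u p) (hsol : ∀ p ∈ Ω, SolAt lam Lam u p) {r : ℝ} (hr : 0 < r)
    {x y : E} {t : ℝ} {k : ℕ} (hk : 0 < k) (hxy : ‖y - x‖ ≤ k * r)
    (hdom : ∀ θ ∈ Icc (0 : ℝ) 1, ∀ z s, dist z (x + θ • (y - x)) ≤ 9 * r →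
      |s - (t + θ * (k * (100 * r ^ 2)))| ≤ 100 * r ^ 2 → (z, s) ∈ Ω) :
    u (x, t) ≤ CH ^ k * u (y, t + k * (100 * r ^ 2)) := by
  have hk0 : (0 : ℝ) < k := by exact_mod_cast hk
  have hr2 : 0 < r ^ 2 := by positivity
  have key := harnack_chain hCH hH hc hnn hsol hr (fun j => x + ((j : ℝ) / k) • (y - x)) t k ?_ ?_
  · simpa [div_self hk0.ne'] using key
  · intro j _
    have : x + (((j + 1 : ℕ) : ℝ) / k) • (y - x) - (x + ((j : ℝ) / k) • (y - x)) =
        (1 / k : ℝ) • (y - x) := by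
      rw [add_sub_add_left_eq_sub, ← sub_smul]; congr 1; push_cast; ring
    rw [dist_eq_norm, this, norm_smul, Real.norm_of_nonneg (by positivity), one_div_mul_eq_div,
      div_le_iff₀ hk0]
    linarith
  · rintro j hj ⟨z, s⟩ ⟨hz, hs1, hs2⟩
    simp only at hz hs1 hs2
    have hj' : (j : ℝ) ≤ k := by exact_mod_cast hj.le
    refine hdom (j / k) ⟨by positivity, (div_le_one hk0).2 hj'⟩ z s hz ?_
    have : t + (j : ℝ) / k * (k * (100 * r ^ 2)) = t + j * (100 * r ^ 2) := by field_simp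
    rw [this, abs_le]
    constructor <;> linarith

end Segment

section Coordinates

variable {m : ℕ}

@[simp] theorem xprime_apply (x : Spc m) (i : Fin m) : xprime x i = x i.castSucc := rfl

@[simp] theorem xprime_add (x y : Spc m) : xprime (x + y) = xprime x + xprime y := by ext i; simp

@[simp] theorem xprime_sub (x y : Spc m) : xprime (x - y) = xprime x - xprime y := by ext i; simp

@[simp] theorem xprime_smul (c : ℝ) (x : Spc m) : xprime (c • x) = c • xprime x := by ext i; simp

@[simp] theorem xlast_add (x y : Spc m) : xlast (x + y) = xlast x + xlast y := rfl

@[simp] theorem xlast_sub (x y : Spc m) : xlast (x - y) = xlast x - xlast y := rfl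

@[simp] theorem xlast_smul (c : ℝ) (x : Spc m) : xlast (c • x) = c * xlast x := rfl

@[simp] theorem xprime_mkPt (a : Spc' m) (b : ℝ) : xprime (mkPt a b) = a := by
  ext i
  simp [mkPt, (Fin.castSucc_lt_last i).ne]

@[simp] theorem xlast_mkPt (a : Spc' m) (b : ℝ) : xlast (mkPt a b) = b := by
  simp [xlast, mkPt]

theorem mkPt_eta (x : Spc m) : mkPt (xprime x) (xlast x) = x := by
  ext i
  by_cases h : i = Fin.last m
  · subst h; simp [mkPt, xlast]
  · simp [mkPt, h]

theorem norm_sq_eq_xprime_xlast (x : Spc m) : ‖x‖ ^ 2 = ‖xprime x‖ ^ 2 + xlast x ^ 2 := by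
  rw [EuclideanSpace.norm_sq_eq, EuclideanSpace.norm_sq_eq, Fin.sum_univ_castSucc]
  simp [xlast]

theorem norm_xprime_le (x : Spc m) : ‖xprime x‖ ≤ ‖x‖ := by
  refine abs_le_of_sq_le_sq' ?_ (norm_nonneg _) |>.2
  nlinarith [norm_sq_eq_xprime_xlast x, sq_nonneg (xlast x)]

theorem abs_xlast_le (x : Spc m) : |xlast x| ≤ ‖x‖ := by
  refine abs_le_of_sq_le_sq ?_ (norm_nonneg _)
  nlinarith [norm_sq_eq_xprime_xlast x, sq_nonneg ‖xprime x‖]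

theorem norm_le_xprime_add_xlast (x : Spc m) : ‖x‖ ≤ ‖xprime x‖ + |xlast x| := by
  refine abs_le_of_sq_le_sq' ?_ (by positivity) |>.2
  rw [norm_sq_eq_xprime_xlast, ← sq_abs (xlast x)]
  nlinarith [mul_nonneg (norm_nonneg (xprime x)) (abs_nonneg (xlast x))]

theorem continuous_xlast : Continuous (xlast : Spc m → ℝ) := by
  unfold xlast; fun_prop

theorem continuous_xprime : Continuous (xprime : Spc m → Spc' m) :=
  LinearMap.continuous_of_finiteDimensional
    (⟨⟨xprime, xprime_add⟩, xprime_smul⟩ : Spc m →ₗ[ℝ] Spc' m)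

variable {g : Spc' m → ℝ → ℝ}

theorem continuous_hGamma (hg : Continuous (fun q : Spc' m × ℝ => g q.1 q.2)) :
    Continuous (hGamma g) := by
  unfold hGamma
  exact (continuous_xlast.comp continuous_fst).sub
    (hg.comp ((continuous_xprime.comp continuous_fst).prodMk continuous_snd))

theorem mem_Cyl_one {p : Spc m × ℝ} : p ∈ Cyl g 1 ↔
    ‖xprime p.1‖ < 1 ∧ -1 < p.2 ∧ p.2 < 1 ∧ 0 < hGamma g p ∧ hGamma g p < 1 := by
  simp only [Cyl, hGamma, mem_ofPred_eq, one_pow, sub_pos, sub_lt_iff_lt_add']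

theorem isOpen_Cyl_one (hg : Continuous (fun q : Spc' m × ℝ => g q.1 q.2)) : IsOpen (Cyl g 1) := by
  have h := continuous_hGamma hg
  have hx := (continuous_xprime (m := m)).comp (continuous_fst (Y := ℝ))
  have : Cyl g 1 = {p | ‖xprime p.1‖ < 1} ∩ {p | -1 < p.2} ∩ {p | p.2 < 1} ∩ {p | 0 < hGamma g p} ∩
      {p | hGamma g p < 1} := by
    ext p
    simp only [mem_Cyl_one, mem_inter_iff, mem_ofPred_eq, and_assoc]
  rw [this]
  exact ((((isOpen_lt hx.norm continuous_const).inter (isOpen_lt continuous_const continuous_snd)).inter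
    (isOpen_lt continuous_snd continuous_const)).inter (isOpen_lt continuous_const h)).inter
    (isOpen_lt h continuous_const)

end Coordinates

section Moves

variable {m : ℕ} {lam Lam CH : ℝ} {g : Spc' m → ℝ → ℝ} {u : Spc m × ℝ → ℝ} {K α β : ℝ}

/-- Positive, jointly continuous solutions in the unit cylinder above the graph of `g`. -/
structure CylSol (lam Lam : ℝ) (g : Spc' m → ℝ → ℝ) (u : Spc m × ℝ → ℝ) : Prop where
  graph : Continuous (fun q : Spc' m × ℝ => g q.1 q.2)
  cont : ∀ p ∈ Cyl g 1, ContinuousAt u p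
  pos : ∀ p ∈ Cyl g 1, 0 < u p
  sol : ∀ p ∈ Cyl g 1, SolAt lam Lam u p

theorem CylSol.move (hu : CylSol lam Lam g u) (hCH : 1 ≤ CH) (hH : HarnackConst (Spc m) lam Lam CH)
    {x y : Spc m} {t r η : ℝ} {k : ℕ} (hr : 0 < r) (hk : 0 < k) (hη : η ≤ 1 / 8)
    (hrη : 9 * r ≤ η / 4) (hx : ‖xprime x‖ ≤ 3 / 4) (hy : ‖xprime y‖ ≤ 3 / 4) (ht : -(3 / 4) ≤ t)
    (hs : t + k * (100 * r ^ 2) ≤ 3 / 4) (hhx : hGamma g (x, t) ∈ Icc η (3 / 4))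
    (hhy : hGamma g (y, t + k * (100 * r ^ 2)) ∈ Icc η (3 / 4))
    (hosc : ∀ z s, ‖z - xprime x‖ ≤ ‖xprime y - xprime x‖ + 9 * r →
      |s - t| ≤ (k + 1) * (100 * r ^ 2) → |g z s - g (xprime x) t| ≤ η / 4)
    (hxy : ‖y - x‖ ≤ k * r) : u (x, t) ≤ CH ^ k * u (y, t + k * (100 * r ^ 2)) := by
  have hη0 : 0 < η := by linarith
  have hr2 : 100 * r ^ 2 ≤ 1 / 8 := by nlinarith
  have hr2p : 0 < 100 * r ^ 2 := by positivity
  have hk0 : (0 : ℝ) < k := by exact_mod_cast hk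
  refine harnack_segment hCH hH (Ω := Cyl g 1) (fun p hp => (hu.cont p hp).continuousWithinAt)
    (fun p hp => (hu.pos p hp).le) hu.sol hr hk hxy ?_
  rintro θ ⟨hθ0, hθ1⟩ z s hz hs'
  set T := (k : ℝ) * (100 * r ^ 2) with hT
  have hT0 : 0 < T := by positivity
  have hθT : θ * T ≤ T := by nlinarith
  have hθT0 : 0 ≤ θ * T := by positivity
  obtain ⟨hs1, hs2⟩ := abs_le.1 hs'
  set w := x + θ • (y - x) with hw
  have hzw : ‖z - w‖ ≤ 9 * r := by rwa [← dist_eq_norm]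
  have hzw1 : ‖xprime z - xprime w‖ ≤ 9 * r := by
    rw [← xprime_sub]; exact (norm_xprime_le _).trans hzw
  have hzw2 : |xlast z - xlast w| ≤ 9 * r := by
    rw [← xlast_sub]; exact (abs_xlast_le _).trans hzw
  have hw1 : xprime w = (1 - θ) • xprime x + θ • xprime y := by
    rw [hw]; simp only [xprime_add, xprime_smul, xprime_sub]; module
  have hw2 : xlast w = (1 - θ) * xlast x + θ * xlast y := by
    rw [hw]; simp only [xlast_add, xlast_smul, xlast_sub]; ring
  have hwn : ‖xprime w‖ ≤ 3 / 4 := by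
    rw [hw1]
    refine (norm_add_le _ _).trans ?_
    rw [norm_smul, norm_smul, Real.norm_of_nonneg hθ0, Real.norm_of_nonneg (by linarith : 0 ≤ 1 - θ)]
    nlinarith
  have hg1 : |g (xprime z) s - g (xprime x) t| ≤ η / 4 := by
    refine hosc _ _ ?_ ?_
    · have e1 : xprime w - xprime x = θ • (xprime y - xprime x) := by rw [hw1]; module
      have e2 : ‖xprime w - xprime x‖ ≤ ‖xprime y - xprime x‖ := by
        rw [e1, norm_smul, Real.norm_of_nonneg hθ0]
        exact mul_le_of_le_one_left (norm_nonneg _) hθ1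
      linarith [norm_sub_le_norm_sub_add_norm_sub (xprime z) (xprime w) (xprime x)]
    · rw [abs_le]; constructor <;> linarith
  have hg2 : |g (xprime y) (t + T) - g (xprime x) t| ≤ η / 4 := by
    refine hosc _ _ (by linarith) ?_
    rw [add_sub_cancel_left, abs_of_pos hT0]; linarith
  simp only [hGamma, mem_Icc] at hhx hhy
  rw [abs_le] at hg1 hg2 hzw2
  refine mem_Cyl_one.2 ⟨?_, ?_, ?_, ?_, ?_⟩ <;> simp only [hGamma]
  · have := norm_le_norm_add_norm_sub' (xprime z) (xprime w)
    linarith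
  · linarith
  · linarith
  · have : g (xprime x) t + η - η / 4 ≤ xlast w := by rw [hw2]; nlinarith
    linarith
  · have : xlast w ≤ g (xprime x) t + 3 / 4 + η / 4 := by rw [hw2]; nlinarith
    linarith

theorem exists_osc_small (hα : 0 < α) (hβ : 0 < β) (K a b : ℝ) {ε : ℝ} (hε : 0 < ε) :
    ∃ c0, 0 < c0 ∧ ∀ c, 0 < c → c ≤ c0 → K * ((a * c) ^ α + (b * c) ^ β) ≤ ε := by
  have hc : Continuous fun c : ℝ => K * ((a * c) ^ α + (b * c) ^ β) := by
    have h1 : Continuous fun c : ℝ => (a * c) ^ α :=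
      (continuous_const.mul continuous_id).rpow_const fun _ => Or.inr hα.le
    have h2 : Continuous fun c : ℝ => (b * c) ^ β :=
      (continuous_const.mul continuous_id).rpow_const fun _ => Or.inr hβ.le
    exact continuous_const.mul (h1.add h2)
  have h0 : (fun c : ℝ => K * ((a * c) ^ α + (b * c) ^ β)) 0 < ε := by
    simpa [Real.zero_rpow hα.ne', Real.zero_rpow hβ.ne'] using hε
  obtain ⟨r, hr, h⟩ := Metric.eventually_nhds_iff.1 (hc.continuousAt.eventually (gt_mem_nhds h0))
  refine ⟨r / 2, by positivity, fun c hc0 hcr => (h ?_).le⟩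
  rw [Real.dist_eq, sub_zero, abs_of_pos hc0]; linarith

theorem exists_rise (hK : 0 < K) (hα0 : 0 < α) (hα1 : α ≤ 1) {γ : ℝ} (hγ : 1 / α - 1 ≤ γ) :
    ∃ c, 0 < c ∧ ∀ (lam Lam CH : ℝ) (g : Spc' m → ℝ → ℝ) (u : Spc m × ℝ → ℝ), CylSol lam Lam g u →
      1 ≤ CH → HarnackConst (Spc m) lam Lam CH → HolderSemi α (α / (1 + α)) K g →
      ∀ x t, ‖xprime x‖ ≤ 3 / 4 → -(3 / 4) ≤ t → t ≤ 5 / 16 + hGamma g (x, t) / 64 →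
      0 < hGamma g (x, t) → hGamma g (x, t) ≤ 1 / 8 →
      ∃ (k : ℕ) (y : Spc m) (s : ℝ), u (x, t) ≤ CH ^ k * u (y, s) ∧
        (k : ℝ) ≤ c * hGamma g (x, t) ^ (-γ) ∧ xprime y = xprime x ∧ t ≤ s ∧
        2 * hGamma g (x, t) ≤ hGamma g (y, s) ∧ hGamma g (y, s) ≤ 3 / 4 ∧
        s ≤ 5 / 16 + hGamma g (y, s) / 64 := by
  obtain ⟨c0, hc0, hosc⟩ := exists_osc_small hα0 (show 0 < α / (1 + α) by positivity) K 9 400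
    (show (0 : ℝ) < 1 / 4 by norm_num)
  set c := min c0 (1 / 25600) with hc
  have hcp : 0 < c := lt_min hc0 (by norm_num)
  have hc1 : c ≤ 1 / 25600 := min_le_right _ _
  have hosc := hosc c hcp (min_le_left _ _)
  refine ⟨3 / c, by positivity, ?_⟩
  intro lam Lam CH g u hu hCH hH hg x t hx ht0 ht1 hh0 hh1
  set η := hGamma g (x, t) with hη
  set a := η ^ (1 / α) with ha
  have ha0 : 0 < a := Real.rpow_pos_of_pos hh0 _
  have hα' : 1 ≤ 1 / α := by rw [le_div_iff₀ hα0]; linarith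
  have haη : a ≤ η := by
    have := Real.rpow_le_rpow_of_exponent_ge hh0 (by linarith) hα'
    rwa [Real.rpow_one] at this
  set r := c * a with hr
  have hr0 : 0 < r := by positivity
  have hrη : r ≤ η / 25600 := by rw [hr]; nlinarith
  set k := ⌈2 * η / r⌉₊ with hk
  have hk1 : 2 * η ≤ k * r := by
    have := Nat.le_ceil (2 * η / r)
    rwa [div_le_iff₀ hr0] at this
  have hk2 : k * r ≤ 2 * η + r := by
    have := (Nat.ceil_lt_add_one (show 0 ≤ 2 * η / r by positivity)).le
    calc (k : ℝ) * r ≤ (2 * η / r + 1) * r := by gcongr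
      _ = 2 * η + r := by field_simp
  have hk0 : 0 < k := Nat.ceil_pos.2 (by positivity)
  set s := t + k * (100 * r ^ 2) with hs
  set y : Spc m := x + mkPt 0 (k * r) with hy
  have hy1 : xprime y = xprime x := by rw [hy]; simp
  have hy2 : xlast y = xlast x + k * r := by rw [hy]; simp
  have hT : ((k : ℝ) + 1) * (100 * r ^ 2) ≤ 400 * c * (η * a) := by
    have : ((k : ℝ) + 1) * (100 * r ^ 2) = 100 * ((k * r + r) * r) := by ring
    rw [this, show 400 * c * (η * a) = 100 * (4 * η * r) by rw [hr]; ring]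
    gcongr; linarith
  have hT' : (k : ℝ) * (100 * r ^ 2) ≤ η / 64 := by
    have h1 : (k : ℝ) * (100 * r ^ 2) ≤ (k + 1) * (100 * r ^ 2) := by gcongr; linarith
    have h2 : 400 * c * (η * a) ≤ η / 64 := by
      calc 400 * c * (η * a) ≤ 400 * (1 / 25600) * (η * 1) := by
            gcongr; linarith
        _ = η / 64 := by ring
    linarith
  have hT0 : 0 ≤ (k : ℝ) * (100 * r ^ 2) := by positivity
  have ho : ∀ z s', ‖z - xprime x‖ ≤ ‖xprime y - xprime x‖ + 9 * r →
      |s' - t| ≤ (k + 1) * (100 * r ^ 2) → |g z s' - g (xprime x) t| ≤ η / 4 := by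
    intro z s' hz hs'
    rw [hy1, sub_self, norm_zero, zero_add] at hz
    refine (hg _ _ _ _).trans ?_
    have e1 : ‖z - xprime x‖ ^ α ≤ (9 * c) ^ α * η := by
      calc ‖z - xprime x‖ ^ α ≤ (9 * c * a) ^ α := by
            refine Real.rpow_le_rpow (norm_nonneg _) ?_ hα0.le
            rw [mul_assoc]; exact hz
        _ = (9 * c) ^ α * η := by
            rw [Real.mul_rpow (by positivity) ha0.le, ha, ← Real.rpow_mul hh0.le,
              one_div_mul_cancel hα0.ne', Real.rpow_one]
    have e2 : |s' - t| ^ (α / (1 + α)) ≤ (400 * c) ^ (α / (1 + α)) * η := by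
      calc |s' - t| ^ (α / (1 + α)) ≤ (400 * c * (η * a)) ^ (α / (1 + α)) := by
            refine Real.rpow_le_rpow (abs_nonneg _) (hs'.trans hT) (by positivity)
        _ = (400 * c) ^ (α / (1 + α)) * η := by
            have : η * a = η ^ (1 + 1 / α) := by
              rw [Real.rpow_add hh0, Real.rpow_one]
            rw [Real.mul_rpow (by positivity) (by positivity), this, ← Real.rpow_mul hh0.le,
              show (1 + 1 / α) * (α / (1 + α)) = 1 by field_simp; ring, Real.rpow_one]
    calc K * (‖z - xprime x‖ ^ α + |s' - t| ^ (α / (1 + α)))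
        ≤ K * ((9 * c) ^ α * η + (400 * c) ^ (α / (1 + α)) * η) := by gcongr
      _ = K * ((9 * c) ^ α + (400 * c) ^ (α / (1 + α))) * η := by ring
      _ ≤ 1 / 4 * η := by gcongr
      _ = η / 4 := by ring
  have hg2 : |g (xprime x) s - g (xprime x) t| ≤ η / 4 := by
    refine ho _ _ (by rw [sub_self, norm_zero]; positivity) ?_
    rw [hs, add_sub_cancel_left, abs_of_nonneg hT0]
    gcongr; linarith
  have hys : hGamma g (y, s) = η + k * r - (g (xprime x) s - g (xprime x) t) := by
    rw [hη]; simp only [hGamma, hy1, hy2]; ring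
  rw [abs_le] at hg2
  have hlow : 2 * η ≤ hGamma g (y, s) := by rw [hys]; linarith
  have hupp : hGamma g (y, s) ≤ 3 / 4 := by rw [hys]; linarith
  refine ⟨k, y, s, ?_, ?_, hy1, by linarith, hlow, hupp, by linarith⟩
  · refine hu.move hCH hH hr0 hk0 hh1 (by linarith) hx (hy1 ▸ hx) ht0 (by linarith)
      ⟨le_rfl, by linarith⟩ ⟨by linarith, hupp⟩ ho ?_
    rw [hy, add_sub_cancel_left]
    refine (norm_le_xprime_add_xlast _).trans ?_
    rw [xprime_mkPt, norm_zero, zero_add, xlast_mkPt, abs_of_nonneg (by positivity)]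
  · have h1 : (k : ℝ) ≤ 3 * η / r := by
      rw [le_div_iff₀ hr0]; linarith
    refine h1.trans ?_
    have h2 : 3 * η / r = 3 / c * η ^ (1 - 1 / α) := by
      rw [Real.rpow_sub hh0, Real.rpow_one, hr, ← ha]; field_simp
    rw [h2]
    refine mul_le_mul_of_nonneg_left ?_ (by positivity)
    exact Real.rpow_le_rpow_of_exponent_ge hh0 (by linarith) (by linarith)

end Moves

section Interior

variable {m : ℕ} {K α β : ℝ}

set_option maxHeartbeats 1000000 in
theorem exists_interior_bound (hK : 0 < K) (hα : 0 < α) (hβ : 0 < β) :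
    ∃ n : ℕ, ∀ (lam Lam CH : ℝ) (g : Spc' m → ℝ → ℝ) (u : Spc m × ℝ → ℝ), CylSol lam Lam g u →
      1 ≤ CH → HarnackConst (Spc m) lam Lam CH → HolderSemi α β K g →
      ∀ x t, ‖xprime x‖ ≤ 3 / 4 → -(3 / 4) ≤ t → t ≤ 3 / 8 →
      1 / 8 ≤ hGamma g (x, t) → hGamma g (x, t) ≤ 3 / 4 → u (x, t) ≤ CH ^ n * u (Ebar g) := by
  obtain ⟨c0, hc0, hosc⟩ := exists_osc_small hα hβ K 2 3 (show (0 : ℝ) < 1 / 32 by norm_num)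
  obtain ⟨N, hN⟩ := exists_nat_gt (1 / c0)
  have hN0 : (0 : ℝ) < N := lt_trans (by positivity) hN
  have hN1 : (1 : ℝ) ≤ N := by
    have : 0 < N := by exact_mod_cast hN0
    exact_mod_cast this
  have hosc := hosc (1 / N) (by positivity) (by rw [one_div_le hN0 hc0]; exact hN.le)
  refine ⟨7200 * N * N, ?_⟩
  intro lam Lam CH g u hu hCH hH hg x t hx ht0 ht1 hh0 hh1
  set k := 7200 * N with hk
  set h := hGamma g (x, t) with hh
  set T := 1 / 2 - t with hT
  have hT1 : 1 / 8 ≤ T := by linarith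
  have hT2 : T ≤ 5 / 4 := by linarith
  set r := √(T / (100 * (N * k))) with hr
  have hkN : (k : ℝ) = 7200 * N := by rw [hk]; push_cast; ring
  have hk0 : (0 : ℝ) < k := by rw [hkN]; positivity
  have hr0 : 0 < r := Real.sqrt_pos.2 (by positivity)
  have hr2 : r ^ 2 = T / (100 * (N * k)) := Real.sq_sqrt (by positivity)
  have htime : (k : ℝ) * (100 * r ^ 2) = T / N := by rw [hr2]; field_simp
  have h9r : 9 * r ≤ 1 / 77 / N := by
    refine abs_le_of_sq_le_sq' ?_ (by positivity) |>.2
    rw [mul_pow, hr2, hkN, div_pow]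
    rw [show (9 : ℝ) ^ 2 * (T / (100 * (N * (7200 * N)))) = 81 * T / 720000 / (N : ℝ) ^ 2 by field_simp; ring]
    gcongr
    norm_num; linarith
  have h9r' : 9 * r ≤ 1 / 77 := h9r.trans (div_le_self (by norm_num) hN1)
  have h9r'' : 9 * r ≤ 1 / N := h9r.trans (by gcongr; norm_num)
  have hkr : 3 ≤ k * r := by
    refine abs_le_of_sq_le_sq' ?_ (by positivity) |>.2
    rw [mul_pow, hr2, hkN, show ((7200 : ℝ) * N) ^ 2 * (T / (100 * (N * (7200 * N)))) = 72 * T by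
      field_simp; ring]
    linarith
  set X : ℕ → Spc' m := fun i => (1 - (i : ℝ) / N) • xprime x with hX
  set τ : ℕ → ℝ := fun i => t + i * (T / N) with hτ
  set y : ℕ → ℝ := fun i => (1 - (i : ℝ) / N) * h + (i : ℝ) / N * (1 / 2) with hy
  set Y : ℕ → Spc m := fun i => mkPt (X i) (g (X i) (τ i) + y i) with hY
  have hfrac : ∀ i : ℕ, i ≤ N → 0 ≤ (i : ℝ) / N ∧ (i : ℝ) / N ≤ 1 := fun i hi =>
    ⟨by positivity, (div_le_one hN0).2 (by exact_mod_cast hi)⟩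
  have hXn : ∀ i ≤ N, ‖X i‖ ≤ 3 / 4 := fun i hi => by
    obtain ⟨a, b⟩ := hfrac i hi
    rw [hX, norm_smul, Real.norm_of_nonneg (by linarith)]
    nlinarith [norm_nonneg (xprime x)]
  have hτm : ∀ i ≤ N, t ≤ τ i ∧ τ i ≤ 1 / 2 := fun i hi => by
    obtain ⟨a, b⟩ := hfrac i hi
    have : τ i = t + (i : ℝ) / N * T := by rw [hτ]; ring
    rw [this]; constructor
    · nlinarith
    · have : (i : ℝ) / N * T ≤ T := by nlinarith
      linarith
  have hym : ∀ i ≤ N, y i ∈ Icc (1 / 8) (3 / 4) := fun i hi => by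
    obtain ⟨a, b⟩ := hfrac i hi
    constructor <;> simp only [hy] <;> nlinarith
  have hYh : ∀ i, hGamma g (Y i, τ i) = y i := fun i => by simp [hGamma, hY]
  have hstep : ∀ i, i < N → u (Y i, τ i) ≤ CH ^ k * u (Y (i + 1), τ (i + 1)) := by
    intro i hi
    have hτs : τ (i + 1) = τ i + k * (100 * r ^ 2) := by
      rw [htime, hτ]; push_cast; ring
    have hXd : ‖X (i + 1) - X i‖ ≤ 1 / N := by
      have : X (i + 1) - X i = (-(1 / N) : ℝ) • xprime x := by
        rw [hX]; simp only; rw [← sub_smul]; congr 1; push_cast; ring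
      rw [this, norm_smul, norm_neg, Real.norm_of_nonneg (by positivity)]
      exact mul_le_of_le_one_right (by positivity) (by linarith)
    have hTN : T / N ≤ 5 / 4 / N := by gcongr
    have ho : ∀ z s, ‖z - X i‖ ≤ ‖X (i + 1) - X i‖ + 9 * r →
        |s - τ i| ≤ (k + 1) * (100 * r ^ 2) → |g z s - g (X i) (τ i)| ≤ (1 / 8) / 4 := by
      intro z s hz hs
      refine (hg _ _ _ _).trans ?_
      have e1 : ‖z - X i‖ ≤ 2 * (1 / N) := by linarith
      have e2 : |s - τ i| ≤ 3 * (1 / N) := by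
        have : 100 * r ^ 2 ≤ k * (100 * r ^ 2) := by
          have : (1 : ℝ) ≤ k := by rw [hkN]; linarith
          exact le_mul_of_one_le_left (by positivity) this
        have e3 : (5 / 4 / N : ℝ) = 5 / 4 * (1 / N) := by ring
        have : (0 : ℝ) < 1 / N := by positivity
        linarith
      calc K * (‖z - X i‖ ^ α + |s - τ i| ^ β) ≤ K * ((2 * (1 / N)) ^ α + (3 * (1 / N)) ^ β) := by
            gcongr
        _ ≤ 1 / 8 / 4 := by linarith
    have hXi := hXn i hi.le
    have hXi1 := hXn (i + 1) hi
    have hgd : |g (X (i + 1)) (τ (i + 1)) - g (X i) (τ i)| ≤ 1 / 8 / 4 := by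
      refine ho _ _ (by linarith) ?_
      rw [hτs, add_sub_cancel_left, abs_of_nonneg (by positivity)]
      gcongr; linarith
    rw [hτs]
    refine hu.move hCH hH (η := 1 / 8) hr0 (by exact_mod_cast hk0) le_rfl (by linarith)
      (by simpa [hY] using hXi) (by simpa [hY] using hXi1) (ht0.trans (hτm i hi.le).1) ?_ ?_ ?_ ?_ ?_
    · rw [← hτs]; linarith [(hτm (i + 1) hi).2]
    · rw [hYh]; exact hym i hi.le
    · rw [← hτs, hYh]; exact hym _ hi
    · simpa [hY] using ho
    · refine (norm_le_xprime_add_xlast _).trans ?_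
      simp only [xprime_sub, xlast_sub, hY, xprime_mkPt, xlast_mkPt]
      have e1 : (1 : ℝ) / N ≤ 1 := (div_le_one hN0).2 hN1
      have e2 : |g (X (i + 1)) (τ (i + 1)) + y (i + 1) - (g (X i) (τ i) + y i)| ≤ 1 := by
        have a1 := hym i hi.le
        have a2 := hym (i + 1) hi
        rw [abs_le] at hgd ⊢
        constructor <;> linarith [a1.1, a1.2, a2.1, a2.2]
      linarith
  have iter : ∀ i ≤ N, u (Y 0, τ 0) ≤ (CH ^ k) ^ i * u (Y i, τ i) := by
    intro i
    induction i with
    | zero => intro _; simp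
    | succ i ih =>
      intro hi
      refine (ih (by omega)).trans ?_
      rw [pow_succ, mul_assoc]
      gcongr
      exact hstep i hi
  have key := iter N le_rfl
  have e0 : (Y 0, τ 0) = (x, t) := by
    have : g (xprime x) t + h = xlast x := by rw [hh]; simp [hGamma]
    simp [hY, hX, hτ, hy, this, mkPt_eta]
  have e1 : (Y N, τ N) = Ebar g := by
    have : t + N * (T / N) = 1 / 2 := by rw [mul_div_cancel₀ _ hN0.ne']; rw [hT]; ring
    simp only [hY, hX, hτ, hy, Ebar, div_self hN0.ne', sub_self, zero_smul, zero_mul, one_mul, zero_add, this]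
  rw [e0, e1, ← pow_mul] at key
  exact key

end Interior

section BoundaryBound

variable {m : ℕ} {K α γ : ℝ}

theorem Ebar_mem_Cyl (g : Spc' m → ℝ → ℝ) : Ebar g ∈ Cyl g 1 := by
  rw [mem_Cyl_one]
  simp only [Ebar, hGamma, xprime_mkPt, xlast_mkPt, norm_zero]
  norm_num

theorem exists_boundary_bound (hK : 0 < K) (hα0 : 0 < α) (hα1 : α ≤ 1) (hγ : 1 / α - 1 ≤ γ)
    (hγ0 : 0 < γ) {CH : ℝ} (hCH : 1 ≤ CH) :
    ∃ (C : ℝ) (n : ℕ), 0 < C ∧ ∀ (lam Lam : ℝ) (g : Spc' m → ℝ → ℝ) (u : Spc m × ℝ → ℝ),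
      CylSol lam Lam g u → HarnackConst (Spc m) lam Lam CH → HolderSemi α (α / (1 + α)) K g →
      ∀ x t, ‖xprime x‖ ≤ 3 / 4 → -(3 / 4) ≤ t → t ≤ 5 / 16 →
      0 < hGamma g (x, t) → hGamma g (x, t) ≤ 3 / 4 →
      u (x, t) ≤ Real.exp (C * hGamma g (x, t) ^ (-γ)) * (CH ^ n * u (Ebar g)) := by
  obtain ⟨c, hc, hrise⟩ := exists_rise (m := m) hK hα0 hα1 hγ
  obtain ⟨n, h_interior⟩ := exists_interior_bound (m := m) hK hα0 (show 0 < α / (1 + α) by positivity)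
  have h2 : (2 : ℝ) ^ (-γ) < 1 := Real.rpow_lt_one_of_one_lt_of_neg (by norm_num) (by linarith)
  have h2' : 0 < 1 - (2 : ℝ) ^ (-γ) := by linarith
  have hL : 0 ≤ Real.log CH := Real.log_nonneg hCH
  set C := (c * Real.log CH + 1) / (1 - (2 : ℝ) ^ (-γ)) with hC
  have hC0 : 0 < C := by positivity
  have hCeq : c * Real.log CH + C * (2 : ℝ) ^ (-γ) ≤ C := by
    have : C * (1 - (2 : ℝ) ^ (-γ)) = c * Real.log CH + 1 := by rw [hC]; field_simp
    linarith
  refine ⟨C, n, hC0, ?_⟩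
  intro lam Lam g u hu hH hg
  set V := CH ^ n * u (Ebar g) with hV
  have hV0 : 0 ≤ V := mul_nonneg (by positivity) (hu.pos _ (Ebar_mem_Cyl g)).le
  have key : ∀ j : ℕ, ∀ x t, ‖xprime x‖ ≤ 3 / 4 → -(3 / 4) ≤ t → t ≤ 5 / 16 + hGamma g (x, t) / 64 →
      (1 / 2) ^ j / 8 ≤ hGamma g (x, t) → hGamma g (x, t) ≤ 3 / 4 →
      u (x, t) ≤ Real.exp (C * hGamma g (x, t) ^ (-γ)) * V := by
    intro j
    induction j with
    | zero =>
      intro x t hx ht0 ht1 hh0 hh1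
      have h0 : 0 ≤ hGamma g (x, t) := by linarith [(show ((1 : ℝ) / 2) ^ 0 = 1 by simp)]
      have := h_interior lam Lam CH g u hu hCH hH hg x t hx ht0 (by linarith) (by simpa using hh0) hh1
      refine this.trans (le_mul_of_one_le_left hV0 (Real.one_le_exp ?_))
      positivity
    | succ j ih =>
      intro x t hx ht0 ht1 hh0 hh1
      by_cases hj : (1 / 2) ^ j / 8 ≤ hGamma g (x, t)
      · exact ih x t hx ht0 ht1 hj hh1
      · have hjp : (0 : ℝ) < (1 / 2) ^ (j + 1) / 8 := by positivity
        have hj1 : ((1 : ℝ) / 2) ^ j ≤ 1 := pow_le_one₀ (by norm_num) (by norm_num)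
        push Not at hj
        set η := hGamma g (x, t)
        have hη0 : 0 < η := hjp.trans_le hh0
        obtain ⟨k, y, s, h1, hk, hy, hts, hlow, hupp, hs⟩ :=
          hrise lam Lam CH g u hu hCH hH hg x t hx ht0 ht1 hη0 (by linarith)
        have hq := ih y s (hy ▸ hx) (ht0.trans hts) hs (by rw [pow_succ] at hh0; linarith) hupp
        have e1 : hGamma g (y, s) ^ (-γ) ≤ 2 ^ (-γ) * η ^ (-γ) := by
          rw [← Real.mul_rpow (by norm_num) hη0.le]
          exact Real.rpow_le_rpow_of_nonpos (by positivity) hlow (by linarith)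
        have e2 : CH ^ k ≤ Real.exp (c * η ^ (-γ) * Real.log CH) := by
          have : CH ^ k = Real.exp (k * Real.log CH) := by
            rw [Real.exp_nat_mul, Real.exp_log (by linarith)]
          rw [this]
          gcongr
        have hηγ : 0 < η ^ (-γ) := Real.rpow_pos_of_pos hη0 _
        calc u (x, t) ≤ CH ^ k * u (y, s) := h1
          _ ≤ CH ^ k * (Real.exp (C * hGamma g (y, s) ^ (-γ)) * V) := by gcongr
          _ ≤ Real.exp (c * η ^ (-γ) * Real.log CH) *
              (Real.exp (C * (2 ^ (-γ) * η ^ (-γ))) * V) := by gcongr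
          _ = Real.exp ((c * Real.log CH + C * 2 ^ (-γ)) * η ^ (-γ)) * V := by
              rw [← mul_assoc, ← Real.exp_add]; ring_nf
          _ ≤ Real.exp (C * η ^ (-γ)) * V := by gcongr
  intro x t hx ht0 ht1 hh0 hh1
  obtain ⟨j, hj⟩ := exists_pow_lt_of_lt_one (show 0 < 8 * hGamma g (x, t) by positivity)
    (show (1 / 2 : ℝ) < 1 by norm_num)
  exact key j x t hx ht0 (by linarith) (by linarith) hh1

end BoundaryBound

section Layer

variable {m : ℕ} {g : Spc' m → ℝ → ℝ} {u : Spc m × ℝ → ℝ}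

/-- Extension of `u` by zero outside the unit cylinder above the graph of `g`. -/
def cylExt (g : Spc' m → ℝ → ℝ) (u : Spc m × ℝ → ℝ) (q : Spc m × ℝ) : ℝ :=
  if q ∈ Cyl g 1 then u q else 0

theorem cylExt_eventuallyEq (hg : Continuous (fun q : Spc' m × ℝ => g q.1 q.2)) {q : Spc m × ℝ}
    (hq : q ∈ Cyl g 1) : cylExt g u =ᶠ[𝓝 q] u := by
  filter_upwards [(isOpen_Cyl_one hg).mem_nhds hq] with p hp
  rw [cylExt, if_pos hp]

theorem continuousAt_cylExt (hg : Continuous (fun q : Spc' m × ℝ => g q.1 q.2))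
    (hu : ∀ p ∈ Cyl g 1, ContinuousAt u p) (hv : VanishesOn u (Cyl g 1) (graphSet g))
    {q : Spc m × ℝ} (hq : 0 < hGamma g q → q ∈ Cyl g 1) : ContinuousAt (cylExt g u) q := by
  by_cases hqC : q ∈ Cyl g 1
  · exact (hu q hqC).congr (cylExt_eventuallyEq hg hqC).symm
  · have h0 : cylExt g u q = 0 := if_neg hqC
    rw [ContinuousAt, h0]
    by_cases hcl : q ∈ closure (Cyl g 1)
    · have h1 : 0 ≤ hGamma g q := by
        have : closure (Cyl g 1) ⊆ {p | 0 ≤ hGamma g p} :=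
          closure_minimal (fun p hp => (mem_Cyl_one.1 hp).2.2.2.1.le)
            (isClosed_le continuous_const (continuous_hGamma hg))
        exact this hcl
      have h2 : hGamma g q = 0 := le_antisymm (not_lt.1 fun h => hqC (hq h)) h1
      have h3 := hv q ⟨show xlast q.1 = _ from sub_eq_zero.1 h2, hcl⟩
      rw [Metric.tendsto_nhds] at h3 ⊢
      intro ε hε
      filter_upwards [eventually_nhdsWithin_iff.1 (h3 ε hε)] with p hp
      rw [cylExt]
      split_ifs with hpC
      · exact hp hpC
      · simpa using hε
    · refine tendsto_const_nhds.congr' ?_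
      filter_upwards [isClosed_closure.isOpen_compl.mem_nhds hcl] with p hp
      rw [cylExt, if_neg fun h => hp (subset_closure h)]

theorem volume_layer_le (hg : Continuous (fun q : Spc' m × ℝ => g q.1 q.2)) (x : Spc m) (t : ℝ)
    {r : ℝ} (hr : 0 < r) (L : ℕ) :
    (L : ENNReal) * volume {p ∈ pcyl x t (L * r) | 0 < hGamma g p ∧ hGamma g p < r} ≤
      volume (pcyl x t (2 * (L * r))) := by
  set S := {p ∈ pcyl x t (L * r) | 0 < hGamma g p ∧ hGamma g p < r} with hS
  have hSm : MeasurableSet S := by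
    refine IsOpen.measurableSet (IsOpen.inter (isOpen_pcyl _ _ _) (IsOpen.inter ?_ ?_))
    · exact isOpen_lt continuous_const (continuous_hGamma hg)
    · exact isOpen_lt (continuous_hGamma hg) continuous_const
  set v : ℕ → Spc m × ℝ := fun i => (mkPt 0 (-(i * r)), 0) with hv
  have hh : ∀ i p, hGamma g (p + v i) = hGamma g p - i * r := fun i p => by
    simp [hGamma, hv]; ring
  have hvol : ∀ i, volume ((· + v i) ⁻¹' S) = volume S := fun i => by
    have : (volume : Measure (Spc m × ℝ)).IsAddHaarMeasure := by
      rw [Measure.volume_eq_prod]; infer_instance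
    exact measure_preimage_add_right _ _ _
  have hdisj : (↑(Finset.range L) : Set ℕ).PairwiseDisjoint fun i => (· + v i) ⁻¹' S := by
    intro i _ j _ hij
    refine Set.disjoint_left.2 fun p hp hp' => hij ?_
    have h1 := hp.2
    have h2 := hp'.2
    rw [hh] at h1 h2
    have a1 : (i : ℝ) < j + 1 := by
      by_contra! hc
      nlinarith [h1.1, h2.2, mul_le_mul_of_nonneg_right hc hr.le]
    have a2 : (j : ℝ) < i + 1 := by
      by_contra! hc
      nlinarith [h2.1, h1.2, mul_le_mul_of_nonneg_right hc hr.le]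
    have a1' : i < j + 1 := by exact_mod_cast a1
    have a2' : j < i + 1 := by exact_mod_cast a2
    omega
  calc (L : ENNReal) * volume S = ∑ i ∈ Finset.range L, volume ((· + v i) ⁻¹' S) := by
        simp [hvol]
    _ = volume (⋃ i ∈ Finset.range L, (· + v i) ⁻¹' S) :=
        (measure_biUnion_finset hdisj fun i _ => hSm.preimage (measurable_add_const _)).symm
    _ ≤ volume (pcyl x t (2 * (L * r))) := by
        refine measure_mono (iUnion₂_subset fun i hi => ?_)
        rintro ⟨y, s⟩ hp
        obtain ⟨hb, ht1, ht2⟩ := hp.1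
        simp only [hv, Prod.mk_add_mk, add_zero] at hb ht1 ht2
        have hiL : (i : ℝ) ≤ L := by exact_mod_cast (Finset.mem_range.1 hi).le
        have hir : (i : ℝ) * r ≤ L * r := by gcongr
        have hn : ‖mkPt (0 : Spc' m) (-(i * r))‖ ≤ i * r := by
          refine (norm_le_xprime_add_xlast _).trans ?_
          rw [xprime_mkPt, norm_zero, zero_add, xlast_mkPt, abs_neg, abs_of_nonneg (by positivity)]
        have hsq : (L * r) ^ 2 ≤ (2 * (L * r)) ^ 2 := by nlinarith [sq_nonneg ((L : ℝ) * r)]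
        refine ⟨?_, by simp only; linarith, by simp only; linarith⟩
        rw [mem_ball, dist_eq_norm] at hb ⊢
        have := norm_sub_le (y + mkPt 0 (-(i * r)) - x) (mkPt 0 (-(i * r)))
        rw [show y + mkPt 0 (-(i * r)) - x - mkPt 0 (-(i * r)) = y - x by abel] at this
        linarith

end Layer

section Carleson

theorem exists_radii {θ C B γ δ : ℝ} (hθ : 1 < θ) (hC : 0 < C) (hB : 0 < B) (hγ0 : 0 < γ)
    (hγ1 : γ < 1) (L : ℕ) (hδ : 0 < δ) :
    ∃ (r : ℕ → ℝ) (N : ℕ), (∀ j, 0 < r j) ∧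
      (∀ n, ∑ i ∈ Finset.range n, 4 * (L * r i) ≤ δ) ∧
      ∀ j h, 0 < h → θ ^ (j + N) / 2 < Real.exp (C * h ^ (-γ)) * B → h < r j := by
  have hl : 0 < Real.log θ := Real.log_pos hθ
  set C' := 2 * C / Real.log θ with hC'
  have hC'0 : 0 < C' := by positivity
  set f : ℕ → ℝ := fun j => 4 * (L * (C' / j) ^ (1 / γ)) with hf
  have hfn : ∀ j, 0 ≤ f j := fun j => by positivity
  have hfs : Summable f := by
    have h1 : Summable fun j : ℕ => ((j : ℝ) ^ (1 / γ))⁻¹ :=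
      Real.summable_nat_rpow_inv.2 (by rw [lt_div_iff₀ hγ0]; linarith)
    refine (h1.mul_left (4 * (L * C' ^ (1 / γ)))).congr fun j => ?_
    rw [hf]
    simp only
    rw [Real.div_rpow hC'0.le (by positivity)]
    ring
  obtain ⟨N1, hN1⟩ := ((tendsto_sum_nat_add f).eventually (gt_mem_nhds hδ)).exists_forall_of_atTop
  obtain ⟨N2, hN2⟩ := exists_nat_gt (2 * Real.log (2 * B) / Real.log θ)
  set N := N1 + N2 + 1 with hN
  have hpos : ∀ j : ℕ, (0 : ℝ) < ((j + N : ℕ) : ℝ) := fun j => by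
    exact_mod_cast (show 0 < j + N by omega)
  refine ⟨fun j => (C' / ((j + N : ℕ) : ℝ)) ^ (1 / γ), N, fun j => ?_, fun n => ?_, ?_⟩
  · have := hpos j
    positivity
  · have hs : Summable fun i => f (i + N) := (summable_nat_add_iff N).2 hfs
    exact (hs.sum_le_tsum _ fun i _ => hfn _).trans (hN1 N (by omega)).le
  · intro j h hh hlt
    by_contra! hge
    have hj := hpos j
    have h1 : h ^ (-γ) ≤ ((j + N : ℕ) : ℝ) / C' := by
      have h2 := Real.rpow_le_rpow_of_nonpos (by positivity) hge (show -γ ≤ 0 by linarith)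
      rwa [← Real.rpow_mul (by positivity), show 1 / γ * -γ = -1 by field_simp,
        Real.rpow_neg_one, inv_div] at h2
    have h3 : C * h ^ (-γ) ≤ ((j + N : ℕ) : ℝ) * Real.log θ / 2 := by
      refine (mul_le_mul_of_nonneg_left h1 hC.le).trans (le_of_eq ?_)
      rw [hC']; field_simp
    have h4 : θ ^ (j + N) < Real.exp (C * h ^ (-γ)) * (2 * B) := by linarith
    have h5 := Real.log_lt_log (by positivity) h4
    rw [Real.log_mul (Real.exp_ne_zero _) (by positivity), Real.log_exp, Real.log_pow] at h5
    rw [div_lt_iff₀ hl] at hN2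
    have h6 : (N2 : ℝ) * Real.log θ ≤ ((j + N : ℕ) : ℝ) * Real.log θ := by
      refine mul_le_mul_of_nonneg_right ?_ hl.le
      exact_mod_cast (show N2 ≤ j + N by omega)
    linarith

variable {m : ℕ}

theorem volume_layer_lt {g : Spc' m → ℝ → ℝ}
    (hg : Continuous (fun q : Spc' m × ℝ => g q.1 q.2)) {μ : ℝ} (hμ : 0 < μ) {L : ℕ}
    (hL : 2 ^ (m + 3) / μ < L) (x : Spc m) (t : ℝ) {r : ℝ} (hr : 0 < r) :
    volume {p ∈ pcyl x t (L * r) | 0 < hGamma g p ∧ hGamma g p < r} <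
      ENNReal.ofReal μ * volume (pcyl x t (L * r)) := by
  have hL0 : (0 : ℝ) < L := lt_of_le_of_lt (by positivity) hL
  have hV0 : volume (ball (0 : Spc m) 1) ≠ 0 := (measure_ball_pos _ _ one_pos).ne'
  have hVt : volume (ball (0 : Spc m) 1) ≠ ⊤ := measure_ball_lt_top.ne
  have hfr : finrank ℝ (Spc m) + 2 = m + 3 := by simp
  have hP := volume_pcyl x t (show 0 ≤ L * r by positivity)
  have hP2 : volume (pcyl x t (2 * (L * r))) =
      ENNReal.ofReal (2 ^ (m + 3)) * volume (pcyl x t (L * r)) := by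
    rw [hP, volume_pcyl x t (by positivity), ← mul_assoc (ENNReal.ofReal _),
      ← ENNReal.ofReal_mul (by positivity), hfr]
    congr 2
    ring
  have hP0 : volume (pcyl x t (L * r)) ≠ 0 := by
    rw [hP]
    exact mul_ne_zero (ENNReal.ofReal_pos.2 (by positivity)).ne' hV0
  have hPt : volume (pcyl x t (L * r)) ≠ ⊤ := by
    rw [hP]
    exact ENNReal.mul_ne_top ENNReal.ofReal_ne_top hVt
  by_contra! hcon
  have h1 := (mul_le_mul_right hcon (L : ENNReal)).trans ((volume_layer_le hg x t hr L).trans_eq hP2)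
  rw [← mul_assoc] at h1
  have h2 := (ENNReal.mul_le_mul_iff_left hP0 hPt).1 h1
  rw [← ENNReal.ofReal_natCast L, ← ENNReal.ofReal_mul hL0.le,
    ENNReal.ofReal_le_ofReal_iff (by positivity)] at h2
  rw [div_lt_iff₀ hμ] at hL
  linarith

/-- Points of a small backward box around a point of the half cylinder stay well inside. -/
theorem exists_box (α β K : ℝ) (hα : 0 < α) (hβ : 0 < β) (hK : 0 < K) :
    ∃ δ : ℝ, 0 < δ ∧ δ ≤ 1 / 8 ∧ ∀ g : Spc' m → ℝ → ℝ, HolderSemi α β K g →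
      ∀ p ∈ Cyl g (1 / 2), ∀ q ∈ closedBall p.1 δ ×ˢ Icc (p.2 - 3 * δ ^ 2) p.2,
        ‖xprime q.1‖ ≤ 3 / 4 ∧ -(3 / 4) ≤ q.2 ∧ q.2 ≤ 5 / 16 ∧ hGamma g q ≤ 3 / 4 := by
  obtain ⟨c, hc, hosc⟩ := exists_osc_small hα hβ K 1 1 (show (0 : ℝ) < 1 / 8 by norm_num)
  refine ⟨min c (1 / 8), by positivity, min_le_right _ _, ?_⟩
  intro g hg p hp q hq
  have hδ := hosc (min c (1 / 8)) (by positivity) (min_le_left _ _)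
  have hδ8 : min c (1 / 8) ≤ 1 / 8 := min_le_right _ _
  have hδ0 : 0 < min c (1 / 8) := by positivity
  set δ := min c (1 / 8)
  obtain ⟨hq1, hq2, hq3⟩ := hq
  obtain ⟨hp1, hp2, hp3, hp4, hp5⟩ := hp
  have hn : ‖q.1 - p.1‖ ≤ δ := by rwa [mem_closedBall, dist_eq_norm] at hq1
  have hx' : ‖xprime q.1 - xprime p.1‖ ≤ δ := by
    rw [← xprime_sub]; exact (norm_xprime_le _).trans hn
  have hxn : |xlast q.1 - xlast p.1| ≤ δ := by
    rw [← xlast_sub]; exact (abs_xlast_le _).trans hn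
  have ht : |q.2 - p.2| ≤ δ := by rw [abs_le]; constructor <;> nlinarith
  have hgd := hg (xprime q.1) (xprime p.1) q.2 p.2
  have h1 : K * (‖xprime q.1 - xprime p.1‖ ^ α + |q.2 - p.2| ^ β) ≤ 1 / 8 := by
    refine le_trans ?_ hδ
    rw [one_mul]
    gcongr
  have h2 := norm_sub_norm_le (xprime q.1) (xprime p.1)
  have h3 := abs_le.1 (hgd.trans h1)
  have h4 := abs_le.1 hxn
  refine ⟨by linarith, by nlinarith, by linarith, ?_⟩
  rw [hGamma]
  linarith

theorem exists_carleson (lam Lam K α : ℝ) (hlam : 0 < lam) (hK : 0 < K)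
    (hα : 1 / 2 < α) (hα1 : α ≤ 1) :
    ∃ C : ℝ, 0 < C ∧
      ∀ (A : Spc m → Matrix (Fin (m + 1)) (Fin (m + 1)) ℝ), IsElliptic lam Lam A →
      ∀ g : Spc' m → ℝ → ℝ,
        Continuous (fun q : Spc' m × ℝ => g q.1 q.2) →
        HolderSemi α (α / (1 + α)) K g →
      ∀ u : Spc m × ℝ → ℝ,
        SolvesL A u (Cyl g 1) →
        (∀ p ∈ Cyl g 1, 0 < u p) →
        VanishesOn u (Cyl g 1) (graphSet g) →
        ∀ p ∈ Cyl g (1 / 2), u p ≤ C * u (Ebar g) := by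
  have hα0 : 0 < α := by linarith
  obtain ⟨e, -, hq⟩ := exists_barParam (finrank ℝ (Spc m)) hlam Lam
  obtain ⟨M, hM, μ, hμ, -, hmtp⟩ := measure_to_point hlam hq
  obtain ⟨CH, hCH, hHar⟩ := exists_harnackConst hlam hM hμ hmtp
  set γ := max (1 / α - 1) (1 / 2) with hγ
  have hγ0 : 0 < γ := lt_max_of_lt_right (by norm_num)
  have hγ1 : γ < 1 := by
    refine max_lt ?_ (by norm_num)
    have : 1 / α < 2 := by rw [div_lt_iff₀ hα0]; linarith
    linarith
  obtain ⟨C, n, hC, hbd⟩ := exists_boundary_bound (m := m) hK hα0 hα1 (le_max_left _ _) hγ0 hCH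
  obtain ⟨δ, hδ0, hδ8, hbox⟩ := exists_box (m := m) α (α / (1 + α)) K hα0 (by positivity) hK
  obtain ⟨L, hL⟩ := exists_nat_gt ((2 : ℝ) ^ (m + 3) / μ)
  have hL0 : (0 : ℝ) < L := lt_of_le_of_lt (by positivity) hL
  have hM1 : 0 < M - 1 := by linarith
  set θ := 1 + 1 / (2 * (M - 1)) with hθ
  have hθ1 : 1 < θ := by
    have : 0 < 1 / (2 * (M - 1)) := by positivity
    linarith
  obtain ⟨r, N, hr0, hrs, hr⟩ :=
    exists_radii hθ1 hC (show 0 < CH ^ n by positivity) hγ0 hγ1 L hδ0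
  refine ⟨θ ^ N, by positivity, ?_⟩
  intro A hA g hg hhol u hsol hpos hvan p hp
  have hΩ := isOpen_Cyl_one hg
  have hS : ∀ q ∈ Cyl g 1, SolAt lam Lam u q := fun q hq => hsol.solAt hA hq
  have hcont := SolAt.continuousAt hCH hHar hΩ (fun q hq => (hpos q hq).le) hS
  have hcs : CylSol lam Lam g u := ⟨hg, hcont, hpos, hS⟩
  have hE : 0 < u (Ebar g) := hpos _ (Ebar_mem_Cyl g)
  have hbox' := hbox g hhol p hp
  have hmem : ∀ q ∈ closedBall p.1 δ ×ˢ Icc (p.2 - 3 * δ ^ 2) p.2, 0 < hGamma g q →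
      q ∈ Cyl g 1 := fun q hq hh => by
    obtain ⟨h1, h2, h3, h4⟩ := hbox' q hq
    exact mem_Cyl_one.2 ⟨by linarith, by linarith, by linarith, hh, by linarith⟩
  have hpC : p ∈ Cyl g 1 :=
    hmem p ⟨mem_closedBall_self hδ0.le, by nlinarith, le_rfl⟩ (sub_pos.2 hp.2.2.2.1)
  have hup : cylExt g u p = u p := if_pos hpC
  have hρ1 : ∀ i, 4 * (L * r i) ≤ δ := fun i =>
    (Finset.single_le_sum (f := fun i => 4 * (L * r i))
      (fun j _ => by have := hr0 j; positivity) (Finset.self_mem_range_succ i)).trans (hrs (i + 1))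
  have hρ0 : ∀ i, 0 < L * r i := fun i => mul_pos hL0 (hr0 i)
  have key : cylExt g u (p.1, p.2) < θ ^ N * u (Ebar g) := by
    refine blowup_bound (δ := δ) (δ' := 3 * δ ^ 2) hM hmtp (by positivity)
      (fun j => L * r j) hρ0 hrs (fun k => ?_) ?_ ?_ ?_
    · calc ∑ i ∈ Finset.range k, 41 * (L * r i) ^ 2
          ≤ ∑ i ∈ Finset.range k, 41 / 16 * δ * (4 * (L * r i)) :=
            Finset.sum_le_sum fun i _ => by nlinarith [hρ1 i, hρ0 i]
        _ = 41 / 16 * δ * ∑ i ∈ Finset.range k, 4 * (L * r i) := (Finset.mul_sum _ _ _).symm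
        _ ≤ 41 / 16 * δ * δ := by gcongr; exact hrs k
        _ ≤ 3 * δ ^ 2 := by nlinarith [sq_nonneg δ]
    · exact fun q hq => (continuousAt_cylExt hg hcont hvan (hmem q hq)).continuousWithinAt
    · intro y _ s _ hlt
      have hyC : (y, s) ∈ Cyl g 1 := by
        by_contra hc
        rw [cylExt, if_neg hc] at hlt
        have : 0 < θ ^ N * u (Ebar g) := by positivity
        linarith
      exact (hS _ hyC).congr (cylExt_eventuallyEq hg hyC)
    · intro j x t hx ht ht0
      refine (measure_mono ?_).trans_lt
        (volume_layer_lt hg hμ hL x (t - 40 * (L * r j) ^ 2) (hr0 j))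
      rintro q ⟨hqc, hlt⟩
      refine ⟨hqc, ?_⟩
      have hqC : q ∈ Cyl g 1 := by
        by_contra hc
        rw [cylExt, if_neg hc] at hlt
        have : 0 < θ ^ j * (θ ^ N * u (Ebar g)) / 2 := by positivity
        linarith
      have hqh := (mem_Cyl_one.1 hqC).2.2.2.1
      obtain ⟨hq1, hq2, hq3⟩ := hqc
      have hsq : 0 < (L * r j) ^ 2 := by have := hρ0 j; positivity
      have hqb : q ∈ closedBall p.1 δ ×ˢ Icc (p.2 - 3 * δ ^ 2) p.2 := by
        refine ⟨hx (ball_subset_closedBall (ball_subset_ball ?_ hq1)), ?_, ?_⟩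
        · linarith [hρ0 j]
        · linarith [ht.1]
        · linarith
      obtain ⟨h1, h2, h3, h4⟩ := hbox' q hqb
      have hb := hbd lam Lam g u hcs hHar hhol q.1 q.2 h1 h2 h3 hqh h4
      refine ⟨hqh, hr j _ hqh ?_⟩
      rw [cylExt, if_pos hqC] at hlt
      have h5 : θ ^ (j + N) / 2 * u (Ebar g) <
          Real.exp (C * hGamma g q ^ (-γ)) * CH ^ n * u (Ebar g) := by
        calc θ ^ (j + N) / 2 * u (Ebar g) = θ ^ j * (θ ^ N * u (Ebar g)) / 2 := by
              rw [pow_add]; ring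
          _ < u q := hlt
          _ ≤ _ := hb.trans_eq (mul_assoc _ _ _).symm
      exact lt_of_mul_lt_mul_right h5 hE.le
  rw [Prod.mk.eta, hup] at key
  exact key.le

end Carleson

end Auxiliary

/-- **Carleson estimate in Hölder domains** (Lemma 3.2). -/
theorem carleson_estimate_holder (m : ℕ) (hm : 1 ≤ m) (lam Lam K α : ℝ)
    (hlam : 0 < lam) (hlamLam : lam ≤ Lam) (hK : 0 < K)
    (hα : 1 / 2 < α) (hα1 : α ≤ 1) :
    ∃ C : ℝ, 0 < C ∧
      ∀ (A : Spc m → Matrix (Fin (m + 1)) (Fin (m + 1)) ℝ), IsElliptic lam Lam A →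
      ∀ g : Spc' m → ℝ → ℝ,
        Continuous (fun q : Spc' m × ℝ => g q.1 q.2) → g 0 0 = 0 →
        HolderSemi α (α / (1 + α)) K g →
      ∀ u : Spc m × ℝ → ℝ,
        SolvesL A u (Cyl g 1) →
        (∀ p ∈ Cyl g 1, 0 < u p) →
        VanishesOn u (Cyl g 1) (graphSet g) →
        ∀ p ∈ Cyl g (1 / 2), u p ≤ C * u (Ebar g) := by
  obtain ⟨C, hC, h⟩ := exists_carleson (m := m) lam Lam K α hlam hK hα hα1
  exact ⟨C, hC, fun A hA g hg _ => h A hA g hg⟩
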